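/- Let p ∈ (1,2], p' = p/(p−1), and h ≥ 0. There exists a constant C = C(p,h) > 0 such that for every g ∈ L^p[0,1], setting g_n := sup{𝓕[g](λ) : λ ∈ [n,n+1] × [−h,h]} for n ∈ ℤ (the rectangle Π_{h,n} := [n,n+1] × [−h,h] ⊂ ℂ), one has ∑_{n∈ℤ} g_n^{p'} ≤ C · ‖g‖_{L^p[0,1]}^{p'}. -/

import Mathlib

open MeasureTheory

/-- The "maximal" Fourier transform `𝓕[g](λ) = sup_{x ∈ [0,1]} |∫₀ˣ g(t) e^{iλt} dt|`. -/
noncomputable def maxFourier (g : ℝ → ℂ) (lam : ℂ) : ℝ :=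
  ⨆ x : Set.Icc (0:ℝ) 1, ‖∫ t in (0:ℝ)..(x : ℝ), g t * Complex.exp (Complex.I * lam * t)‖

/-- The `L^p`-norm of `g` on `[0,1]`. -/
noncomputable def lpNorm01 (p : ℝ) (g : ℝ → ℂ) : ℝ :=
  (∫ t in (0:ℝ)..1, ‖g t‖ ^ p) ^ (1 / p)

/-- `g_n := sup { 𝓕[g](λ) : λ ∈ [n, n+1] × [-h, h] }`. -/
noncomputable def rectSup (g : ℝ → ℂ) (h : ℝ) (n : ℤ) : ℝ :=
  sSup {y : ℝ | ∃ lam : ℂ, lam.re ∈ Set.Icc (n : ℝ) (n + 1) ∧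
    lam.im ∈ Set.Icc (-h) h ∧ y = maxFourier g lam}

/-! ### Dyadic blocks -/

/-- Index of the dyadic block of length `2 ^ s` containing `x`. -/
def blk (s : ℕ) (x : ℤ) : ℤ := x / 2 ^ s

/-- `x` and `y` lie in equal or adjacent dyadic blocks of length `2 ^ s`. -/
def Near (s : ℕ) (x y : ℤ) : Prop := |blk s x - blk s y| ≤ 1

instance (s : ℕ) (x y : ℤ) : Decidable (Near s x y) := by unfold Near; infer_instance

lemma blk_eq_iff {s : ℕ} {x c : ℤ} : blk s x = c ↔ c * 2 ^ s ≤ x ∧ x < (c + 1) * 2 ^ s := by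
  unfold blk
  have h2 : (0 : ℤ) < 2 ^ s := by positivity
  constructor
  · rintro rfl
    exact ⟨Int.ediv_mul_le _ h2.ne', Int.lt_ediv_add_one_mul_self _ h2⟩
  · rintro ⟨h1, h3⟩
    apply le_antisymm
    · exact Int.lt_add_one_iff.1 (Int.ediv_lt_of_lt_mul h2 h3)
    · exact (Int.le_ediv_iff_mul_le h2).2 h1

lemma blk_bounds (s : ℕ) (x : ℤ) : blk s x * 2 ^ s ≤ x ∧ x < (blk s x + 1) * 2 ^ s :=
  blk_eq_iff.1 rfl

lemma blk_add (s t : ℕ) (x : ℤ) : blk (s + t) x = blk t (blk s x) := by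
  unfold blk
  rw [pow_add, Int.ediv_ediv_of_nonneg (by positivity)]

lemma blk_mono {s t : ℕ} (h : s ≤ t) {x y : ℤ} (hxy : blk s x = blk s y) :
    blk t x = blk t y := by
  obtain ⟨k, rfl⟩ := Nat.exists_eq_add_of_le h
  rw [blk_add, blk_add, hxy]

lemma near_of_abs_lt {s : ℕ} {x y : ℤ} (h : |x - y| ≤ 2 ^ s) : Near s x y := by
  have h2 : (0 : ℤ) < 2 ^ s := by positivity
  obtain ⟨h3, h4⟩ := blk_bounds s x
  obtain ⟨h5, h6⟩ := blk_bounds s y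
  unfold Near
  rw [abs_le] at *
  constructor
  · by_contra! hc
    have : (blk s x + 1) * 2 ^ s ≤ (blk s y - 1) * 2 ^ s :=
      mul_le_mul_of_nonneg_right (by omega) h2.le
    linarith
  · by_contra! hc
    have : (blk s y + 1) * 2 ^ s ≤ (blk s x - 1) * 2 ^ s :=
      mul_le_mul_of_nonneg_right (by omega) h2.le
    linarith

lemma Near.symm {s : ℕ} {x y : ℤ} (h : Near s x y) : Near s y x := by
  unfold Near at *; rwa [abs_sub_comm]

lemma near_congr {s : ℕ} {x x' y : ℤ} (h : blk s x = blk s x') : Near s x y ↔ Near s x' y := by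
  unfold Near; rw [h]

lemma near_succ_of_abs_le_two {s : ℕ} {x y : ℤ} (h : |blk s x - blk s y| ≤ 2) :
    Near (s + 1) x y := by
  unfold Near
  rw [blk_add, blk_add]
  unfold blk at *
  rw [abs_le] at *
  omega

lemma Near.mono {s t : ℕ} (hst : s ≤ t) {x y : ℤ} (h : Near s x y) : Near t x y := by
  induction t, hst using Nat.le_induction with
  | base => exact h
  | succ n _ ih => exact near_succ_of_abs_le_two (le_trans ih (by norm_num))

lemma Near.trans_succ {s t : ℕ} (hst : s ≤ t) {x y z : ℤ} (h : Near s x y) (h' : Near t y z) :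
    Near (t + 1) x z := by
  have h := h.mono hst
  apply near_succ_of_abs_le_two
  unfold Near at *
  rw [abs_le] at *
  omega

/-- The dyadic block as a finset. -/
noncomputable def blkSet (s : ℕ) (x : ℤ) : Finset ℤ := Finset.Ico (blk s x * 2 ^ s) ((blk s x + 1) * 2 ^ s)

lemma mem_blkSet {s : ℕ} {x y : ℤ} : y ∈ blkSet s x ↔ blk s y = blk s x := by
  rw [blk_eq_iff, blkSet, Finset.mem_Ico]

lemma card_blkSet (s : ℕ) (x : ℤ) : (blkSet s x).card = 2 ^ s := by
  rw [blkSet, Int.card_Ico]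
  have : (blk s x + 1) * 2 ^ s - blk s x * 2 ^ s = ((2 ^ s : ℕ) : ℤ) := by push_cast; ring
  rw [this, Int.toNat_natCast]

lemma card_filter_near_le (W : Finset ℤ) (s : ℕ) (x : ℤ) :
    ((W.filter (fun y => Near s x y)).card : ℝ) ≤ 3 * 2 ^ s := by
  have : (W.filter (fun y => Near s x y)) ⊆
      Finset.Ico ((blk s x - 1) * 2 ^ s) ((blk s x + 2) * 2 ^ s) := by
    intro y hy
    rw [Finset.mem_filter] at hy
    rw [Finset.mem_Ico]
    have h2 : (0 : ℤ) < 2 ^ s := by positivity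
    have h := hy.2
    unfold Near at h
    rw [abs_le] at h
    obtain ⟨h5, h6⟩ := blk_bounds s y
    have h7 : (blk s x - 1) * 2 ^ s ≤ (blk s y) * 2 ^ s :=
      mul_le_mul_of_nonneg_right (by omega) h2.le
    have h8 : (blk s y + 1) * 2 ^ s ≤ (blk s x + 2) * 2 ^ s :=
      mul_le_mul_of_nonneg_right (by omega) h2.le
    constructor <;> linarith
  have h1 := Finset.card_le_card this
  rw [Int.card_Ico] at h1
  have h3 : (blk s x + 2) * 2 ^ s - (blk s x - 1) * 2 ^ s = ((3 * 2 ^ s : ℕ) : ℤ) := by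
    push_cast; ring
  rw [h3, Int.toNat_natCast] at h1
  exact_mod_cast h1

/-! ### Greedy selection and stopping times -/

lemma exists_greedy {X : Type*} [DecidableEq X] (A : Finset X) (r : X → X → Prop)
    (hrefl : ∀ x ∈ A, r x x) (hsymm : ∀ x y, r x y → r y x) (b : X → ℕ) :
    ∃ U ⊆ A, (∀ u ∈ U, ∀ v ∈ U, u ≠ v → ¬ r u v) ∧ ∀ z ∈ A, ∃ u ∈ U, r z u ∧ b z ≤ b u := by
  induction A using Finset.strongInduction with
  | H A ih =>
    rcases A.eq_empty_or_nonempty with rfl | hne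
    · exact ⟨∅, by simp, by simp, by simp⟩
    · obtain ⟨a, ha, hmin⟩ := A.exists_min_image b hne
      obtain ⟨U, hU, hp, hc⟩ := ih (A.erase a) (Finset.erase_ssubset ha)
        (fun x hx => hrefl x (Finset.mem_of_mem_erase hx))
      by_cases h : ∃ u ∈ U, r a u
      · obtain ⟨u, hu, hau⟩ := h
        refine ⟨U, hU.trans (Finset.erase_subset _ _), hp, fun z hz => ?_⟩
        by_cases hza : z = a
        · exact ⟨u, hu, hza ▸ hau, hza ▸ hmin u (Finset.mem_of_mem_erase (hU hu))⟩
        · exact hc z (Finset.mem_erase.2 ⟨hza, hz⟩)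
      · push Not at h
        refine ⟨insert a U, ?_, ?_, ?_⟩
        · exact Finset.insert_subset ha (hU.trans (Finset.erase_subset _ _))
        · intro u hu v hv huv
          rw [Finset.mem_insert] at hu hv
          rcases hu with rfl | hu <;> rcases hv with rfl | hv
          · exact absurd rfl huv
          · exact h v hv
          · exact fun hr => h u hu (hsymm _ _ hr)
          · exact hp u hu v hv huv
        · intro z hz
          by_cases hza : z = a
          · exact ⟨a, by simp, hza ▸ hrefl a ha, by rw [hza]⟩
          · obtain ⟨u, hu, h1⟩ := hc z (Finset.mem_erase.2 ⟨hza, hz⟩)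
            exact ⟨u, Finset.mem_insert_of_mem hu, h1⟩

lemma sum_le_of_stopping (Q W : Finset ℤ) (c : ℤ → ℕ) (δ : ℝ) (u g : ℤ → ℝ) (hδ : 0 ≤ δ)
    (hstab : ∀ y ∈ Q, ∀ y' ∈ Q, blk (c y) y' = blk (c y) y → c y' = c y)
    (hcard : ∀ y ∈ Q, ((Q.filter (fun y' => blk (c y) y' = blk (c y) y)).card : ℝ) ≤ δ * 2 ^ c y)
    (hW : ∀ y ∈ Q, blkSet (c y) y ⊆ W) (hg : ∀ y ∈ W, 0 ≤ g y)
    (hu : ∀ y ∈ Q, ∀ y', blk (c y) y' = blk (c y) y → u y ≤ g y') :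
    ∑ y ∈ Q, u y ≤ δ * ∑ y ∈ W, g y := by
  have h1 : ∀ y ∈ Q, u y ≤ ∑ y' ∈ W, if blk (c y) y' = blk (c y) y then g y' / 2 ^ c y else 0 := by
    intro y hy
    have h2 : ∑ y' ∈ blkSet (c y) y, g y' / 2 ^ c y ≤
        ∑ y' ∈ W, if blk (c y) y' = blk (c y) y then g y' / 2 ^ c y else 0 := by
      rw [← Finset.sum_filter]
      apply Finset.sum_le_sum_of_subset_of_nonneg
      · intro z hz
        exact Finset.mem_filter.2 ⟨hW y hy hz, mem_blkSet.1 hz⟩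
      · intro z hz _
        exact div_nonneg (hg z (Finset.mem_filter.1 hz).1) (by positivity)
    refine le_trans ?_ h2
    have h3 : ∑ y' ∈ blkSet (c y) y, u y / 2 ^ c y = u y := by
      rw [Finset.sum_const, card_blkSet, nsmul_eq_mul]
      push_cast
      field_simp
    rw [← h3]
    apply Finset.sum_le_sum
    intro z hz
    have := hu y hy z (mem_blkSet.1 hz)
    gcongr
  calc ∑ y ∈ Q, u y ≤ ∑ y ∈ Q, ∑ y' ∈ W,
        (if blk (c y) y' = blk (c y) y then g y' / 2 ^ c y else 0) := Finset.sum_le_sum h1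
    _ = ∑ y' ∈ W, ∑ y ∈ Q, (if blk (c y) y' = blk (c y) y then g y' / 2 ^ c y else 0) :=
        Finset.sum_comm
    _ ≤ ∑ y' ∈ W, δ * g y' := by
        apply Finset.sum_le_sum
        intro y' hy'
        have hg' := hg y' hy'
        rw [← Finset.sum_filter]
        set P := Q.filter (fun y => blk (c y) y' = blk (c y) y) with hP
        rcases P.eq_empty_or_nonempty with h0 | hne
        · rw [h0]; simp; positivity
        · obtain ⟨y0, hy0, hmax⟩ := P.exists_max_image c hne
          rw [hP, Finset.mem_filter] at hy0
          have key : ∀ y ∈ P, blk (c y0) y = blk (c y0) y0 ∧ c y = c y0 := by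
            intro y hy
            have h4 := hmax y hy
            rw [hP, Finset.mem_filter] at hy
            have h5 : blk (c y0) y = blk (c y0) y0 := by
              rw [← hy0.2]; exact (blk_mono h4 hy.2).symm
            exact ⟨h5, hstab y0 hy0.1 y hy.1 h5⟩
          calc ∑ y ∈ P, g y' / 2 ^ c y = ∑ y ∈ P, g y' / 2 ^ c y0 :=
                Finset.sum_congr rfl fun y hy => by rw [(key y hy).2]
            _ = P.card * (g y' / 2 ^ c y0) := by rw [Finset.sum_const, nsmul_eq_mul]
            _ ≤ (δ * 2 ^ c y0) * (g y' / 2 ^ c y0) := by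
                gcongr
                refine le_trans ?_ (hcard y0 hy0.1)
                exact_mod_cast Finset.card_le_card fun y hy =>
                  Finset.mem_filter.2 ⟨(Finset.mem_filter.1 hy).1, (key y hy).1⟩
            _ = δ * g y' := by field_simp
    _ = δ * ∑ y ∈ W, g y := by rw [Finset.mul_sum]

/-- The scale used for stopping-time arguments: the largest `c` such that no `z ∈ Z` in the
block of length `2 ^ c` around `y` has `a z ≤ c`, assuming `1 ≤ a`. -/
lemma exists_stopping (Z : Finset ℤ) (a : ℤ → ℕ) (ha : ∀ z ∈ Z, 1 ≤ a z) :
    ∃ c : ℤ → ℕ, ∀ y, (∃ z ∈ Z, ∃ t, blk t z = blk t y ∧ a z ≤ t) →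
      (∀ z ∈ Z, blk (c y) z = blk (c y) y → c y + 1 ≤ a z) ∧
      (∃ z ∈ Z, blk (c y + 1) z = blk (c y + 1) y ∧ a z ≤ c y + 1) ∧
      (∀ y', blk (c y) y' = blk (c y) y → c y' = c y) := by
  classical
  let P : ℤ → ℕ → Prop := fun y t => ∃ z ∈ Z, blk t z = blk t y ∧ a z ≤ t
  let b : ℤ → ℕ := fun y => if h : ∃ t, P y t then Nat.find h else 0
  have hb : ∀ y, (∃ t, P y t) → P y (b y) ∧ ∀ t < b y, ¬ P y t := by
    intro y h
    simp only [b, dif_pos h]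
    exact ⟨Nat.find_spec h, fun t ht => Nat.find_min h ht⟩
  have hmono : ∀ y t t', t ≤ t' → P y t → P y t' := by
    rintro y t t' htt ⟨z, hz, h1, h2⟩
    exact ⟨z, hz, blk_mono htt h1, h2.trans htt⟩
  have hcongr : ∀ y y' t, blk t y = blk t y' → P y t → P y' t := by
    rintro y y' t h ⟨z, hz, h1, h2⟩
    exact ⟨z, hz, h1.trans h, h2⟩
  refine ⟨fun y => b y - 1, fun y hy => ?_⟩
  obtain ⟨z0, hz0, t0, h1, h2⟩ := hy
  have hex : ∃ t, P y t := ⟨t0, z0, hz0, h1, h2⟩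
  obtain ⟨hP, hmin⟩ := hb y hex
  have hb1 : 1 ≤ b y := by
    obtain ⟨z, hz, _, h4⟩ := hP
    exact (ha z hz).trans h4
  have hb2 : b y - 1 + 1 = b y := by omega
  refine ⟨?_, ?_, ?_⟩
  · intro z hz h
    by_contra! hc
    exact hmin (b y - 1) (by omega) ⟨z, hz, h, Nat.lt_succ_iff.1 hc⟩
  · simp only [hb2]; exact hP
  · intro y' h
    change blk (b y - 1) y' = blk (b y - 1) y at h
    have h5 : P y' (b y) := hcongr y y' _ (blk_mono (by omega) h.symm) hP
    obtain ⟨hP', hmin'⟩ := hb y' ⟨_, h5⟩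
    have h6 : b y' ≤ b y := by
      by_contra! hc
      exact hmin' _ hc h5
    have h7 : b y ≤ b y' := by
      by_contra! hc
      have : P y (b y - 1) := hcongr y' y _ h (hmono _ _ _ (by omega) hP')
      exact hmin _ (by omega) this
    show b y' - 1 = b y - 1
    omega

/-! ### Averages and the maximal function -/

/-- Average of `f` over the three dyadic blocks of length `2 ^ s` around `x` (up to a factor). -/
noncomputable def avg (W : Finset ℤ) (s : ℕ) (f : ℤ → ℝ) (x : ℤ) : ℝ :=
  (∑ y ∈ W with Near s x y, f y) / 2 ^ s

/-- Maximal function associated to `avg`. -/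
noncomputable def mx (W : Finset ℤ) (f : ℤ → ℝ) (x : ℤ) : ℝ := ⨆ s, avg W s f x

section
variable {W : Finset ℤ} {f : ℤ → ℝ}

lemma avg_nonneg (hf : ∀ y, 0 ≤ f y) (s : ℕ) (x : ℤ) : 0 ≤ avg W s f x :=
  div_nonneg (Finset.sum_nonneg fun y _ => hf y) (by positivity)

lemma avg_le_sum (hf : ∀ y, 0 ≤ f y) (s : ℕ) (x : ℤ) : avg W s f x ≤ ∑ y ∈ W, f y := by
  have h0 : 0 ≤ ∑ y ∈ W with Near s x y, f y := Finset.sum_nonneg fun y _ => hf y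
  have h1 : (1 : ℝ) ≤ 2 ^ s := one_le_pow₀ (by norm_num)
  calc avg W s f x ≤ ∑ y ∈ W with Near s x y, f y := div_le_self h0 h1
    _ ≤ ∑ y ∈ W, f y :=
      Finset.sum_le_sum_of_subset_of_nonneg (Finset.filter_subset _ _) fun y _ _ => hf y

lemma avg_bddAbove (hf : ∀ y, 0 ≤ f y) (x : ℤ) : BddAbove (Set.range fun s => avg W s f x) :=
  ⟨∑ y ∈ W, f y, by rintro _ ⟨s, rfl⟩; exact avg_le_sum hf s x⟩

lemma avg_le_mx (hf : ∀ y, 0 ≤ f y) (s : ℕ) (x : ℤ) : avg W s f x ≤ mx W f x :=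
  le_ciSup (avg_bddAbove hf x) s

lemma mx_nonneg (hf : ∀ y, 0 ≤ f y) (x : ℤ) : 0 ≤ mx W f x :=
  (avg_nonneg hf 0 x).trans (avg_le_mx hf 0 x)

lemma avg_le_two_mul {s t : ℕ} (hf : ∀ y, 0 ≤ f y) (h : s ≤ t + 1) {x x' : ℤ}
    (hx : blk s x = blk s x') : avg W t f x ≤ 2 * avg W (t + 1) f x' := by
  unfold avg
  rw [pow_succ]
  have : ∑ y ∈ W with Near t x y, f y ≤ ∑ y ∈ W with Near (t + 1) x' y, f y := by
    apply Finset.sum_le_sum_of_subset_of_nonneg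
    · intro y hy
      rw [Finset.mem_filter] at hy ⊢
      exact ⟨hy.1, (near_congr (blk_mono h hx)).1 (hy.2.mono (by omega))⟩
    · intros; exact hf _
  calc (∑ y ∈ W with Near t x y, f y) / 2 ^ t ≤ (∑ y ∈ W with Near (t + 1) x' y, f y) / 2 ^ t := by
        gcongr
    _ = _ := by field_simp

lemma avg_le_two_mul_mx {s t : ℕ} (hf : ∀ y, 0 ≤ f y) (h : s ≤ t + 1) {x x' : ℤ}
    (hx : blk s x = blk s x') : avg W t f x ≤ 2 * mx W f x' :=
  (avg_le_two_mul hf h hx).trans (by have := avg_le_mx (W := W) hf (t + 1) x'; linarith)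

lemma exists_mx_le (hf : ∀ y, 0 ≤ f y) (x : ℤ) : ∃ s, mx W f x ≤ 2 * avg W s f x := by
  rcases (mx_nonneg (W := W) hf x).eq_or_lt with h | h
  · exact ⟨0, by rw [← h]; have := avg_nonneg (W := W) hf 0 x; positivity⟩
  · obtain ⟨s, hs⟩ := exists_lt_of_lt_ciSup (show mx W f x / 2 < ⨆ s, avg W s f x by
      change mx W f x / 2 < mx W f x; linarith)
    exact ⟨s, by linarith⟩

lemma sum_dual_avg_sq_le (k : ℤ → ℕ) (h : ℤ → ℝ) (hh : ∀ x, 0 ≤ h x) :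
    ∑ y ∈ W, (∑ x ∈ W, if Near (k x) x y then h x / 2 ^ k x else 0) ^ 2 ≤
      12 * ∑ x ∈ W, h x * avg W (k x + 1) h x := by
  set a : ℤ → ℤ → ℝ := fun x y => if Near (k x) x y then 1 / 2 ^ k x else 0 with ha
  set d : ℤ → ℤ → ℝ := fun x x' => if Near (k x + 1) x x' then 3 / 2 ^ k x else 0 with hd
  have ha0 : ∀ x y, 0 ≤ a x y := by
    intro x y; simp only [ha]; split_ifs <;> positivity
  have hd0 : ∀ x y, 0 ≤ d x y := by
    intro x y; simp only [hd]; split_ifs <;> positivity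
  have key : ∀ x x', k x' ≤ k x → ∑ y ∈ W, a x y * a x' y ≤ d x x' := by
    intro x x' hk
    by_cases hn : Near (k x + 1) x x'
    · have h1 : ∀ y ∈ W, a x y * a x' y ≤
          if Near (k x') x' y then 1 / 2 ^ k x * (1 / 2 ^ k x') else 0 := by
        intro y _
        simp only [ha]
        split_ifs <;> simp
      refine (Finset.sum_le_sum h1).trans ?_
      rw [← Finset.sum_filter, Finset.sum_const, nsmul_eq_mul]
      simp only [hd, if_pos hn]
      have := card_filter_near_le W (k x') x'
      calc _ ≤ (3 * 2 ^ k x') * ((1 : ℝ) / 2 ^ k x * (1 / 2 ^ k x')) := by gcongr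
        _ = _ := by field_simp
    · rw [Finset.sum_eq_zero]
      · exact hd0 _ _
      · intro y _
        simp only [ha]
        split_ifs with h1 h2
        · exact absurd (Near.symm (Near.trans_succ hk h2 h1.symm)) hn
        all_goals simp
  have key2 : ∀ x x', ∑ y ∈ W, a x y * a x' y ≤ d x x' + d x' x := by
    intro x x'
    rcases le_total (k x') (k x) with h1 | h1
    · exact (key x x' h1).trans (le_add_of_nonneg_right (hd0 _ _))
    · have := key x' x h1
      simp only [mul_comm (a x' _)] at this
      exact this.trans (le_add_of_nonneg_left (hd0 _ _))
  have e1 : ∀ y, (∑ x ∈ W, if Near (k x) x y then h x / 2 ^ k x else 0) = ∑ x ∈ W, h x * a x y := by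
    intro y
    refine Finset.sum_congr rfl fun x _ => ?_
    simp only [ha]; split_ifs <;> ring
  have e2 : ∀ x, 12 * (h x * avg W (k x + 1) h x) = 2 * ∑ x' ∈ W, h x * h x' * d x x' := by
    intro x
    simp only [avg, hd, mul_ite, mul_zero]
    rw [← Finset.sum_filter, ← Finset.sum_mul, ← Finset.mul_sum, pow_succ]
    field_simp
    ring
  rw [Finset.mul_sum]
  simp only [e1, e2]
  calc ∑ y ∈ W, (∑ x ∈ W, h x * a x y) ^ 2
      = ∑ x ∈ W, ∑ x' ∈ W, h x * h x' * ∑ y ∈ W, a x y * a x' y := by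
        simp only [sq, Finset.sum_mul_sum]
        rw [Finset.sum_comm]
        refine Finset.sum_congr rfl fun x _ => ?_
        rw [Finset.sum_comm]
        refine Finset.sum_congr rfl fun x' _ => ?_
        rw [Finset.mul_sum]
        exact Finset.sum_congr rfl fun y _ => by ring
    _ ≤ ∑ x ∈ W, ∑ x' ∈ W, h x * h x' * (d x x' + d x' x) := by
        gcongr with x _ x' _
        · exact mul_nonneg (hh x) (hh x')
        · exact key2 x x'
    _ = ∑ x ∈ W, ∑ x' ∈ W, h x * h x' * d x x' + ∑ x ∈ W, ∑ x' ∈ W, h x' * h x * d x' x := by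
        rw [← Finset.sum_add_distrib]
        refine Finset.sum_congr rfl fun x _ => ?_
        rw [← Finset.sum_add_distrib]
        exact Finset.sum_congr rfl fun y _ => by ring
    _ = ∑ x ∈ W, 2 * ∑ x' ∈ W, h x * h x' * d x x' := by
        rw [Finset.sum_comm (f := fun x x' => h x' * h x * d x' x), ← two_mul, Finset.mul_sum]

lemma sum_avg_sq_le (k : ℤ → ℕ) (hf : ∀ y, 0 ≤ f y) :
    ∑ x ∈ W, avg W (k x) f x ^ 2 ≤ 145 * ∑ x ∈ W, f x ^ 2 := by
  let P : ℝ → Prop := fun B => ∀ (k : ℤ → ℕ) (f : ℤ → ℝ), (∀ y, 0 ≤ f y) →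
    ∑ x ∈ W, avg W (k x) f x ^ 2 ≤ B * ∑ x ∈ W, f x ^ 2
  let S : Set ℝ := {B | 0 ≤ B ∧ P B}
  have hne : S.Nonempty := by
    refine ⟨(W.card : ℝ) * W.card, by positivity, fun k f hf => ?_⟩
    calc ∑ x ∈ W, avg W (k x) f x ^ 2 ≤ ∑ x ∈ W, (∑ y ∈ W, f y) ^ 2 := by
          gcongr with x _
          · exact avg_nonneg hf _ _
          · exact avg_le_sum hf _ _
      _ = W.card * (∑ y ∈ W, f y) ^ 2 := by rw [Finset.sum_const, nsmul_eq_mul]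
      _ ≤ W.card * (W.card * ∑ y ∈ W, f y ^ 2) := by
          gcongr
          exact sq_sum_le_card_mul_sum_sq
      _ = _ := by ring
  have hbdd : BddBelow S := ⟨0, fun B hB => hB.1⟩
  have hstep : ∀ B ∈ S, 12 * Real.sqrt B ∈ S := by
    rintro B ⟨hB, hP⟩
    refine ⟨by positivity, fun k f hf => ?_⟩
    set g : ℤ → ℝ := fun x => avg W (k x) f x with hg
    have hg0 : ∀ x, 0 ≤ g x := fun x => avg_nonneg hf _ _
    set v : ℤ → ℝ := fun y => ∑ x ∈ W, if Near (k x) x y then g x / 2 ^ k x else 0 with hv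
    have h1 : ∑ x ∈ W, g x ^ 2 = ∑ y ∈ W, v y * f y := by
      simp only [hv, Finset.sum_mul]
      rw [Finset.sum_comm]
      refine Finset.sum_congr rfl fun x _ => ?_
      have hgx : g x = (∑ y ∈ W with Near (k x) x y, f y) / 2 ^ k x := rfl
      simp only [ite_mul, zero_mul]
      rw [← Finset.sum_filter, ← Finset.mul_sum, sq]
      nth_rewrite 2 [hgx]
      ring
    have h2 := sum_dual_avg_sq_le (W := W) k g hg0
    have h3 := hP (fun x => k x + 1) g hg0
    set n := ∑ x ∈ W, g x ^ 2 with hn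
    have hn0 : 0 ≤ n := Finset.sum_nonneg fun _ _ => sq_nonneg _
    have h4 : (∑ x ∈ W, g x * avg W (k x + 1) g x) ^ 2 ≤ n * (B * n) :=
      (Finset.sum_mul_sq_le_sq_mul_sq _ _ _).trans (by gcongr)
    have h5 : (∑ x ∈ W, g x * avg W (k x + 1) g x) ≤ Real.sqrt B * n := by
      apply abs_le_of_sq_le_sq' _ (by positivity) |>.2
      rw [mul_pow, Real.sq_sqrt hB]; linarith
    have h6 : n ^ 2 ≤ (∑ y ∈ W, v y ^ 2) * ∑ y ∈ W, f y ^ 2 := by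
      rw [h1]; exact Finset.sum_mul_sq_le_sq_mul_sq _ _ _
    have hf2 : 0 ≤ ∑ y ∈ W, f y ^ 2 := Finset.sum_nonneg fun _ _ => sq_nonneg _
    have h7 : n ^ 2 ≤ (12 * (Real.sqrt B * n)) * ∑ y ∈ W, f y ^ 2 :=
      h6.trans (mul_le_mul_of_nonneg_right (h2.trans (by linarith)) hf2)
    rcases hn0.eq_or_lt with h0 | h0
    · change n ≤ _
      rw [← h0]; positivity
    · change n ≤ _
      have : n * n ≤ n * (12 * Real.sqrt B * ∑ y ∈ W, f y ^ 2) := by nlinarith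
      exact le_of_mul_le_mul_left this h0
  have hlt : sInf S < 145 := by
    by_contra! hc
    have h0 : sInf S < sInf S ^ 2 / 144 := by
      rw [lt_div_iff₀ (by norm_num)]; nlinarith
    obtain ⟨B, hB, hB2⟩ := exists_lt_of_csInf_lt hne h0
    have h1 := csInf_le hbdd (hstep B hB)
    have h2 : sInf S ^ 2 ≤ (12 * Real.sqrt B) ^ 2 := by gcongr
    rw [mul_pow, Real.sq_sqrt hB.1] at h2
    rw [lt_div_iff₀ (by norm_num)] at hB2
    linarith
  obtain ⟨B, hB, hB2⟩ := exists_lt_of_csInf_lt hne hlt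
  refine (hB.2 k f hf).trans ?_
  gcongr

lemma sum_mx_sq_le (hf : ∀ y, 0 ≤ f y) :
    ∑ x ∈ W, mx W f x ^ 2 ≤ 580 * ∑ x ∈ W, f x ^ 2 := by
  choose k hk using fun x => exists_mx_le (W := W) hf x
  calc ∑ x ∈ W, mx W f x ^ 2 ≤ ∑ x ∈ W, (2 * avg W (k x) f x) ^ 2 := by
        gcongr with x _
        · exact mx_nonneg hf x
        · exact hk x
    _ = 4 * ∑ x ∈ W, avg W (k x) f x ^ 2 := by
        rw [Finset.mul_sum]; exact Finset.sum_congr rfl fun _ _ => by ring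
    _ ≤ 4 * (145 * ∑ x ∈ W, f x ^ 2) := by gcongr; exact sum_avg_sq_le k hf
    _ = _ := by ring

open Classical in
/-- Weak type `(1,1)` bound for counting averages. -/
lemma card_maximal_le (F G : Finset ℤ) (lam : ℝ) (hlam : 0 < lam) :
    lam * ((F.filter fun x => ∃ s : ℕ, lam * 2 ^ s < ((G.filter fun y => Near s x y).card : ℝ)).card : ℝ)
      ≤ 5 * G.card := by
  set X := F.filter fun x => ∃ s : ℕ, lam * 2 ^ s < (G.filter fun y => Near s x y).card with hX
  have hs : ∀ x, ∃ s : ℕ, x ∈ X → lam * 2 ^ s < (G.filter fun y => Near s x y).card := by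
    intro x
    by_cases hx : x ∈ X
    · obtain ⟨s, hs⟩ := (Finset.mem_filter.1 hx).2
      exact ⟨s, fun _ => hs⟩
    · exact ⟨0, fun h => absurd h hx⟩
  choose k hk using hs
  let J : ℤ → Finset ℤ := fun x => G.filter fun y => Near (k x) x y
  obtain ⟨U, hU, hdis, hcov⟩ := exists_greedy X
    (fun x x' => |blk (max (k x) (k x')) x - blk (max (k x) (k x')) x'| ≤ 2)
    (by intro x _; simp) (by intro x y h; rw [max_comm, abs_sub_comm]; exact h) k
  have h1 : (X.card : ℝ) ≤ ∑ u ∈ U, 5 * 2 ^ k u := by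
    have hsub : X ⊆ U.biUnion fun u =>
        Finset.Ico ((blk (k u) u - 2) * 2 ^ k u) ((blk (k u) u + 3) * 2 ^ k u) := by
      intro z hz
      obtain ⟨u, hu, h2, h3⟩ := hcov z hz
      rw [max_eq_right h3, abs_le] at h2
      refine Finset.mem_biUnion.2 ⟨u, hu, Finset.mem_Ico.2 ?_⟩
      have hp : (0 : ℤ) < 2 ^ k u := by positivity
      obtain ⟨h5, h6⟩ := blk_bounds (k u) z
      have h7 : (blk (k u) u - 2) * 2 ^ k u ≤ (blk (k u) z) * 2 ^ k u :=
        mul_le_mul_of_nonneg_right (by omega) hp.le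
      have h8 : (blk (k u) z + 1) * 2 ^ k u ≤ (blk (k u) u + 3) * 2 ^ k u :=
        mul_le_mul_of_nonneg_right (by omega) hp.le
      constructor <;> linarith
    have := (Finset.card_le_card hsub).trans Finset.card_biUnion_le
    have h4 : (X.card : ℝ) ≤ ∑ u ∈ U, ((Finset.Ico ((blk (k u) u - 2) * 2 ^ k u)
        ((blk (k u) u + 3) * 2 ^ k u)).card : ℝ) := by exact_mod_cast this
    refine h4.trans (le_of_eq (Finset.sum_congr rfl fun u _ => ?_))
    rw [Int.card_Ico]
    have h5 : (blk (k u) u + 3) * 2 ^ k u - (blk (k u) u - 2) * 2 ^ k u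
      = ((5 * 2 ^ k u : ℕ) : ℤ) := by push_cast; ring
    rw [h5, Int.toNat_natCast]; push_cast; ring
  have h2 : ∑ u ∈ U, ((J u).card : ℝ) ≤ G.card := by
    have hd : ∀ u ∈ U, ∀ v ∈ U, u ≠ v → Disjoint (J u) (J v) := by
      intro u hu v hv huv
      rw [Finset.disjoint_left]
      intro y hy hy'
      have h3 := (Finset.mem_filter.1 hy).2.mono (le_max_left (k u) (k v))
      have h4 := (Finset.mem_filter.1 hy').2.mono (le_max_right (k u) (k v))
      apply hdis u hu v hv huv
      unfold Near at h3 h4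
      rw [abs_le] at *
      omega
    have := Finset.card_biUnion hd
    have h3 : U.biUnion J ⊆ G := by
      intro y hy
      obtain ⟨u, _, h4⟩ := Finset.mem_biUnion.1 hy
      exact (Finset.mem_filter.1 h4).1
    have h4 := Finset.card_le_card h3
    rw [this] at h4
    exact_mod_cast h4
  calc lam * (X.card : ℝ) ≤ lam * ∑ u ∈ U, 5 * 2 ^ k u := by gcongr
    _ = 5 * ∑ u ∈ U, lam * 2 ^ k u := by
        rw [Finset.mul_sum, Finset.mul_sum]; exact Finset.sum_congr rfl fun _ _ => by ring
    _ ≤ 5 * ∑ u ∈ U, ((J u).card : ℝ) := by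
        gcongr with u hu
        exact (hk u (hU hu)).le
    _ ≤ 5 * G.card := by gcongr

end

/-! ### Exponentials and summation by parts -/

/-- The character `t ↦ exp (i t)`. -/
noncomputable def ee (t : ℝ) : ℂ := Complex.exp (t * Complex.I)

lemma ee_add (s t : ℝ) : ee (s + t) = ee s * ee t := by
  simp [ee, add_mul, Complex.exp_add]

lemma ee_zero : ee 0 = 1 := by simp [ee]

lemma norm_ee (t : ℝ) : ‖ee t‖ = 1 := by simp [ee, Complex.norm_exp_ofReal_mul_I]

lemma conj_ee (t : ℝ) : (starRingEnd ℂ) (ee t) = ee (-t) := by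
  simp [ee, ← Complex.exp_conj]

lemma norm_ee_sub_one_le (t : ℝ) : ‖ee t - 1‖ ≤ |t| := by
  have := Real.norm_exp_I_mul_ofReal_sub_one_le (x := t)
  rwa [mul_comm, Real.norm_eq_abs] at this

lemma norm_ee_sub_le (s t : ℝ) : ‖ee s - ee t‖ ≤ |s - t| := by
  have : ee s - ee t = ee t * (ee (s - t) - 1) := by
    rw [mul_sub, ← ee_add]; simp
  rw [this, norm_mul, norm_ee, one_mul]
  exact norm_ee_sub_one_le _

lemma le_norm_ee_sub_one {t : ℝ} (ht : |t| ≤ 1) : |t| / 2 ≤ ‖ee t - 1‖ := by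
  have h := Complex.norm_exp_I_mul_ofReal_sub_one t
  rw [mul_comm] at h
  have h3 : |t / 2| = |t| / 2 := by rw [abs_div]; simp
  have hpi := Real.pi_gt_three
  have hpi4 := Real.pi_le_four
  have h1 : 2 / Real.pi * |t / 2| ≤ |Real.sin (t / 2)| := by
    apply Real.mul_abs_le_abs_sin
    rw [h3]; linarith
  unfold ee
  rw [h, norm_mul, Real.norm_eq_abs, Real.norm_eq_abs]
  rw [h3] at h1
  have h4 : 1 / 2 ≤ 2 / Real.pi := by
    rw [div_le_div_iff₀ (by norm_num) (by positivity)]; linarith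
  have h5 := mul_le_mul_of_nonneg_right h4 (show 0 ≤ |t| / 2 by positivity)
  norm_num at *
  linarith

lemma norm_sum_ee_mul_le {W W' : Finset ℤ} {Δ : ℝ} (hΔ : |Δ| ≤ 1) (h0 : Δ ≠ 0) (Φ : ℤ → ℂ)
    (hW : ∀ y, Φ y ≠ 0 → y ∈ W) (hW' : ∀ y, Φ y ≠ 0 → y ∈ W' ∧ y - 1 ∈ W') :
    ‖∑ y ∈ W, ee (Δ * y) * Φ y‖ ≤ 2 / |Δ| * ∑ y ∈ W', ‖Φ (y + 1) - Φ y‖ := by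
  have hs : ∀ y : ℤ, ee (Δ * y) * Φ y ≠ 0 → Φ y ≠ 0 := fun y h => right_ne_zero_of_mul h
  have e1 : ∑ᶠ y : ℤ, ee (Δ * y) * Φ y = ∑ y ∈ W, ee (Δ * y) * Φ y :=
    finsum_eq_sum_of_support_subset _ fun y hy => hW y (hs y hy)
  have e2 : ∑ᶠ y : ℤ, ee (Δ * y) * Φ y = ∑ y ∈ W', ee (Δ * y) * Φ y :=
    finsum_eq_sum_of_support_subset _ fun y hy => (hW' y (hs y hy)).1
  have e3 : ∑ᶠ y : ℤ, ee (Δ * y) * Φ y = ∑ y ∈ W', ee (Δ * (y + 1 : ℤ)) * Φ (y + 1) := by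
    rw [← finsum_comp_equiv (Equiv.addRight (1 : ℤ))]
    apply finsum_eq_sum_of_support_subset
    intro y hy
    have := (hW' (y + 1) (hs (y + 1) hy)).2
    simpa using this
  have e4 : (ee Δ - 1) * ∑ y ∈ W, ee (Δ * y) * Φ y =
      ∑ y ∈ W', ee (Δ * (y + 1 : ℤ)) * (Φ y - Φ (y + 1)) := by
    rw [sub_mul, one_mul]
    nth_rewrite 1 [← e1]
    rw [← e1, e2]
    nth_rewrite 2 [← e2]
    rw [e3, Finset.mul_sum, ← Finset.sum_sub_distrib]
    refine Finset.sum_congr rfl fun y _ => ?_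
    have : ee (Δ * (y + 1 : ℤ)) = ee Δ * ee (Δ * y) := by
      rw [← ee_add]; push_cast; ring_nf
    rw [this]; ring
  have h5 := le_norm_ee_sub_one hΔ
  have hp : 0 < |Δ| := abs_pos.2 h0
  have h6 : ‖(ee Δ - 1) * ∑ y ∈ W, ee (Δ * y) * Φ y‖ ≤ ∑ y ∈ W', ‖Φ (y + 1) - Φ y‖ := by
    rw [e4]
    refine (norm_sum_le _ _).trans (le_of_eq (Finset.sum_congr rfl fun y _ => ?_))
    rw [norm_mul, norm_ee, one_mul, norm_sub_rev]
  rw [norm_mul] at h6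
  have h7 : |Δ| / 2 * ‖∑ y ∈ W, ee (Δ * y) * Φ y‖ ≤ ∑ y ∈ W', ‖Φ (y + 1) - Φ y‖ :=
    (mul_le_mul_of_nonneg_right h5 (norm_nonneg _)).trans h6
  calc ‖∑ y ∈ W, ee (Δ * y) * Φ y‖ = 2 / |Δ| * (|Δ| / 2 * ‖∑ y ∈ W, ee (Δ * y) * Φ y‖) := by
        field_simp
    _ ≤ _ := by gcongr

/-! ### The truncated kernel -/

/-- Piecewise linear cutoff, `1` for `2|n| ≤ 2^s` and `0` for `|n| ≥ 2^s`. -/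
noncomputable def cutoff (s : ℕ) (n : ℤ) : ℝ := max 0 (min 1 (2 - 2 * |(n : ℝ)| / 2 ^ s))

/-- Smoothly truncated kernel `1 / n`. -/
noncomputable def kerR (s : ℕ) (n : ℤ) : ℝ := cutoff s n / n

/-- A single scale piece of the kernel. -/
noncomputable def kerK (t : ℕ) (n : ℤ) : ℝ := kerR (t + 1) n - kerR t n

lemma cutoff_nonneg (s : ℕ) (n : ℤ) : 0 ≤ cutoff s n := le_max_left _ _

lemma cutoff_le_one (s : ℕ) (n : ℤ) : cutoff s n ≤ 1 := max_le zero_le_one (min_le_left _ _)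

lemma cutoff_eq_zero {s : ℕ} {n : ℤ} (h : (2 : ℝ) ^ s ≤ |(n : ℝ)|) : cutoff s n = 0 := by
  unfold cutoff
  apply max_eq_left
  refine (min_le_right _ _).trans ?_
  have h1 : (1 : ℝ) ≤ |(n : ℝ)| / 2 ^ s := by rwa [le_div_iff₀ (by positivity), one_mul]
  rw [mul_div_assoc]; linarith

lemma cutoff_eq_one {s : ℕ} {n : ℤ} (h : 2 * |(n : ℝ)| ≤ 2 ^ s) : cutoff s n = 1 := by
  unfold cutoff
  have h1 : 2 * |(n : ℝ)| / 2 ^ s ≤ 1 := by rwa [div_le_one (by positivity)]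
  rw [min_eq_left (by linarith)]
  simp

lemma abs_cutoff_sub_le (s : ℕ) (m n : ℤ) :
    |cutoff s m - cutoff s n| ≤ 2 * |(m : ℝ) - n| / 2 ^ s := by
  unfold cutoff
  rw [max_comm, max_comm 0]
  refine (abs_max_sub_max_le_abs _ _ (0 : ℝ)).trans ?_
  rw [min_comm, min_comm 1]
  refine (abs_min_sub_min_le_max _ _ _ _).trans ?_
  simp only [sub_self, abs_zero]
  apply max_le _ (by positivity)
  have : 2 - 2 * |(m : ℝ)| / 2 ^ s - (2 - 2 * |(n : ℝ)| / 2 ^ s) =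
    2 * (|(n : ℝ)| - |(m : ℝ)|) / 2 ^ s := by ring
  rw [this, abs_div, abs_mul, abs_of_pos (show (0 : ℝ) < 2 ^ s by positivity),
    abs_of_pos (show (0 : ℝ) < 2 by norm_num)]
  have h3 : |(|(n : ℝ)| - |(m : ℝ)|)| ≤ |(m : ℝ) - n| := by
    rw [abs_sub_comm (m : ℝ)]; exact abs_abs_sub_abs_le _ _
  exact div_le_div_of_nonneg_right (mul_le_mul_of_nonneg_left h3 (by norm_num)) (by positivity)

lemma cutoff_mono {s t : ℕ} (h : s ≤ t) (n : ℤ) : cutoff s n ≤ cutoff t n := by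
  unfold cutoff
  have : (2 : ℝ) ^ s ≤ 2 ^ t := by gcongr; norm_num
  gcongr

lemma kerR_zero_left (n : ℤ) : kerR 0 n = 0 := by
  unfold kerR
  by_cases h : n = 0
  · simp [h]
  · rw [cutoff_eq_zero, zero_div]
    rw [pow_zero]
    exact_mod_cast Int.one_le_abs h

lemma kerR_eq_inv {s : ℕ} {n : ℤ} (h : 2 * |(n : ℝ)| ≤ 2 ^ s) : kerR s n = 1 / n := by
  rw [kerR, cutoff_eq_one h]

lemma sum_kerK {a b : ℕ} (h : a ≤ b) (n : ℤ) :
    ∑ t ∈ Finset.Ico a b, kerK t n = kerR b n - kerR a n := by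
  simp only [kerK]
  exact Finset.sum_Ico_sub (fun t => kerR t n) h

lemma kerK_eq (t : ℕ) (n : ℤ) : kerK t n = (cutoff (t + 1) n - cutoff t n) / n := by
  simp [kerK, kerR, sub_div]

lemma kerK_ne_zero {t : ℕ} {n : ℤ} (h : cutoff (t + 1) n - cutoff t n ≠ 0) :
    (2 : ℝ) ^ t < 2 * |(n : ℝ)| ∧ |(n : ℝ)| < 2 ^ (t + 1) := by
  constructor
  · by_contra! hc
    rw [cutoff_eq_one hc, cutoff_eq_one] at h
    · simp at h
    · rw [pow_succ]; linarith [show (0 : ℝ) < 2 ^ t by positivity]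
  · by_contra! hc
    rw [cutoff_eq_zero hc, cutoff_eq_zero] at h
    · simp at h
    · rw [pow_succ] at hc; linarith [show (0 : ℝ) < 2 ^ t by positivity]

lemma kerK_support {t : ℕ} {n : ℤ} (h : kerK t n ≠ 0) :
    (2 : ℝ) ^ t < 2 * |(n : ℝ)| ∧ |(n : ℝ)| < 2 ^ (t + 1) := by
  rw [kerK_eq] at h
  exact kerK_ne_zero fun h0 => h (by rw [h0, zero_div])

lemma abs_kerK_le (t : ℕ) (n : ℤ) : |kerK t n| ≤ 2 / 2 ^ t := by
  by_cases h : kerK t n = 0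
  · rw [h, abs_zero]; positivity
  · obtain ⟨h1, h2⟩ := kerK_support h
    rw [kerK_eq, abs_div]
    have h3 : |cutoff (t + 1) n - cutoff t n| ≤ 1 := by
      rw [abs_le]
      constructor <;>
      linarith [cutoff_nonneg t n, cutoff_le_one t n, cutoff_nonneg (t+1) n, cutoff_le_one (t+1) n]
    have hp : (0 : ℝ) < 2 ^ t := by positivity
    rw [div_le_div_iff₀ (by linarith) hp]
    nlinarith [abs_nonneg (cutoff (t + 1) n - cutoff t n)]

lemma abs_kerK_sub_le (t : ℕ) (n : ℤ) : |kerK t (n + 1) - kerK t n| ≤ 10 / 4 ^ t := by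
  set ψ : ℤ → ℝ := fun n => cutoff (t + 1) n - cutoff t n with hψ
  have hp : (0 : ℝ) < 2 ^ t := by positivity
  have h4 : (4 : ℝ) ^ t = 2 ^ t * 2 ^ t := by rw [← mul_pow]; norm_num
  have hL : |ψ (n + 1) - ψ n| ≤ 3 / 2 ^ t := by
    have h1 := abs_cutoff_sub_le (t + 1) (n + 1) n
    have h2 := abs_cutoff_sub_le t (n + 1) n
    have e : ((n + 1 : ℤ) : ℝ) - n = 1 := by push_cast; ring
    rw [e, abs_one, mul_one] at h1 h2
    have e2 : ψ (n + 1) - ψ n = (cutoff (t + 1) (n + 1) - cutoff (t + 1) n) -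
      (cutoff t (n + 1) - cutoff t n) := by simp only [hψ]; ring
    rw [e2]
    refine (abs_sub _ _).trans ?_
    have e3 : (2 : ℝ) / 2 ^ (t + 1) = 1 / 2 ^ t := by rw [pow_succ]; field_simp
    rw [e3] at h1
    calc _ ≤ 1 / 2 ^ t + 2 / 2 ^ t := add_le_add h1 h2
      _ = (3 : ℝ) / 2 ^ t := by ring
  have hinv : ∀ m : ℤ, (2 : ℝ) ^ t < 2 * |(m : ℝ)| → |(m : ℝ)|⁻¹ ≤ 2 / 2 ^ t := by
    intro m hm
    rw [inv_eq_one_div, div_le_div_iff₀ (by linarith) hp]; linarith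
  have hle : (6 : ℝ) / 4 ^ t ≤ 10 / 4 ^ t := by gcongr; norm_num
  rw [kerK_eq, kerK_eq]
  change |ψ (n + 1) / (n + 1 : ℤ) - ψ n / n| ≤ _
  by_cases h1 : ψ (n + 1) = 0
  · by_cases h2 : ψ n = 0
    · rw [h1, h2]; simp; positivity
    · have h3 := hinv n (kerK_ne_zero h2).1
      rw [h1, zero_sub, abs_neg] at hL
      rw [h1, zero_div, zero_sub, abs_neg, abs_div, div_eq_mul_inv]
      refine le_trans ?_ hle
      calc _ ≤ (3 : ℝ) / 2 ^ t * (2 / 2 ^ t) := by gcongr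
        _ = _ := by rw [h4]; field_simp; norm_num
  · have h3 := hinv _ (kerK_ne_zero h1).1
    by_cases h2 : ψ n = 0
    · rw [h2, sub_zero] at hL
      rw [h2, zero_div, sub_zero, abs_div, div_eq_mul_inv]
      refine le_trans ?_ hle
      calc _ ≤ (3 : ℝ) / 2 ^ t * (2 / 2 ^ t) := by gcongr
        _ = _ := by rw [h4]; field_simp; norm_num
    · have h5 := hinv n (kerK_ne_zero h2).1
      have hψ1 : |ψ n| ≤ 1 := by
        rw [abs_le]
        constructor <;>
        linarith [cutoff_nonneg t n, cutoff_le_one t n, cutoff_nonneg (t+1) n,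
          cutoff_le_one (t+1) n]
      have hn0 : (n : ℝ) ≠ 0 := by
        intro h; have := (kerK_ne_zero h2).1; rw [h] at this; simp at this; linarith
      have hn1 : ((n + 1 : ℤ) : ℝ) ≠ 0 := by
        intro h; have := (kerK_ne_zero h1).1; rw [h] at this; simp at this; linarith
      have e : ψ (n + 1) / (n + 1 : ℤ) - ψ n / n = (ψ (n + 1) - ψ n) * ((n + 1 : ℤ) : ℝ)⁻¹
          - ψ n * ((n : ℝ)⁻¹ * ((n + 1 : ℤ) : ℝ)⁻¹) := by
        field_simp
        push_cast
        ring
      rw [e]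
      refine (abs_sub _ _).trans ?_
      rw [abs_mul, abs_mul, abs_mul, abs_inv, abs_inv]
      calc _ ≤ (3 : ℝ) / 2 ^ t * (2 / 2 ^ t) + 1 * (2 / 2 ^ t * (2 / 2 ^ t)) := by gcongr
        _ = _ := by rw [h4]; field_simp; norm_num

/-! ### The discrete Hilbert transform -/

lemma integral_ee_mul (n : ℤ) :
    ∫ t in (-Real.pi)..Real.pi, ee (n * t) = if n = 0 then (2 * Real.pi : ℂ) else 0 := by
  split_ifs with h
  · subst h
    simp [ee_zero]
    ring
  · have hc : (n : ℂ) * Complex.I ≠ 0 := by simp [h]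
    have : ∀ t : ℝ, ee (n * t) = Complex.exp ((n * Complex.I) * t) := by
      intro t; unfold ee; push_cast; ring_nf
    simp_rw [this]
    rw [integral_exp_mul_complex hc]
    have h1 : Complex.exp (n * Complex.I * (Real.pi : ℝ)) =
        Complex.exp (n * Complex.I * ((-Real.pi : ℝ) : ℂ)) := by
      rw [Complex.exp_eq_exp_iff_exists_int]
      exact ⟨n, by push_cast; ring⟩
    rw [h1, sub_self, zero_div]

lemma ee_int_mul_pi (n : ℤ) : ee (n * Real.pi) = (-1) ^ n := by
  have : ee (n * Real.pi) = Complex.exp (Real.pi * Complex.I) ^ n := by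
    rw [← Complex.exp_int_mul]
    unfold ee; push_cast; ring_nf
  rw [this, Complex.exp_pi_mul_I]

lemma continuous_ee : Continuous ee := by
  unfold ee; fun_prop

lemma integral_mul_ee (n : ℤ) :
    ∫ t in (-Real.pi)..Real.pi, (t : ℂ) * ee (n * t) =
      -Complex.I * (2 * Real.pi * (-1) ^ n) * (1 / (n : ℂ)) := by
  by_cases h : n = 0
  · subst h
    simp only [Int.cast_zero, zero_mul, ee_zero, mul_one, div_zero, mul_zero]
    rw [intervalIntegral.integral_ofReal]
    simp
  · have hn : (n : ℂ) ≠ 0 := by exact_mod_cast h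
    have hd : ∀ t : ℝ, HasDerivAt (fun t : ℝ => (-Complex.I * t / n + 1 / (n : ℂ) ^ 2) * ee (n * t))
        ((t : ℂ) * ee (n * t)) t := by
      intro t
      have h1 : HasDerivAt (fun t : ℝ => (t : ℂ)) 1 t := Complex.ofRealCLM.hasDerivAt
      have h2 : HasDerivAt (fun t : ℝ => ee (n * t)) (ee (n * t) * (n * Complex.I)) t := by
        unfold ee
        have := (((h1.const_mul (n : ℂ)).mul_const Complex.I)).cexp
        simpa using this
      have h3 : HasDerivAt (fun t : ℝ => (-Complex.I * (t : ℂ) / n + 1 / (n : ℂ) ^ 2))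
          (-Complex.I * 1 / n) t :=
        ((h1.const_mul (-Complex.I)).div_const (n : ℂ)).add_const _
      refine (h3.mul h2).congr_deriv ?_
      field_simp
      ring_nf
      simp
    rw [intervalIntegral.integral_eq_sub_of_hasDerivAt (fun t _ => hd t)]
    · have h1 := ee_int_mul_pi n
      have h2 : ee (n * -Real.pi) = (-1) ^ n := by
        have := ee_int_mul_pi (-n)
        push_cast at this
        rw [mul_neg, ← neg_mul, this, zpow_neg, ← inv_zpow]
        norm_num
      rw [h1, h2]
      push_cast
      ring
    · apply Continuous.intervalIntegrable
      have := continuous_ee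
      fun_prop

lemma integral_norm_sq_sum (X : Finset ℤ) (h : ℤ → ℂ) :
    ∫ t in (-Real.pi)..Real.pi, ‖∑ x ∈ X, h x * ee (x * t)‖ ^ 2 =
      2 * Real.pi * ∑ x ∈ X, ‖h x‖ ^ 2 := by
  have hee := continuous_ee
  have e1 : ∀ t : ℝ, ((‖∑ x ∈ X, h x * ee (x * t)‖ ^ 2 : ℝ) : ℂ) =
      ∑ x ∈ X, ∑ y ∈ X, h x * (starRingEnd ℂ) (h y) * ee ((x - y : ℤ) * t) := by
    intro t
    push_cast
    rw [← Complex.mul_conj', map_sum, Finset.sum_mul_sum]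
    refine Finset.sum_congr rfl fun x _ => Finset.sum_congr rfl fun y _ => ?_
    have : ((x : ℝ) - y) * t = x * t + -(y * t) := by ring
    rw [map_mul, conj_ee, this, ee_add]
    ring
  have e2 : ((∫ t in (-Real.pi)..Real.pi, ‖∑ x ∈ X, h x * ee (x * t)‖ ^ 2 : ℝ) : ℂ) =
      ((2 * Real.pi * ∑ x ∈ X, ‖h x‖ ^ 2 : ℝ) : ℂ) := by
    rw [← intervalIntegral.integral_ofReal]
    simp_rw [e1]
    rw [intervalIntegral.integral_finsetSum]
    · rw [Finset.mul_sum, Complex.ofReal_sum]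
      refine Finset.sum_congr rfl fun x hx => ?_
      rw [intervalIntegral.integral_finsetSum]
      · rw [Finset.sum_eq_single x]
        · rw [intervalIntegral.integral_const_mul, integral_ee_mul, if_pos (sub_self x),
            Complex.mul_conj']
          push_cast
          ring
        · intro y _ hy
          rw [intervalIntegral.integral_const_mul, integral_ee_mul, if_neg, mul_zero]
          intro h0; exact hy (sub_eq_zero.1 h0).symm
        · exact fun h0 => absurd hx h0
      · intro y _; apply Continuous.intervalIntegrable; fun_prop
    · intro y _; apply Continuous.intervalIntegrable; fun_prop
  exact_mod_cast e2

/-- Truncated discrete Hilbert transform. -/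
noncomputable def hilb (W : Finset ℤ) (f : ℤ → ℂ) (x : ℤ) : ℂ :=
  ∑ y ∈ W, f y / ((x : ℂ) - y)

lemma norm_bilin_hilb_le (X W : Finset ℤ) (h f : ℤ → ℂ) :
    ‖∑ x ∈ X, h x * hilb W f x‖ ≤
      Real.pi / 2 * (∑ x ∈ X, ‖h x‖ ^ 2 + ∑ y ∈ W, ‖f y‖ ^ 2) := by
  have hee := continuous_ee
  set P : ℝ → ℂ := fun t => ∑ x ∈ X, (h x * (-1) ^ x) * ee (x * t) with hP
  set Q : ℝ → ℂ := fun t => ∑ y ∈ W, (f y * (-1) ^ y) * ee (y * t) with hQ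
  have hPc : Continuous P := by simp only [hP]; fun_prop
  have hQc : Continuous Q := by simp only [hQ]; fun_prop
  have hn1 : ∀ (z : ℂ) (x : ℤ), ‖z * (-1) ^ x‖ = ‖z‖ := by
    intro z x; rw [norm_mul, norm_zpow]; simp
  have hPi : ∫ t in (-Real.pi)..Real.pi, ‖P t‖ ^ 2 = 2 * Real.pi * ∑ x ∈ X, ‖h x‖ ^ 2 := by
    simp only [hP]; rw [integral_norm_sq_sum]; simp only [hn1]
  have hQi : ∫ t in (-Real.pi)..Real.pi, ‖Q t‖ ^ 2 = 2 * Real.pi * ∑ x ∈ W, ‖f x‖ ^ 2 := by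
    simp only [hQ]; rw [integral_norm_sq_sum]; simp only [hn1]
  have hpi := Real.pi_pos
  have key : ∫ t in (-Real.pi)..Real.pi, (t : ℂ) * (P t * Q (-t)) =
      -Complex.I * (2 * Real.pi) * ∑ x ∈ X, h x * hilb W f x := by
    have e1 : ∀ t : ℝ, (t : ℂ) * (P t * Q (-t)) = ∑ x ∈ X, ∑ y ∈ W,
        (h x * (-1) ^ x * (f y * (-1) ^ y)) * ((t : ℂ) * ee ((x - y : ℤ) * t)) := by
      intro t
      simp only [hP, hQ]
      rw [Finset.sum_mul_sum, Finset.mul_sum]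
      refine Finset.sum_congr rfl fun x _ => ?_
      rw [Finset.mul_sum]
      refine Finset.sum_congr rfl fun y _ => ?_
      have : (((x - y : ℤ) : ℝ)) * t = x * t + y * -t := by push_cast; ring
      rw [this, ee_add]
      ring
    simp_rw [e1]
    rw [intervalIntegral.integral_finsetSum, Finset.mul_sum]
    · refine Finset.sum_congr rfl fun x hx => ?_
      rw [intervalIntegral.integral_finsetSum, hilb, Finset.mul_sum, Finset.mul_sum]
      · refine Finset.sum_congr rfl fun y _ => ?_
        rw [intervalIntegral.integral_const_mul, integral_mul_ee]
        have h1 : ((-1 : ℂ)) ^ (x - y) * (-1) ^ x * (-1) ^ y = 1 := by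
          rw [← zpow_add₀ (by norm_num), ← zpow_add₀ (by norm_num)]
          have : x - y + x + y = 2 * x := by ring
          rw [this, zpow_mul]; norm_num
        push_cast
        linear_combination (-Complex.I * (2 * Real.pi) * h x * f y * (1 / ((x : ℂ) - y))) * h1
      · intro y _; apply Continuous.intervalIntegrable; fun_prop
    · intro y _; apply Continuous.intervalIntegrable; fun_prop
  have hbound : ‖∫ t in (-Real.pi)..Real.pi, (t : ℂ) * (P t * Q (-t))‖ ≤
      ∫ t in (-Real.pi)..Real.pi, Real.pi / 2 * (‖P t‖ ^ 2 + ‖Q (-t)‖ ^ 2) := by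
    apply intervalIntegral.norm_integral_le_of_norm_le (by linarith)
    · filter_upwards with t ht
      rw [norm_mul, norm_mul, Complex.norm_real, Real.norm_eq_abs]
      have h1 : |t| ≤ Real.pi := abs_le.2 ⟨ht.1.le, ht.2⟩
      have h2 : ‖P t‖ * ‖Q (-t)‖ ≤ (‖P t‖ ^ 2 + ‖Q (-t)‖ ^ 2) / 2 := by
        nlinarith [sq_nonneg (‖P t‖ - ‖Q (-t)‖)]
      calc |t| * (‖P t‖ * ‖Q (-t)‖) ≤ Real.pi * ((‖P t‖ ^ 2 + ‖Q (-t)‖ ^ 2) / 2) := by gcongr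
        _ = _ := by ring
    · apply Continuous.intervalIntegrable; fun_prop
  rw [key, intervalIntegral.integral_const_mul, intervalIntegral.integral_add,
    intervalIntegral.integral_comp_neg (fun t => ‖Q t‖ ^ 2), neg_neg, hPi, hQi] at hbound
  · rw [norm_mul] at hbound
    have : ‖-Complex.I * (2 * (Real.pi : ℂ))‖ = 2 * Real.pi := by
      simp [abs_of_pos hpi]
    rw [this] at hbound
    have h2 : (2 * Real.pi) * ‖∑ x ∈ X, h x * hilb W f x‖ ≤ (2 * Real.pi) *
      (Real.pi / 2 * (∑ x ∈ X, ‖h x‖ ^ 2 + ∑ y ∈ W, ‖f y‖ ^ 2)) := by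
      refine hbound.trans (le_of_eq ?_); ring
    exact le_of_mul_le_mul_left h2 (by positivity)
  · apply Continuous.intervalIntegrable; fun_prop
  · apply Continuous.intervalIntegrable; fun_prop

lemma sum_hilb_sq_le (X W : Finset ℤ) (f : ℤ → ℂ) :
    ∑ x ∈ X, ‖hilb W f x‖ ^ 2 ≤ 10 * ∑ y ∈ W, ‖f y‖ ^ 2 := by
  have hpi := Real.pi_pos
  have h := norm_bilin_hilb_le X W
    (fun x => ((1 / Real.pi : ℝ) : ℂ) * (starRingEnd ℂ) (hilb W f x)) f
  set A := ∑ x ∈ X, ‖hilb W f x‖ ^ 2 with hA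
  set F := ∑ y ∈ W, ‖f y‖ ^ 2 with hF
  have hF0 : 0 ≤ F := Finset.sum_nonneg fun _ _ => sq_nonneg _
  have e1 : ∑ x ∈ X, ((1 / Real.pi : ℝ) : ℂ) * (starRingEnd ℂ) (hilb W f x) * hilb W f x =
      ((1 / Real.pi * A : ℝ) : ℂ) := by
    rw [hA, Finset.mul_sum]
    push_cast
    refine Finset.sum_congr rfl fun x _ => ?_
    rw [mul_assoc, mul_comm (starRingEnd ℂ _), Complex.mul_conj']
  have e2 : ∑ x ∈ X, ‖((1 / Real.pi : ℝ) : ℂ) * (starRingEnd ℂ) (hilb W f x)‖ ^ 2 =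
      (1 / Real.pi) ^ 2 * A := by
    rw [hA, Finset.mul_sum]
    refine Finset.sum_congr rfl fun x _ => ?_
    rw [norm_mul, Complex.norm_real, RCLike.norm_conj, mul_pow, Real.norm_eq_abs, sq_abs]
  rw [e1, e2, Complex.norm_real, Real.norm_eq_abs] at h
  have h1 := (le_abs_self _).trans h
  have h2 : A ≤ Real.pi ^ 2 * F := by
    have : 2 * Real.pi * (1 / Real.pi * A) ≤
        2 * Real.pi * (Real.pi / 2 * ((1 / Real.pi) ^ 2 * A + F)) := by gcongr
    have e3 : 2 * Real.pi * (1 / Real.pi * A) = 2 * A := by field_simp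
    have e4 : 2 * Real.pi * (Real.pi / 2 * ((1 / Real.pi) ^ 2 * A + F)) = A + Real.pi ^ 2 * F := by
      field_simp
    linarith
  refine h2.trans ?_
  gcongr
  have := Real.pi_lt_d2
  nlinarith

/-! ### Cotlar's inequality -/

lemma sum_tent (m : ℕ) : ∑ w ∈ Finset.Icc (-(m : ℤ)) m, ((m : ℝ) - |(w : ℝ)|) = m ^ 2 := by
  induction m with
  | zero => simp
  | succ m ih =>
    have hsub : Finset.Icc (-(m : ℤ)) m ⊆ Finset.Icc (-((m + 1 : ℕ) : ℤ)) ((m + 1 : ℕ) : ℤ) := by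
      intro w hw
      rw [Finset.mem_Icc] at hw ⊢
      push_cast
      omega
    rw [← Finset.sum_subset hsub]
    · have : ∀ w : ℤ, (((m + 1 : ℕ) : ℝ) - |(w : ℝ)|) = ((m : ℝ) - |(w : ℝ)|) + 1 := by
        intro w; push_cast; ring
      simp_rw [this]
      rw [Finset.sum_add_distrib, ih, Finset.sum_const, Int.card_Icc]
      have h2 : ((m : ℤ) + 1 - -(m : ℤ)) = ((2 * m + 1 : ℕ) : ℤ) := by push_cast; ring
      rw [h2, Int.toNat_natCast]
      simp
      ring
    · intro w hw hw'
      rw [Finset.mem_Icc] at hw hw'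
      push_cast at hw
      have h3 : |w| = m + 1 := by
        rcases abs_cases w with ⟨h, _⟩ | ⟨h, _⟩ <;> rw [h] <;> omega
      have h4 : |(w : ℝ)| = m + 1 := by exact_mod_cast h3
      rw [h4]; push_cast; ring

/-- Normalized tent function of width `2 ^ s`. -/
noncomputable def tent (s : ℕ) (w : ℤ) : ℝ := max 0 (2 ^ s - |(w : ℝ)|) / 4 ^ s

lemma tent_nonneg (s : ℕ) (w : ℤ) : 0 ≤ tent s w :=
  div_nonneg (le_max_left _ _) (by positivity)

lemma four_pow_eq (s : ℕ) : (4 : ℝ) ^ s = 2 ^ s * 2 ^ s := by rw [← mul_pow]; norm_num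

lemma tent_le (s : ℕ) (w : ℤ) : tent s w ≤ 1 / 2 ^ s := by
  unfold tent
  have h1 : max 0 (2 ^ s - |(w : ℝ)|) ≤ 2 ^ s :=
    max_le (by positivity) (by linarith [abs_nonneg (w : ℝ)])
  rw [div_le_div_iff₀ (by positivity) (by positivity), four_pow_eq]
  nlinarith [show (0 : ℝ) < 2 ^ s by positivity]

lemma tent_eq_zero {s : ℕ} {w : ℤ} (h : 2 ^ s ≤ |(w : ℝ)|) : tent s w = 0 := by
  unfold tent
  rw [max_eq_left (by linarith), zero_div]

lemma abs_tent_sub_le (s : ℕ) (v w : ℤ) : |tent s v - tent s w| ≤ |(v : ℝ) - w| / 4 ^ s := by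
  unfold tent
  rw [← sub_div, abs_div, abs_of_pos (show (0 : ℝ) < 4 ^ s by positivity)]
  refine div_le_div_of_nonneg_right ?_ (by positivity)
  rw [max_comm, max_comm 0]
  refine (abs_max_sub_max_le_abs _ _ (0 : ℝ)).trans ?_
  have : (2 : ℝ) ^ s - |(v : ℝ)| - (2 ^ s - |(w : ℝ)|) = |(w : ℝ)| - |(v : ℝ)| := by ring
  rw [this, abs_sub_comm (v : ℝ)]
  exact abs_abs_sub_abs_le _ _

lemma sum_tent_eq_one (s : ℕ) : ∑ w ∈ Finset.Icc (-(2 ^ s : ℤ)) (2 ^ s), tent s w = 1 := by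
  have h := sum_tent (2 ^ s)
  push_cast at h
  have : ∀ w ∈ Finset.Icc (-(2 ^ s : ℤ)) (2 ^ s), tent s w = (2 ^ s - |(w : ℝ)|) / 4 ^ s := by
    intro w hw
    rw [Finset.mem_Icc] at hw
    have : |w| ≤ 2 ^ s := abs_le.2 hw
    have h2 : |(w : ℝ)| ≤ 2 ^ s := by exact_mod_cast this
    unfold tent
    rw [max_eq_right (by linarith)]
  rw [Finset.sum_congr rfl this, ← Finset.sum_div, h, four_pow_eq]
  field_simp

/-- The tent average of the kernel `1 / n`. -/
noncomputable def tentKer (s : ℕ) (n : ℤ) : ℝ :=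
  ∑ w ∈ Finset.Icc (-(2 ^ s : ℤ)) (2 ^ s), tent s w / ((n : ℝ) - w)

lemma abs_tentKer_le {s : ℕ} {n : ℤ} (hn : |n| < 2 * 2 ^ s) : |tentKer s n| ≤ 7 / 2 ^ s := by
  set M : ℤ := 3 * 2 ^ s with hM
  have hp : (1 : ℤ) ≤ 2 ^ s := one_le_pow₀ (by norm_num)
  have hpR : (1 : ℝ) ≤ 2 ^ s := one_le_pow₀ (by norm_num)
  have hzero : ∀ v : ℤ, v ∉ Finset.Icc (-(2 ^ s : ℤ)) (2 ^ s) → tent s v = 0 := by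
    intro v hv
    apply tent_eq_zero
    rw [Finset.mem_Icc, ← abs_le] at hv
    push Not at hv
    exact_mod_cast hv.le
  have e1 : tentKer s n = ∑ u ∈ Finset.Icc (-M) M, tent s (n - u) / (u : ℝ) := by
    have h1 : tentKer s n = ∑ w ∈ Finset.Icc (n - M) (n + M), tent s w / ((n : ℝ) - w) := by
      unfold tentKer
      apply Finset.sum_subset
      · intro w hw
        rw [Finset.mem_Icc] at hw ⊢
        rw [abs_lt] at hn
        constructor <;> linarith
      · intro w _ hw
        rw [hzero w hw, zero_div]
    rw [h1]
    refine Finset.sum_nbij' (fun w => n - w) (fun u => n - u) ?_ ?_ ?_ ?_ ?_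
    · intro w hw; simp only [Finset.mem_Icc] at hw ⊢; omega
    · intro w hw; simp only [Finset.mem_Icc] at hw ⊢; omega
    · intro w _; ring
    · intro w _; ring
    · intro w _; simp
  have e2 : tentKer s n = ∑ u ∈ Finset.Icc (-M) M, -(tent s (n + u) / (u : ℝ)) := by
    rw [e1]
    refine Finset.sum_nbij' (fun w => - w) (fun u => - u) ?_ ?_ ?_ ?_ ?_
    · intro w hw; simp only [Finset.mem_Icc] at hw ⊢; omega
    · intro w hw; simp only [Finset.mem_Icc] at hw ⊢; omega
    · intro w _; ring
    · intro w _; ring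
    · intro w _; push_cast; rw [div_neg, neg_neg, sub_eq_add_neg]
  have e3 : 2 * tentKer s n = ∑ u ∈ Finset.Icc (-M) M, (tent s (n - u) - tent s (n + u)) / u := by
    rw [two_mul]
    nth_rewrite 1 [e1]
    rw [e2, ← Finset.sum_add_distrib]
    exact Finset.sum_congr rfl fun u _ => by ring
  have h4 : |2 * tentKer s n| ≤ ∑ u ∈ Finset.Icc (-M) M, (2 : ℝ) / 4 ^ s := by
    rw [e3]
    refine (Finset.abs_sum_le_sum_abs _ _).trans (Finset.sum_le_sum fun u _ => ?_)
    rw [abs_div]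
    by_cases hu : u = 0
    · subst hu; simp; positivity
    · have hu' : 0 < |(u : ℝ)| := abs_pos.2 (by exact_mod_cast hu)
      rw [div_le_iff₀ hu']
      refine (abs_tent_sub_le _ _ _).trans (le_of_eq ?_)
      push_cast
      have : (n : ℝ) - u - (n + u) = -(2 * u) := by ring
      rw [this, abs_neg, abs_mul, abs_of_pos (show (0 : ℝ) < 2 by norm_num)]
      ring
  rw [Finset.sum_const, Int.card_Icc, nsmul_eq_mul, abs_mul] at h4
  have h5 : M + 1 - -M = ((6 * 2 ^ s + 1 : ℕ) : ℤ) := by rw [hM]; push_cast; ring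
  rw [h5, Int.toNat_natCast, abs_of_pos (show (0 : ℝ) < 2 by norm_num), four_pow_eq] at h4
  push_cast at h4
  have h6 : (6 * 2 ^ s + 1 : ℝ) * (2 / (2 ^ s * 2 ^ s)) ≤ 14 / 2 ^ s := by
    rw [mul_div_assoc', div_le_div_iff₀ (by positivity) (by positivity)]
    nlinarith
  have h7 : (14 : ℝ) / 2 ^ s = 2 * (7 / 2 ^ s) := by ring
  linarith

lemma abs_tentKer_sub_le_of_lt {s : ℕ} {n : ℤ} (hn : |n| < 2 * 2 ^ s) :
    |tentKer s n - (1 - cutoff s n) / n| ≤ 9 / 2 ^ s := by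
  have h1 := abs_tentKer_le hn
  have h2 : |(1 - cutoff s n) / n| ≤ 2 / 2 ^ s := by
    by_cases h : 2 * |(n : ℝ)| ≤ 2 ^ s
    · rw [cutoff_eq_one h]; simp; positivity
    · push Not at h
      rw [abs_div, div_le_div_iff₀ (by linarith [show (0 : ℝ) < 2 ^ s by positivity])
        (by positivity)]
      have : |1 - cutoff s n| ≤ 1 := by
        rw [abs_le]; constructor <;> linarith [cutoff_nonneg s n, cutoff_le_one s n]
      nlinarith [abs_nonneg (1 - cutoff s n), show (0 : ℝ) < 2 ^ s by positivity]
  refine (abs_sub _ _).trans ?_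
  calc _ ≤ 7 / 2 ^ s + (2 : ℝ) / 2 ^ s := add_le_add h1 h2
    _ = _ := by ring

lemma abs_tentKer_sub_le_of_le {s : ℕ} {n : ℤ} (hn : 2 * 2 ^ s ≤ |(n : ℝ)|) :
    |tentKer s n - (1 - cutoff s n) / n| ≤ 2 * 2 ^ s / (n : ℝ) ^ 2 := by
  have hp : (0 : ℝ) < 2 ^ s := by positivity
  have hn0 : (n : ℝ) ≠ 0 := by
    intro h; rw [h, abs_zero] at hn; linarith
  rw [cutoff_eq_zero (by linarith), sub_zero]
  have e : tentKer s n - 1 / n = ∑ w ∈ Finset.Icc (-(2 ^ s : ℤ)) (2 ^ s),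
      tent s w * (1 / ((n : ℝ) - w) - 1 / n) := by
    simp only [mul_sub]
    rw [Finset.sum_sub_distrib, ← Finset.sum_mul, sum_tent_eq_one, one_mul]
    congr 1
    exact Finset.sum_congr rfl fun w _ => by ring
  rw [e]
  refine (Finset.abs_sum_le_sum_abs _ _).trans ?_
  have : ∀ w ∈ Finset.Icc (-(2 ^ s : ℤ)) (2 ^ s),
      |tent s w * (1 / ((n : ℝ) - w) - 1 / n)| ≤ tent s w * (2 * 2 ^ s / (n : ℝ) ^ 2) := by
    intro w hw
    rw [Finset.mem_Icc, ← abs_le] at hw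
    have hw' : |(w : ℝ)| ≤ 2 ^ s := by exact_mod_cast hw
    rw [abs_mul, abs_of_nonneg (tent_nonneg s w)]
    refine mul_le_mul_of_nonneg_left ?_ (tent_nonneg s w)
    have h1 : |(n : ℝ)| - |(w : ℝ)| ≤ |(n : ℝ) - w| := abs_sub_abs_le_abs_sub _ _
    have h2 : |(n : ℝ)| / 2 ≤ |(n : ℝ) - w| := by linarith
    have h3 : (n : ℝ) - w ≠ 0 := by
      intro h; rw [h, abs_zero] at h2; linarith
    have e2 : 1 / ((n : ℝ) - w) - 1 / n = w / (n * (n - w)) := by field_simp; ring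
    rw [e2, abs_div, abs_mul, ← sq_abs (n : ℝ)]
    have hnp : 0 < |(n : ℝ)| := abs_pos.2 hn0
    rw [div_le_div_iff₀ (by positivity) (by positivity)]
    calc |(w : ℝ)| * |(n : ℝ)| ^ 2 ≤ 2 ^ s * |(n : ℝ)| ^ 2 := by gcongr
      _ = 2 * 2 ^ s * (|(n : ℝ)| * (|(n : ℝ)| / 2)) := by ring
      _ ≤ _ := by gcongr
  refine (Finset.sum_le_sum this).trans ?_
  rw [← Finset.sum_mul, sum_tent_eq_one, one_mul]

lemma exists_tentKer_sub_le (s T : ℕ) (hs : s ≤ T) (n : ℤ) (hn : |n| ≤ 2 ^ T) :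
    ∃ t ∈ Finset.Icc s T, |n| ≤ 2 ^ t ∧
      |tentKer s n - (1 - cutoff s n) / n| ≤ 36 * 2 ^ s / 4 ^ t := by
  by_cases h0 : |n| ≤ 2 ^ s
  · refine ⟨s, Finset.mem_Icc.2 ⟨le_rfl, hs⟩, h0, ?_⟩
    have hp : (1 : ℤ) ≤ 2 ^ s := one_le_pow₀ (by norm_num)
    refine (abs_tentKer_sub_le_of_lt (by linarith)).trans ?_
    rw [four_pow_eq, div_le_div_iff₀ (by positivity) (by positivity)]
    nlinarith [show (0 : ℝ) < 2 ^ s * 2 ^ s by positivity]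
  · have hex : ∃ t, |n| ≤ 2 ^ t := ⟨T, hn⟩
    set t := Nat.find hex with ht
    have h1 : |n| ≤ 2 ^ t := Nat.find_spec hex
    have h2 : t ≤ T := Nat.find_min' hex hn
    have h3 : s < t := by
      by_contra! hc
      exact h0 (h1.trans (pow_le_pow_right₀ (by norm_num) hc))
    have h4 : 2 ^ (t - 1) < |n| := by
      have := Nat.find_min hex (show t - 1 < t by omega)
      push Not at this; exact this
    refine ⟨t, Finset.mem_Icc.2 ⟨h3.le, h2⟩, h1, ?_⟩
    by_cases h5 : |n| < 2 * 2 ^ s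
    · have h6 : t = s + 1 := by
        apply le_antisymm _ h3
        apply Nat.find_min' hex
        rw [pow_succ]; linarith
      refine (abs_tentKer_sub_le_of_lt h5).trans ?_
      rw [h6, pow_succ, four_pow_eq, div_le_div_iff₀ (by positivity) (by positivity)]
      nlinarith [show (0 : ℝ) < 2 ^ s * 2 ^ s by positivity]
    · push Not at h5
      have h5' : 2 * 2 ^ s ≤ |(n : ℝ)| := by exact_mod_cast h5
      have h4' : (2 : ℝ) ^ (t - 1) < |(n : ℝ)| := by exact_mod_cast h4
      have h7 : (2 : ℝ) ^ t = 2 * 2 ^ (t - 1) := by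
        rw [← pow_succ']; congr 1; omega
      refine (abs_tentKer_sub_le_of_le h5').trans ?_
      rw [four_pow_eq, h7, ← sq_abs (n : ℝ)]
      have h8 : (2 : ℝ) ^ (t - 1) * 2 ^ (t - 1) ≤ |(n : ℝ)| ^ 2 := by
        rw [sq]; gcongr
      have hp : (0 : ℝ) < 2 ^ (t - 1) * 2 ^ (t - 1) := by positivity
      rw [div_le_div_iff₀ (by linarith) (by positivity)]
      nlinarith [show (0 : ℝ) < 2 ^ s by positivity]

lemma sum_two_pow_Icc_le (s T : ℕ) : ∑ t ∈ Finset.Icc s T, (2 : ℝ) ^ s / 2 ^ t ≤ 2 := by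
  rcases le_or_gt s T with h | h
  · have : ∑ t ∈ Finset.Icc s T, (2 : ℝ) ^ s / 2 ^ t = 2 - 2 ^ s / 2 ^ T := by
      induction T, h using Nat.le_induction with
      | base => simp; norm_num
      | succ n hn ih =>
        rw [Finset.sum_Icc_succ_top (by omega), ih, pow_succ]
        field_simp; ring
    rw [this]
    have : (0 : ℝ) ≤ 2 ^ s / 2 ^ T := by positivity
    linarith
  · rw [Finset.Icc_eq_empty (by omega)]; simp

lemma norm_hilb_sub_le {W : Finset ℤ} {s : ℕ} {z : ℤ} (f : ℤ → ℂ)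
    (hW : ∀ y, |z - y| ≤ 2 ^ s → y ∈ W) {B : ℝ}
    (hB : ∀ t, s ≤ t → avg W t (fun y => ‖f y‖) z ≤ B) :
    ‖hilb W f z - ∑ y ∈ W, (kerR s (z - y) : ℂ) * f y‖ ≤
      avg W s (fun y => ‖hilb W f y‖) z + 72 * B := by
  obtain ⟨T, hsT, hT⟩ : ∃ T, s ≤ T ∧ ∀ y ∈ W, |z - y| ≤ 2 ^ T := by
    refine ⟨s + ∑ y ∈ W, (z - y).natAbs, by omega, fun y hy => ?_⟩
    have h1 : (z - y).natAbs ≤ ∑ y ∈ W, (z - y).natAbs :=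
      Finset.single_le_sum (f := fun y => (z - y).natAbs) (fun _ _ => Nat.zero_le _) hy
    have h2 : (z - y).natAbs < 2 ^ (s + ∑ y ∈ W, (z - y).natAbs) :=
      lt_of_lt_of_le Nat.lt_two_pow_self (Nat.pow_le_pow_right (by norm_num) (by omega))
    rw [Int.abs_eq_natAbs]
    exact_mod_cast h2.le
  have e1 : hilb W f z - ∑ y ∈ W, (kerR s (z - y) : ℂ) * f y =
      ∑ y ∈ W, (((1 - cutoff s (z - y)) / ((z - y : ℤ) : ℝ) : ℝ) : ℂ) * f y := by
    unfold hilb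
    rw [← Finset.sum_sub_distrib]
    refine Finset.sum_congr rfl fun y _ => ?_
    unfold kerR
    push_cast
    ring
  have e2 : ∑ w ∈ Finset.Icc (-(2 ^ s : ℤ)) (2 ^ s), (tent s w : ℂ) * hilb W f (z - w) =
      ∑ y ∈ W, ((tentKer s (z - y) : ℝ) : ℂ) * f y := by
    simp only [hilb, tentKer, Finset.mul_sum]
    rw [Finset.sum_comm]
    refine Finset.sum_congr rfl fun y _ => ?_
    push_cast
    rw [Finset.sum_mul]
    refine Finset.sum_congr rfl fun w _ => ?_
    rw [sub_right_comm]
    ring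
  have h1 : ‖∑ w ∈ Finset.Icc (-(2 ^ s : ℤ)) (2 ^ s), (tent s w : ℂ) * hilb W f (z - w)‖ ≤
      avg W s (fun y => ‖hilb W f y‖) z := by
    refine (norm_sum_le _ _).trans ?_
    have h2 : ∀ w ∈ Finset.Icc (-(2 ^ s : ℤ)) (2 ^ s), ‖(tent s w : ℂ) * hilb W f (z - w)‖ ≤
        ‖hilb W f (z - w)‖ / 2 ^ s := by
      intro w _
      rw [norm_mul, Complex.norm_real, Real.norm_eq_abs, abs_of_nonneg (tent_nonneg s w),
        div_eq_mul_one_div, mul_comm]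
      gcongr
      exact tent_le s w
    refine (Finset.sum_le_sum h2).trans ?_
    rw [← Finset.sum_div]
    unfold avg
    gcongr
    have e3 : ∑ w ∈ Finset.Icc (-(2 ^ s : ℤ)) (2 ^ s), ‖hilb W f (z - w)‖ =
        ∑ y ∈ Finset.Icc (z - 2 ^ s) (z + 2 ^ s), ‖hilb W f y‖ := by
      refine Finset.sum_nbij' (fun w => z - w) (fun u => z - u) ?_ ?_ ?_ ?_ ?_
      · intro w hw; simp only [Finset.mem_Icc] at hw ⊢; omega
      · intro w hw; simp only [Finset.mem_Icc] at hw ⊢; omega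
      · intro w _; ring
      · intro w _; ring
      · intro w _; rfl
    rw [e3]
    apply Finset.sum_le_sum_of_subset_of_nonneg
    · intro y hy
      rw [Finset.mem_Icc] at hy
      have h4 : |z - y| ≤ 2 ^ s := abs_le.2 ⟨by linarith, by linarith⟩
      exact Finset.mem_filter.2 ⟨hW y h4, near_of_abs_lt h4⟩
    · intros; exact norm_nonneg _
  have h3 : ‖∑ y ∈ W, ((tentKer s (z - y) : ℝ) : ℂ) * f y -
      ∑ y ∈ W, (((1 - cutoff s (z - y)) / ((z - y : ℤ) : ℝ) : ℝ) : ℂ) * f y‖ ≤ 72 * B := by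
    rw [← Finset.sum_sub_distrib]
    refine (norm_sum_le _ _).trans ?_
    have h4 : ∀ y ∈ W, ‖((tentKer s (z - y) : ℝ) : ℂ) * f y -
        (((1 - cutoff s (z - y)) / ((z - y : ℤ) : ℝ) : ℝ) : ℂ) * f y‖ ≤
        ∑ t ∈ Finset.Icc s T, if Near t z y then 36 * 2 ^ s / 4 ^ t * ‖f y‖ else 0 := by
      intro y hy
      rw [← sub_mul, ← Complex.ofReal_sub, norm_mul, Complex.norm_real, Real.norm_eq_abs]
      obtain ⟨t, ht, h5, h6⟩ := exists_tentKer_sub_le s T hsT (z - y) (hT y hy)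
      refine le_trans ?_ (Finset.single_le_sum (f := fun t => if Near t z y then
        36 * 2 ^ s / 4 ^ t * ‖f y‖ else 0) (fun t _ => ?_) ht)
      · rw [if_pos (near_of_abs_lt h5)]; gcongr
      · split_ifs <;> positivity
    refine (Finset.sum_le_sum h4).trans ?_
    rw [Finset.sum_comm]
    have h7 : ∀ t ∈ Finset.Icc s T,
        ∑ y ∈ W, (if Near t z y then 36 * 2 ^ s / 4 ^ t * ‖f y‖ else 0) ≤
        (36 * B) * (2 ^ s / 2 ^ t) := by
      intro t ht
      have h8 := hB t (Finset.mem_Icc.1 ht).1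
      rw [← Finset.sum_filter, ← Finset.mul_sum]
      calc _ = 36 * (2 ^ s / 2 ^ t) * avg W t (fun y => ‖f y‖) z := by
            unfold avg; rw [four_pow_eq]; field_simp
        _ ≤ 36 * (2 ^ s / 2 ^ t) * B := by gcongr
        _ = _ := by ring
    refine (Finset.sum_le_sum h7).trans ?_
    rw [← Finset.mul_sum]
    have hB0 : 0 ≤ B := (avg_nonneg (fun y => norm_nonneg (f y)) s z).trans (hB s le_rfl)
    calc 36 * B * _ ≤ 36 * B * 2 := by gcongr; exact sum_two_pow_Icc_le s T
      _ = _ := by ring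
  rw [e1]
  rw [← e2] at h3
  rw [norm_sub_rev] at h3
  have := norm_le_norm_add_norm_sub' (∑ y ∈ W, (((1 - cutoff s (z - y)) / ((z - y : ℤ) : ℝ) : ℝ) : ℂ) * f y) (∑ w ∈ Finset.Icc (-(2 ^ s : ℤ)) (2 ^ s), (tent s w : ℂ) * hilb W f (z - w))
  linarith

/-- Maximally truncated singular integrals are controlled by maximal functions at all nearby
points. -/
lemma norm_sum_kerR_sub_le {W : Finset ℤ} {a b : ℕ} (hab : a ≤ b) {z x : ℤ} (f : ℤ → ℂ)
    (hW : ∀ y, |z - y| ≤ 2 ^ b → y ∈ W) (hx : blk (a + 1) z = blk (a + 1) x) :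
    ‖∑ y ∈ W, ((kerR b (z - y) - kerR a (z - y) : ℝ) : ℂ) * f y‖ ≤
      4 * mx W (fun y => ‖hilb W f y‖) x + 288 * mx W (fun y => ‖f y‖) x := by
  have key : ∀ s, a ≤ s → s ≤ b → ‖hilb W f z - ∑ y ∈ W, (kerR s (z - y) : ℂ) * f y‖ ≤
      2 * mx W (fun y => ‖hilb W f y‖) x + 144 * mx W (fun y => ‖f y‖) x := by
    intro s h1 h2
    have h3 := norm_hilb_sub_le (W := W) (s := s) (z := z) f
      (fun y hy => hW y (hy.trans (pow_le_pow_right₀ (by norm_num) h2)))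
      (B := 2 * mx W (fun y => ‖f y‖) x)
      (fun t ht => avg_le_two_mul_mx (fun y => norm_nonneg _) (show a + 1 ≤ t + 1 by omega) hx)
    have h4 := avg_le_two_mul_mx (W := W) (f := fun y => ‖hilb W f y‖) (fun y => norm_nonneg _)
      (show a + 1 ≤ s + 1 by omega) hx
    linarith
  have h1 := key a le_rfl hab
  have h2 := key b hab le_rfl
  have e : ∑ y ∈ W, ((kerR b (z - y) - kerR a (z - y) : ℝ) : ℂ) * f y =
      (hilb W f z - ∑ y ∈ W, (kerR a (z - y) : ℂ) * f y) -
      (hilb W f z - ∑ y ∈ W, (kerR b (z - y) : ℂ) * f y) := by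
    rw [sub_sub_sub_cancel_left, ← Finset.sum_sub_distrib]
    refine Finset.sum_congr rfl fun y _ => ?_
    push_cast; ring
  rw [e]
  refine (norm_sub_le _ _).trans ?_
  linarith

/-! ### Single scale operators and trees -/

/-- The kernel of the linearized operator at `x`, with scales between `a` and `b`. -/
noncomputable def kerN (N : ℤ → ℝ) (a b : ℕ) (x y : ℤ) : ℂ :=
  ((kerR b (x - y) - kerR a (x - y) : ℝ) : ℂ) * ee (-(N x * y))

/-- Adjoint of the linearized operator, with scales in `(a x, b x]` at the point `x`. -/
noncomputable def vop (N : ℤ → ℝ) (A : Finset ℤ) (h : ℤ → ℂ) (a b : ℤ → ℕ) (y : ℤ) : ℂ :=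
  ∑ x ∈ A, h x * kerN N (a x) (b x) x y

/-- The set of points in the block of `x` at scale `t` with frequency within `ρ` of `θ`. -/
noncomputable def freqSet (N : ℤ → ℝ) (G : Finset ℤ) (t : ℕ) (x : ℤ) (θ ρ : ℝ) : Finset ℤ := by
  classical exact G.filter fun z => blk t z = blk t x ∧ |N z - θ| ≤ ρ

lemma mem_freqSet {N : ℤ → ℝ} {G : Finset ℤ} {t : ℕ} {x z : ℤ} {θ ρ : ℝ} :
    z ∈ freqSet N G t x θ ρ ↔ z ∈ G ∧ blk t z = blk t x ∧ |N z - θ| ≤ ρ := by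
  simp [freqSet]

/-- All tiles above `(x, s)` have density at most `δ`. -/
def Low (N : ℤ → ℝ) (G : Finset ℤ) (δ : ℝ) (x : ℤ) (s : ℕ) : Prop :=
  ∀ t, s ≤ t → ∀ θ r : ℝ, 1 ≤ r → |θ - N x| ≤ r / 2 ^ s →
    ((freqSet N G t x θ (r / 2 ^ t)).card : ℝ) ≤ δ * r * 2 ^ t

lemma sum_norm_sq_le_of_inner {W A : Finset ℤ} (k : ℤ → ℤ → ℂ) (h : ℤ → ℂ) (d : ℤ → ℤ → ℝ)
    (hk : ∀ x ∈ A, ∀ x' ∈ A,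
      ‖∑ y ∈ W, k x y * (starRingEnd ℂ) (k x' y)‖ ≤ d x x' + d x' x) :
    ∑ y ∈ W, ‖∑ x ∈ A, h x * k x y‖ ^ 2 ≤ 2 * ∑ x ∈ A, ∑ x' ∈ A, ‖h x‖ * ‖h x'‖ * d x x' := by
  have e1 : ((∑ y ∈ W, ‖∑ x ∈ A, h x * k x y‖ ^ 2 : ℝ) : ℂ) = ∑ x ∈ A, ∑ x' ∈ A,
      h x * (starRingEnd ℂ) (h x') * ∑ y ∈ W, k x y * (starRingEnd ℂ) (k x' y) := by
    push_cast
    simp only [← Complex.mul_conj', map_sum, Finset.sum_mul_sum, map_mul]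
    rw [Finset.sum_comm]
    refine Finset.sum_congr rfl fun x _ => ?_
    rw [Finset.sum_comm]
    refine Finset.sum_congr rfl fun x' _ => ?_
    rw [Finset.mul_sum]
    exact Finset.sum_congr rfl fun y _ => by ring
  have h0 : 0 ≤ ∑ y ∈ W, ‖∑ x ∈ A, h x * k x y‖ ^ 2 := Finset.sum_nonneg fun _ _ => sq_nonneg _
  rw [← abs_of_nonneg h0, ← Real.norm_eq_abs, ← Complex.norm_real, e1]
  calc _ ≤ ∑ x ∈ A, ∑ x' ∈ A, ‖h x‖ * ‖h x'‖ * (d x x' + d x' x) := by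
        refine (norm_sum_le _ _).trans (Finset.sum_le_sum fun x hx => ?_)
        refine (norm_sum_le _ _).trans (Finset.sum_le_sum fun x' hx' => ?_)
        rw [norm_mul, norm_mul, RCLike.norm_conj]
        exact mul_le_mul_of_nonneg_left (hk x hx x' hx') (by positivity)
    _ = ∑ x ∈ A, ∑ x' ∈ A, ‖h x‖ * ‖h x'‖ * d x x' +
        ∑ x ∈ A, ∑ x' ∈ A, ‖h x'‖ * ‖h x‖ * d x' x := by
        simp only [← Finset.sum_add_distrib]
        exact Finset.sum_congr rfl fun x _ => Finset.sum_congr rfl fun y _ => by ring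
    _ = _ := by
        rw [Finset.sum_comm (f := fun x x' => ‖h x'‖ * ‖h x‖ * d x' x), ← two_mul]

lemma sum_norm_sq_le_of_dual {W A : Finset ℤ} (k : ℤ → ℤ → ℂ) (B : ℝ) (hB : 0 ≤ B)
    (hT : ∀ f : ℤ → ℂ, ∑ x ∈ A, ‖∑ y ∈ W, k x y * f y‖ ^ 2 ≤ B * ∑ y ∈ W, ‖f y‖ ^ 2)
    (h : ℤ → ℂ) :
    ∑ y ∈ W, ‖∑ x ∈ A, h x * k x y‖ ^ 2 ≤ B * ∑ x ∈ A, ‖h x‖ ^ 2 := by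
  set v : ℤ → ℂ := fun y => ∑ x ∈ A, h x * k x y with hv
  set n := ∑ y ∈ W, ‖v y‖ ^ 2 with hn
  have hn0 : 0 ≤ n := Finset.sum_nonneg fun _ _ => sq_nonneg _
  have hf := hT fun y => (starRingEnd ℂ) (v y)
  simp only [RCLike.norm_conj] at hf
  rw [← hn] at hf
  have e1 : (n : ℂ) = ∑ x ∈ A, h x * ∑ y ∈ W, k x y * (starRingEnd ℂ) (v y) := by
    rw [hn]
    push_cast
    simp only [← Complex.mul_conj']
    simp only [Finset.mul_sum]
    rw [Finset.sum_comm]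
    refine Finset.sum_congr rfl fun y _ => ?_
    conv_lhs => rw [hv]
    simp only
    rw [Finset.sum_mul]
    refine Finset.sum_congr rfl fun x _ => ?_
    rw [mul_assoc]
  have h1 : n ≤ ∑ x ∈ A, ‖h x‖ * ‖∑ y ∈ W, k x y * (starRingEnd ℂ) (v y)‖ := by
    have : n = ‖(n : ℂ)‖ := by rw [Complex.norm_real, Real.norm_eq_abs, abs_of_nonneg hn0]
    rw [this, e1]
    refine (norm_sum_le _ _).trans (le_of_eq (Finset.sum_congr rfl fun x _ => norm_mul _ _))
  have h2 : n ^ 2 ≤ (∑ x ∈ A, ‖h x‖ ^ 2) * (B * n) :=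
    calc n ^ 2 ≤ (∑ x ∈ A, ‖h x‖ * ‖∑ y ∈ W, k x y * (starRingEnd ℂ) (v y)‖) ^ 2 := by gcongr
      _ ≤ _ := Finset.sum_mul_sq_le_sq_mul_sq _ _ _
      _ ≤ _ := by gcongr
  rcases hn0.eq_or_lt with h0 | h0
  · rw [← h0]
    positivity
  · have : n * n ≤ n * (B * ∑ x ∈ A, ‖h x‖ ^ 2) := by nlinarith
    exact le_of_mul_le_mul_left this h0

lemma Low.mono {N : ℤ → ℝ} {G : Finset ℤ} {δ : ℝ} {x : ℤ} {s s' : ℕ} (h : Low N G δ x s)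
    (hs : s ≤ s') : Low N G δ x s' := by
  intro t ht θ r hr hθ
  refine h t (hs.trans ht) θ r hr (hθ.trans ?_)
  have : (2 : ℝ) ^ s ≤ 2 ^ s' := pow_le_pow_right₀ (by norm_num) hs
  gcongr

lemma Low.mono_left {N : ℤ → ℝ} {G : Finset ℤ} {δ δ' : ℝ} {x : ℤ} {s : ℕ} (h : Low N G δ x s)
    (hd : δ ≤ δ') : Low N G δ' x s := by
  intro t ht θ r hr hθ
  refine (h t ht θ r hr hθ).trans ?_
  gcongr

/-- Points of comparable frequency and low density are sparse. -/
lemma sum_le_of_low {N : ℤ → ℝ} {G : Finset ℤ} {δ : ℝ} (Q : Finset ℤ) (hQ : Q ⊆ G)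
    (t : ℤ → ℕ) (θ R : ℝ) (hR : 1 ≤ R) (hδ : 0 ≤ δ) (hθ : ∀ z ∈ Q, |θ - N z| ≤ R / 2 ^ t z)
    (hL : ∀ z ∈ Q, Low N G δ z (t z + 1)) (W : Finset ℤ)
    (hW : ∀ z ∈ Q, ∀ y, blk (t z) y = blk (t z) z → y ∈ W) (u g : ℤ → ℝ)
    (hg : ∀ y ∈ W, 0 ≤ g y)
    (hu : ∀ z ∈ Q, ∀ y, blk (t z) y = blk (t z) z → u z ≤ g y) :
    ∑ z ∈ Q, u z ≤ 4 * R * δ * ∑ y ∈ W, g y := by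
  obtain ⟨c, hc⟩ := exists_stopping Q (fun z => t z + 1) (fun z _ => by omega)
  have hex : ∀ y ∈ Q, ∃ z ∈ Q, ∃ s, blk s z = blk s y ∧ t z + 1 ≤ s :=
    fun y hy => ⟨y, hy, t y + 1, rfl, le_rfl⟩
  have hct : ∀ y ∈ Q, c y ≤ t y := fun y hy => by
    have := (hc y (hex y hy)).1 y hy rfl
    omega
  refine sum_le_of_stopping Q W c (4 * R * δ) u g (by positivity)
    (fun y hy y' _ h => (hc y (hex y hy)).2.2 y' h) ?_ ?_ hg
    (fun y hy y' h => hu y hy y' (blk_mono (hct y hy) h))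
  · intro y hy
    obtain ⟨h1, ⟨z, hz, hzb, hzt⟩, -⟩ := hc y (hex y hy)
    have h2 := hL z hz (c y + 1) hzt θ (2 * R) (by linarith) (by
      refine (hθ z hz).trans (le_of_eq ?_)
      rw [pow_succ]; field_simp)
    have h3 : (Q.filter fun y' => blk (c y) y' = blk (c y) y) ⊆
        freqSet N G (c y + 1) z θ (2 * R / 2 ^ (c y + 1)) := by
      intro w hw
      rw [Finset.mem_filter] at hw
      rw [mem_freqSet, abs_sub_comm]
      refine ⟨hQ hw.1, (blk_mono (Nat.le_succ _) hw.2).trans hzb.symm, (hθ w hw.1).trans ?_⟩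
      have h5 : c y ≤ t w := by have := h1 w hw.1 hw.2; omega
      have h6 : (2 : ℝ) ^ c y ≤ 2 ^ t w := pow_le_pow_right₀ (by norm_num) h5
      rw [pow_succ, mul_comm (2 : ℝ) R, mul_div_mul_right _ _ (by norm_num : (2 : ℝ) ≠ 0)]
      gcongr
    calc _ ≤ ((freqSet N G (c y + 1) z θ (2 * R / 2 ^ (c y + 1))).card : ℝ) := by
          exact_mod_cast Finset.card_le_card h3
      _ ≤ _ := h2
      _ = _ := by rw [pow_succ]; ring
  · intro y hy z hz
    rw [mem_blkSet] at hz
    exact hW y hy z (blk_mono (hct y hy) hz)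

lemma card_le_of_low {N : ℤ → ℝ} {G : Finset ℤ} {δ : ℝ} (Q : Finset ℤ) (hQ : Q ⊆ G)
    (t : ℤ → ℕ) (θ R : ℝ) (hR : 1 ≤ R) (hδ : 0 ≤ δ) (hθ : ∀ z ∈ Q, |θ - N z| ≤ R / 2 ^ t z)
    (hL : ∀ z ∈ Q, Low N G δ z (t z + 1)) (W : Finset ℤ) (σ : ℕ) (hσ : ∀ z ∈ Q, t z ≤ σ)
    (hW : ∀ z ∈ Q, ∀ y, blk σ y = blk σ z → y ∈ W) :
    (Q.card : ℝ) ≤ 4 * R * δ * W.card := by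
  have := sum_le_of_low Q hQ t θ R hR hδ hθ hL W
    (fun z hz y hy => hW z hz y (blk_mono (hσ z hz) hy)) (fun _ => 1) (fun _ => 1)
    (fun _ _ => zero_le_one) (fun _ _ _ _ => le_rfl)
  simpa using this

lemma vop_single_inner_aux {N : ℤ → ℝ} {W : Finset ℤ} {t t' : ℕ} {x x' : ℤ} (htt : t' ≤ t)
    (hN : |N x - N x'| ≤ 1) {Λ : ℝ} (hΛ : 0 < Λ) (hW : ∀ y, |x' - y| ≤ 2 ^ (t' + 1) → y ∈ W) :
    ‖∑ y ∈ W, (kerK t (x - y) : ℂ) * ee (-(N x * y)) *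
      (starRingEnd ℂ) ((kerK t' (x' - y) : ℂ) * ee (-(N x' * y)))‖ ≤
      if |x - x'| < 2 ^ (t + 2) then
        (if |N x - N x'| ≤ Λ / 2 ^ t' then 20 / 2 ^ t else 480 / (Λ * 2 ^ t)) else 0 := by
  have hs : ∀ n : ℤ, kerK t' n ≠ 0 → |n| < 2 ^ (t' + 1) := fun n hn => by
    exact_mod_cast (kerK_support hn).2
  have hs2 : ∀ n : ℤ, kerK t n ≠ 0 → |n| < 2 ^ (t + 1) := fun n hn => by
    exact_mod_cast (kerK_support hn).2
  set Φ : ℤ → ℂ := fun y => ((kerK t (x - y) * kerK t' (x' - y) : ℝ) : ℂ) with hΦ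
  have e1 : ∀ y : ℤ, (kerK t (x - y) : ℂ) * ee (-(N x * y)) *
      (starRingEnd ℂ) ((kerK t' (x' - y) : ℂ) * ee (-(N x' * y))) =
      ee (-(N x - N x') * y) * Φ y := by
    intro y
    rw [map_mul, Complex.conj_ofReal, conj_ee, hΦ]
    have : ee (-(N x - N x') * y) = ee (-(N x * y)) * ee (- -(N x' * y)) := by
      rw [← ee_add]; congr 1; ring
    rw [this]; push_cast; ring
  simp only [e1]
  have hΦ0 : ∀ y, Φ y ≠ 0 → |x - y| < 2 ^ (t + 1) ∧ |x' - y| < 2 ^ (t' + 1) := by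
    intro y hy
    have : kerK t (x - y) * kerK t' (x' - y) ≠ 0 := by
      intro h; apply hy; simp only [hΦ, h, Complex.ofReal_zero]
    exact ⟨hs2 _ (left_ne_zero_of_mul this), hs _ (right_ne_zero_of_mul this)⟩
  have hpow : (2 : ℤ) ^ t' ≤ 2 ^ t := pow_le_pow_right₀ (by norm_num) htt
  have hpow1 : (2 : ℤ) ^ (t' + 1) = 2 * 2 ^ t' := by ring
  have hpow2 : (2 : ℤ) ^ (t + 1) = 2 * 2 ^ t := by ring
  have hpow3 : (2 : ℤ) ^ (t + 2) = 4 * 2 ^ t := by ring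
  have hpos : (0 : ℤ) < 2 ^ t' := by positivity
  have hp : (0 : ℝ) < 2 ^ t := by positivity
  have hp' : (0 : ℝ) < 2 ^ t' := by positivity
  have hp1 : (1 : ℝ) ≤ 2 ^ t' := one_le_pow₀ (by norm_num)
  set I := Finset.Icc (x' - 2 ^ (t' + 1) - 1) (x' + 2 ^ (t' + 1)) with hI
  have hIc : (I.card : ℝ) ≤ 6 * 2 ^ t' := by
    rw [hI, Int.card_Icc]
    have : (((x' + 2 ^ (t' + 1) + 1 - (x' - 2 ^ (t' + 1) - 1)).toNat : ℤ)) ≤ 6 * 2 ^ t' := by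
      rw [Int.toNat_of_nonneg (by omega)]; omega
    exact_mod_cast this
  split_ifs with h1 h2
  · calc _ ≤ ∑ y ∈ W, ‖Φ y‖ := by
          refine (norm_sum_le _ _).trans (le_of_eq (Finset.sum_congr rfl fun y _ => ?_))
          rw [norm_mul, norm_ee, one_mul]
      _ ≤ ∑ y ∈ W.filter (fun y => Φ y ≠ 0), 4 / (2 ^ t * 2 ^ t') := by
          rw [Finset.sum_filter]
          refine Finset.sum_le_sum fun y _ => ?_
          split_ifs with h
          · rw [hΦ]
            simp only [Complex.norm_real, Real.norm_eq_abs, abs_mul]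
            calc _ ≤ 2 / 2 ^ t * (2 / 2 ^ t') := by
                  gcongr <;> exact abs_kerK_le _ _
              _ = (4 : ℝ) / (2 ^ t * 2 ^ t') := by field_simp; norm_num
          · push Not at h; simp [h]
      _ ≤ (Finset.Icc (x' - 2 ^ (t' + 1)) (x' + 2 ^ (t' + 1))).card * (4 / (2 ^ t * 2 ^ t')) := by
          rw [Finset.sum_const, nsmul_eq_mul]
          gcongr
          intro y hy
          rw [Finset.mem_filter] at hy
          have := (hΦ0 y hy.2).2
          rw [abs_lt] at this
          rw [Finset.mem_Icc]
          constructor <;> omega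
      _ ≤ (5 * 2 ^ t') * (4 / (2 ^ t * 2 ^ t')) := by
          gcongr
          rw [Int.card_Icc]
          have : (((x' + 2 ^ (t' + 1) + 1 - (x' - 2 ^ (t' + 1))).toNat : ℤ)) ≤ 5 * 2 ^ t' := by
            rw [Int.toNat_of_nonneg (by omega)]; omega
          exact_mod_cast this
      _ = _ := by field_simp; norm_num
  · push Not at h2
    have hΔ : 0 < |N x - N x'| := lt_of_le_of_lt (by positivity) h2
    have h3 := norm_sum_ee_mul_le (W := W) (W' := I) (Δ := -(N x - N x')) (by rwa [abs_neg])
      (by intro h; rw [← abs_neg, h, abs_zero] at hΔ; exact lt_irrefl _ hΔ) Φ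
      (fun y hy => hW y (hΦ0 y hy).2.le) (fun y hy => by
        have := (hΦ0 y hy).2
        rw [abs_lt] at this
        rw [hI, Finset.mem_Icc, Finset.mem_Icc]
        refine ⟨⟨?_, ?_⟩, ?_, ?_⟩ <;> omega)
    refine h3.trans ?_
    rw [abs_neg]
    have h4 : ∀ y ∈ I, ‖Φ (y + 1) - Φ y‖ ≤ 40 / (2 ^ t * (2 ^ t' * 2 ^ t')) := by
      intro y _
      rw [hΦ]
      simp only [← Complex.ofReal_sub, Complex.norm_real, Real.norm_eq_abs]
      have e : x - y = x - (y + 1) + 1 := by ring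
      have e' : x' - y = x' - (y + 1) + 1 := by ring
      have h5 := abs_kerK_sub_le t (x - (y + 1))
      have h6 := abs_kerK_sub_le t' (x' - (y + 1))
      rw [← e] at h5
      rw [← e'] at h6
      have h7 := abs_kerK_le t (x - (y + 1))
      have h8 := abs_kerK_le t' (x' - y)
      rw [four_pow_eq] at h5 h6
      have h9 : (10 : ℝ) / (2 ^ t * 2 ^ t) ≤ 10 / (2 ^ t * 2 ^ t') := by
        have : (2 : ℝ) ^ t' ≤ 2 ^ t := pow_le_pow_right₀ (by norm_num) htt
        gcongr
      calc |kerK t (x - (y + 1)) * kerK t' (x' - (y + 1)) - kerK t (x - y) * kerK t' (x' - y)|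
          = |kerK t (x - (y + 1)) * (kerK t' (x' - (y + 1)) - kerK t' (x' - y)) +
            (kerK t (x - (y + 1)) - kerK t (x - y)) * kerK t' (x' - y)| := by congr 1; ring
        _ ≤ 2 / 2 ^ t * (10 / (2 ^ t' * 2 ^ t')) + 10 / (2 ^ t * 2 ^ t') * (2 / 2 ^ t') := by
          refine (abs_add_le _ _).trans ?_
          rw [abs_mul, abs_mul, abs_sub_comm, abs_sub_comm (kerK t (x - (y + 1)))]
          gcongr
          exact h5.trans h9
        _ = _ := by field_simp; norm_num
    calc _ ≤ 2 / (Λ / 2 ^ t') * ∑ y ∈ I, (40 : ℝ) / (2 ^ t * (2 ^ t' * 2 ^ t')) := by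
          gcongr with y hy
          exact h4 y hy
      _ ≤ 2 / (Λ / 2 ^ t') * ((6 * 2 ^ t') * (40 / (2 ^ t * (2 ^ t' * 2 ^ t')))) := by
          rw [Finset.sum_const, nsmul_eq_mul]
          gcongr
      _ = _ := by field_simp; norm_num
  · rw [Finset.sum_eq_zero, norm_zero]
    intro y _
    have : Φ y = 0 := by
      by_contra h
      obtain ⟨h3, h4⟩ := hΦ0 y h
      rw [abs_lt] at *
      apply h1
      constructor <;> omega
    rw [this, mul_zero]

lemma kerN_succ (N : ℤ → ℝ) (t : ℕ) (x y : ℤ) :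
    kerN N t (t + 1) x y = (kerK t (x - y) : ℂ) * ee (-(N x * y)) := rfl

/-- Single scale estimate. -/
lemma sum_norm_vop_single_sq_le {N : ℤ → ℝ} {W G A : Finset ℤ} {δ : ℝ} {t : ℤ → ℕ}
    {h : ℤ → ℂ} (hδ : 0 < δ) (hδ1 : δ ≤ 1) (hA : A ⊆ G) (hN : ∀ x, N x ∈ Set.Icc (0 : ℝ) 1)
    (hL : ∀ x ∈ A, Low N G δ x (t x + 1)) (hh : ∀ x, ‖h x‖ ≤ 1)
    (hW : ∀ x ∈ A, ∀ y, |x - y| ≤ 2 ^ (t x + 1) → y ∈ W) :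
    ∑ y ∈ W, ‖vop N A h t (fun x => t x + 1) y‖ ^ 2 ≤ 11400 * √δ * A.card := by
  classical
  set Λ : ℝ := 1 / √δ with hΛ
  have hsq : 0 < √δ := Real.sqrt_pos.2 hδ
  have hΛ0 : 0 < Λ := by positivity
  have hsq1 : √δ ≤ 1 := Real.sqrt_le_one.2 hδ1
  have hΛ1 : 1 ≤ Λ := by rw [hΛ, le_div_iff₀ hsq]; linarith
  have hΛδ : Λ * δ = √δ := by
    rw [hΛ, div_mul_eq_mul_div, one_mul, Real.div_sqrt]
  have hNN : ∀ x x', |N x - N x'| ≤ 1 := fun x x' => by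
    have h1 := hN x
    have h2 := hN x'
    rw [Set.mem_Icc] at h1 h2
    rw [abs_le]; constructor <;> linarith
  set d : ℤ → ℤ → ℝ := fun x x' => if t x' ≤ t x then (if |x - x'| < 2 ^ (t x + 2) then
        (if |N x - N x'| ≤ Λ / 2 ^ t x' then 20 / 2 ^ t x else 480 / (Λ * 2 ^ t x)) else 0)
        else 0 with hd
  have hd0 : ∀ x x', 0 ≤ d x x' := fun x x' => by
    simp only [hd]
    split_ifs <;> positivity
  have h1 := sum_norm_sq_le_of_inner (W := W) (A := A)
    (fun x y => kerN N (t x) (t x + 1) x y) h d ?_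
  swap
  · intro x hx x' hx'
    simp only [kerN_succ]
    rcases le_total (t x') (t x) with h | h
    · have := vop_single_inner_aux (N := N) h (hNN x x') hΛ0 (hW x' hx')
      refine (this.trans (le_of_eq ?_)).trans (le_add_of_nonneg_right (hd0 x' x))
      simp only [hd, if_pos h]
    · have := vop_single_inner_aux (N := N) h (hNN x' x) hΛ0 (hW x hx)
      rw [← RCLike.norm_conj, map_sum]
      refine le_trans (le_of_eq ?_) ((this.trans (le_of_eq ?_)).trans
        (le_add_of_nonneg_left (hd0 x x')))
      · congr 1
        refine Finset.sum_congr rfl fun y _ => ?_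
        rw [map_mul (starRingEnd ℂ), Complex.conj_conj, mul_comm]
      · simp only [hd, if_pos h]
  have h2 : ∀ x ∈ A, ∑ x' ∈ A, d x x' ≤ 5700 * √δ := by
    intro x hx
    set σ := t x
    have hp : (0 : ℝ) < 2 ^ σ := by positivity
    set I := Finset.Icc (x - 2 ^ (σ + 2)) (x + 2 ^ (σ + 2)) with hI
    set J := Finset.Icc (x - 2 ^ (σ + 3)) (x + 2 ^ (σ + 3)) with hJ
    have hpos : (1 : ℤ) ≤ 2 ^ σ := one_le_pow₀ (by norm_num)
    have hIc : (I.card : ℝ) ≤ 9 * 2 ^ σ := by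
      rw [hI, Int.card_Icc]
      have : (((x + 2 ^ (σ + 2) + 1 - (x - 2 ^ (σ + 2))).toNat : ℤ)) ≤ 9 * 2 ^ σ := by
        rw [Int.toNat_of_nonneg (by have : (0:ℤ) < 2 ^ (σ + 2) := by positivity
                                    omega), pow_add]; omega
      exact_mod_cast this
    have hJc : (J.card : ℝ) ≤ 17 * 2 ^ σ := by
      rw [hJ, Int.card_Icc]
      have : (((x + 2 ^ (σ + 3) + 1 - (x - 2 ^ (σ + 3))).toNat : ℤ)) ≤ 17 * 2 ^ σ := by
        rw [Int.toNat_of_nonneg (by have : (0:ℤ) < 2 ^ (σ + 3) := by positivity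
                                    omega), pow_add]; omega
      exact_mod_cast this
    set Q := A.filter fun x' => t x' ≤ σ ∧ |x - x'| < 2 ^ (σ + 2) ∧ |N x - N x'| ≤ Λ / 2 ^ t x'
    have hQ := card_le_of_low (G := G) (N := N) (δ := δ) Q ((Finset.filter_subset _ _).trans hA) t
      (N x) Λ hΛ1 hδ.le (fun z hz => (Finset.mem_filter.1 hz).2.2.2)
      (fun z hz => hL z (Finset.mem_filter.1 hz).1) J σ (fun z hz => (Finset.mem_filter.1 hz).2.1)
      (fun z hz y hy => by
        have h3 := (Finset.mem_filter.1 hz).2.2.1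
        have h4 := blk_bounds σ y
        have h5 := blk_bounds σ z
        rw [hy] at h4
        rw [hJ, Finset.mem_Icc]
        rw [abs_lt] at h3
        have e2 : (2 : ℤ) ^ (σ + 2) = 4 * 2 ^ σ := by ring
        have e3 : (2 : ℤ) ^ (σ + 3) = 8 * 2 ^ σ := by ring
        have e4 : (blk σ z + 1) * 2 ^ σ = blk σ z * 2 ^ σ + 2 ^ σ := by ring
        rw [e4] at h4 h5
        constructor <;> omega)
    have h3 : ∀ x' ∈ A, d x x' ≤ (if x' ∈ Q then 20 / 2 ^ σ else 0) +
        (if x' ∈ I then 480 / (Λ * 2 ^ σ) else 0) := by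
      intro x' hx'
      have h0 : (0 : ℝ) ≤ if x' ∈ Q then 20 / 2 ^ σ else 0 := by split_ifs <;> positivity
      have h0' : (0 : ℝ) ≤ if x' ∈ I then 480 / (Λ * 2 ^ σ) else 0 := by
        split_ifs <;> positivity
      change (if t x' ≤ σ then (if |x - x'| < 2 ^ (σ + 2) then
        (if |N x - N x'| ≤ Λ / 2 ^ t x' then (20 : ℝ) / 2 ^ σ else 480 / (Λ * 2 ^ σ)) else 0)
        else 0) ≤ _
      by_cases h5 : t x' ≤ σ
      swap
      · rw [if_neg h5]; positivity
      by_cases h6 : |x - x'| < 2 ^ (σ + 2)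
      swap
      · rw [if_pos h5, if_neg h6]; positivity
      rw [if_pos h5, if_pos h6]
      by_cases h7 : |N x - N x'| ≤ Λ / 2 ^ t x'
      · rw [if_pos h7, if_pos (Finset.mem_filter.2 ⟨hx', h5, h6, h7⟩)]
        exact le_add_of_nonneg_right h0'
      · have h8 : x' ∈ I := by
          rw [hI, Finset.mem_Icc]; rw [abs_lt] at h6; constructor <;> omega
        rw [if_neg h7, if_pos h8]
        exact le_add_of_nonneg_left h0
    calc _ ≤ ∑ x' ∈ A, ((if x' ∈ Q then (20 : ℝ) / 2 ^ σ else 0) +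
        (if x' ∈ I then 480 / (Λ * 2 ^ σ) else 0)) := Finset.sum_le_sum h3
      _ ≤ Q.card * (20 / 2 ^ σ) + I.card * (480 / (Λ * 2 ^ σ)) := by
        rw [Finset.sum_add_distrib, ← Finset.sum_filter, ← Finset.sum_filter, Finset.sum_const,
          Finset.sum_const, nsmul_eq_mul, nsmul_eq_mul]
        gcongr <;> (intro z hz; exact (Finset.mem_filter.1 hz).2)
      _ ≤ (4 * Λ * δ * (17 * 2 ^ σ)) * (20 / 2 ^ σ) + (9 * 2 ^ σ) * (480 / (Λ * 2 ^ σ)) := by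
        have : (Q.card : ℝ) ≤ 4 * Λ * δ * (17 * 2 ^ σ) := hQ.trans (by gcongr)
        gcongr
      _ = 1360 * (Λ * δ) + 4320 * (1 / Λ) := by field_simp; ring
      _ = 5680 * √δ := by rw [hΛδ, hΛ, one_div_one_div]; ring
      _ ≤ _ := by linarith
  have h4 : ∑ x ∈ A, ∑ x' ∈ A, ‖h x‖ * ‖h x'‖ * d x x' ≤ ∑ x ∈ A, 5700 * √δ := by
    refine Finset.sum_le_sum fun x hx => le_trans (Finset.sum_le_sum fun x' hx' => ?_) (h2 x hx)
    have := mul_le_one₀ (hh x) (norm_nonneg _) (hh x')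
    exact mul_le_of_le_one_left (hd0 _ _) this
  rw [Finset.sum_const, nsmul_eq_mul] at h4
  unfold vop
  refine h1.trans ?_
  linarith

lemma abs_kerR_sub_mul_le {a b : ℕ} (hab : a ≤ b) (n : ℤ) :
    |kerR b n - kerR a n| * |(n : ℝ)| ≤ if |n| < 2 ^ b then 1 else 0 := by
  rcases eq_or_ne n 0 with rfl | hn
  · simp
  have hn' : (0 : ℝ) < |(n : ℝ)| := abs_pos.2 (by exact_mod_cast hn)
  have e : |kerR b n - kerR a n| * |(n : ℝ)| = |cutoff b n - cutoff a n| := by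
    rw [← abs_mul]
    congr 1
    unfold kerR
    have : (n : ℝ) ≠ 0 := by exact_mod_cast hn
    field_simp
  rw [e]
  have h1 := cutoff_mono hab n
  rw [abs_of_nonneg (by linarith)]
  split_ifs with h
  · linarith [cutoff_le_one b n, cutoff_nonneg a n]
  · push Not at h
    have h2 : (2 : ℝ) ^ b ≤ |(n : ℝ)| := by exact_mod_cast h
    linarith [cutoff_eq_zero h2, cutoff_nonneg a n]

/-- Tree estimate, dual form, pointwise. -/
lemma norm_tree_dual_le {N : ℤ → ℝ} {W : Finset ℤ} {a b : ℕ} {θ : ℝ} {z x : ℤ} (hab : a ≤ b)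
    (hθ : |θ - N z| ≤ 4 / 2 ^ b) (hW : ∀ y, |z - y| ≤ 2 ^ b → y ∈ W)
    (hx : blk (a + 1) z = blk (a + 1) x) (f : ℤ → ℂ) :
    ‖∑ y ∈ W, kerN N a b z y * f y‖ ≤
      4 * mx W (fun y => ‖hilb W (fun y => f y * ee (-(θ * y))) y‖) x +
      296 * mx W (fun y => ‖f y‖) x := by
  set fc : ℤ → ℂ := fun y => f y * ee (-(θ * y)) with hfc
  have hfn : ∀ y, ‖fc y‖ = ‖f y‖ := fun y => by rw [hfc]; simp [norm_ee]
  have h1 := norm_sum_kerR_sub_le hab fc hW hx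
  simp only [hfn] at h1
  have e1 : ∀ y : ℤ, kerN N a b z y * f y = ee (-((N z - θ) * z)) *
      (((kerR b (z - y) - kerR a (z - y) : ℝ) : ℂ) * fc y +
      ((kerR b (z - y) - kerR a (z - y) : ℝ) : ℂ) * ((ee ((N z - θ) * (z - y)) - 1) * fc y)) := by
    intro y
    have : ee (-(N z * y)) = ee (-((N z - θ) * z)) * ee ((N z - θ) * (z - y)) *
        ee (-(θ * y)) := by
      rw [← ee_add, ← ee_add]; congr 1; ring
    rw [kerN, this, hfc]
    ring
  simp only [e1]
  rw [← Finset.mul_sum, norm_mul, norm_ee, one_mul, Finset.sum_add_distrib]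
  refine (norm_add_le _ _).trans ?_
  have h2 : ‖∑ y ∈ W, ((kerR b (z - y) - kerR a (z - y) : ℝ) : ℂ) *
      ((ee ((N z - θ) * (z - y)) - 1) * fc y)‖ ≤ 4 * avg W b (fun y => ‖f y‖) z := by
    rw [avg, mul_div_assoc', Finset.mul_sum, Finset.sum_div, Finset.sum_filter]
    refine (norm_sum_le _ _).trans (Finset.sum_le_sum fun y _ => ?_)
    rw [norm_mul, norm_mul, hfn, Complex.norm_real, Real.norm_eq_abs]
    have h3 := abs_kerR_sub_mul_le hab (z - y)
    have h4 : ‖ee ((N z - θ) * (z - y)) - 1‖ ≤ 4 / 2 ^ b * |((z - y : ℤ) : ℝ)| := by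
      refine (norm_ee_sub_one_le _).trans ?_
      rw [abs_mul, abs_sub_comm]
      push_cast
      gcongr
    calc _ ≤ |kerR b (z - y) - kerR a (z - y)| * (4 / 2 ^ b * |((z - y : ℤ) : ℝ)| * ‖f y‖) := by
          gcongr
      _ = |kerR b (z - y) - kerR a (z - y)| * |((z - y : ℤ) : ℝ)| * (4 / 2 ^ b * ‖f y‖) := by ring
      _ ≤ (if |z - y| < 2 ^ b then 1 else 0) * (4 / 2 ^ b * ‖f y‖) := by gcongr
      _ ≤ _ := by
        by_cases h5 : |z - y| < 2 ^ b
        · rw [if_pos h5, if_pos (near_of_abs_lt h5.le)]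
          exact le_of_eq (by ring)
        · rw [if_neg h5, zero_mul]
          split_ifs <;> positivity
  have h3 := avg_le_two_mul_mx (W := W) (f := fun y => ‖f y‖) (fun y => norm_nonneg _)
    (show a + 1 ≤ b + 1 by omega) hx
  linarith

/-- Tree estimate. -/
lemma sum_norm_vop_tree_sq_le {N : ℤ → ℝ} {W G Z : Finset ℤ} {δ : ℝ} {a b : ℤ → ℕ} {θ : ℝ}
    (hδ : 0 ≤ δ) (hZ : Z ⊆ G) (hab : ∀ z ∈ Z, a z ≤ b z)
    (hθ : ∀ z ∈ Z, |θ - N z| ≤ 4 / 2 ^ b z) (hL : ∀ z ∈ Z, Low N G δ z (a z + 1))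
    (hW : ∀ z ∈ Z, ∀ y, |z - y| ≤ 2 ^ b z → y ∈ W) (h : ℤ → ℂ) :
    ∑ y ∈ W, ‖vop N Z h a b y‖ ^ 2 ≤ 2000000000 * δ * ∑ z ∈ Z, ‖h z‖ ^ 2 := by
  refine sum_norm_sq_le_of_dual (fun x y => kerN N (a x) (b x) x y) _ (by positivity)
    (fun f => ?_) h
  set H : ℤ → ℝ := fun y => ‖hilb W (fun y => f y * ee (-(θ * y))) y‖ with hH
  set g : ℤ → ℝ := fun x => 4 * mx W H x + 296 * mx W (fun y => ‖f y‖) x with hg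
  have h1 := sum_le_of_low Z hZ a θ 4 (by norm_num) hδ (fun z hz => (hθ z hz).trans (by
      have : (2 : ℝ) ^ a z ≤ 2 ^ b z := pow_le_pow_right₀ (by norm_num) (hab z hz)
      gcongr)) hL W (fun z hz y hy => hW z hz y (by
        have h3 := blk_bounds (a z) y
        have h4 := blk_bounds (a z) z
        rw [hy] at h3
        have e4 : (blk (a z) z + 1) * 2 ^ a z = blk (a z) z * 2 ^ a z + 2 ^ a z := by ring
        rw [e4] at h3 h4
        have h5 : (2 : ℤ) ^ a z ≤ 2 ^ b z := pow_le_pow_right₀ (by norm_num) (hab z hz)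
        rw [abs_le]; constructor <;> omega))
    (fun z => ‖∑ y ∈ W, kerN N (a z) (b z) z y * f y‖ ^ 2) (fun x => g x ^ 2)
    (fun _ _ => sq_nonneg _) (fun z hz y hy => by
      refine pow_le_pow_left₀ (norm_nonneg _) ?_ 2
      exact norm_tree_dual_le (hab z hz) (hθ z hz) (hW z hz) (blk_mono (Nat.le_succ _) hy.symm) f)
  have h2 : ∑ x ∈ W, mx W H x ^ 2 ≤ 580 * (10 * ∑ y ∈ W, ‖f y‖ ^ 2) := by
    refine (sum_mx_sq_le fun y => norm_nonneg _).trans ?_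
    refine mul_le_mul_of_nonneg_left ?_ (by norm_num)
    refine (sum_hilb_sq_le W W _).trans (le_of_eq ?_)
    simp [norm_ee]
  have h3 := sum_mx_sq_le (W := W) (f := fun y => ‖f y‖) fun y => norm_nonneg _
  have h4 : ∑ x ∈ W, g x ^ 2 ≤
      ∑ x ∈ W, (32 * mx W H x ^ 2 + 175232 * mx W (fun y => ‖f y‖) x ^ 2) := by
    refine Finset.sum_le_sum fun x _ => ?_
    simp only [hg]
    nlinarith [sq_nonneg (4 * mx W H x - 296 * mx W (fun y => ‖f y‖) x)]
  rw [Finset.sum_add_distrib, ← Finset.mul_sum, ← Finset.mul_sum] at h4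
  have h5 : ∑ x ∈ W, g x ^ 2 ≤ 110000000 * ∑ y ∈ W, ‖f y‖ ^ 2 := by
    have : 0 ≤ ∑ y ∈ W, ‖f y‖ ^ 2 := Finset.sum_nonneg fun _ _ => sq_nonneg _
    linarith
  calc _ ≤ 4 * 4 * δ * ∑ y ∈ W, g y ^ 2 := h1
    _ ≤ 4 * 4 * δ * (110000000 * ∑ y ∈ W, ‖f y‖ ^ 2) := by gcongr
    _ ≤ _ := by
      have : 0 ≤ δ * ∑ y ∈ W, ‖f y‖ ^ 2 := mul_nonneg hδ (Finset.sum_nonneg fun _ _ => sq_nonneg _)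
      linarith

/-! ### Regularity of tree operators -/

/-- The adjoint of a tree operator, demodulated at the frequency `θ`. -/
noncomputable def dem (N : ℤ → ℝ) (Z : Finset ℤ) (h : ℤ → ℂ) (a b : ℤ → ℕ) (θ : ℝ) (y : ℤ) : ℂ :=
  ee (θ * y) * vop N Z h a b y

lemma norm_dem (N : ℤ → ℝ) (Z : Finset ℤ) (h : ℤ → ℂ) (a b : ℤ → ℕ) (θ : ℝ) (y : ℤ) :
    ‖dem N Z h a b θ y‖ = ‖vop N Z h a b y‖ := by
  rw [dem, norm_mul, norm_ee, one_mul]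

lemma vop_eq_dem (N : ℤ → ℝ) (Z : Finset ℤ) (h : ℤ → ℂ) (a b : ℤ → ℕ) (θ : ℝ) (y : ℤ) :
    vop N Z h a b y = ee (-(θ * y)) * dem N Z h a b θ y := by
  rw [dem, ← mul_assoc, ← ee_add, neg_add_cancel, ee_zero, one_mul]

lemma kerN_eq_sum {N : ℤ → ℝ} {a b : ℕ} (hab : a ≤ b) (x y : ℤ) :
    kerN N a b x y = ∑ t ∈ Finset.Ico a b, (kerK t (x - y) : ℂ) * ee (-(N x * y)) := by
  rw [kerN, ← sum_kerK hab, ← Finset.sum_mul]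
  push_cast
  rfl

lemma abs_kerK_sub_le' (t : ℕ) (m n : ℤ) :
    |kerK t m - kerK t n| ≤ 10 * |((m - n : ℤ) : ℝ)| / 4 ^ t := by
  have key : ∀ (k : ℕ) (n : ℤ), |kerK t (n + k) - kerK t n| ≤ 10 * k / 4 ^ t := by
    intro k n
    induction k with
    | zero => simp
    | succ k ih =>
      have h1 := abs_kerK_sub_le t (n + k)
      calc |kerK t (n + (k + 1 : ℕ)) - kerK t n|
          = |(kerK t (n + k + 1) - kerK t (n + k)) + (kerK t (n + k) - kerK t n)| := by
            push_cast; rw [← add_assoc]; congr 1; ring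
        _ ≤ 10 / 4 ^ t + 10 * k / 4 ^ t := (abs_add_le _ _).trans (add_le_add h1 ih)
        _ = _ := by push_cast; ring
  rcases le_total n m with h | h
  · obtain ⟨k, hk⟩ := Int.eq_ofNat_of_zero_le (sub_nonneg.2 h)
    have := key k n
    rw [hk]
    have e : m = n + k := by omega
    rw [e]
    simpa using this
  · obtain ⟨k, hk⟩ := Int.eq_ofNat_of_zero_le (sub_nonneg.2 h)
    have := key k m
    have e' : |((m - n : ℤ) : ℝ)| = |((n - m : ℤ) : ℝ)| := by push_cast; exact abs_sub_comm _ _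
    rw [abs_sub_comm, e', hk]
    have e : n = m + k := by omega
    rw [e]
    simpa using this

lemma norm_dem_sub_le {N : ℤ → ℝ} {W Z : Finset ℤ} {a b : ℤ → ℕ} {θ : ℝ} {y y' : ℤ} {τ : ℕ}
    (hZW : Z ⊆ W) (hab : ∀ z ∈ Z, a z ≤ b z) (hθ : ∀ z ∈ Z, |θ - N z| ≤ 4 / 2 ^ b z)
    (hy : |y - y'| ≤ 2 ^ τ) (h : ℤ → ℂ)
    (hτ : ∀ z ∈ Z, ∀ t, a z ≤ t → t < b z → (|z - y| < 2 ^ (t + 1) ∨ |z - y'| < 2 ^ (t + 1)) →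
      τ ≤ t) :
    ‖dem N Z h a b θ y - dem N Z h a b θ y'‖ ≤
      144 * |((y - y' : ℤ) : ℝ)| / 2 ^ τ * mx W (fun z => if z ∈ Z then ‖h z‖ else 0) y' := by
  classical
  set hZ : ℤ → ℝ := fun z => if z ∈ Z then ‖h z‖ else 0 with hhZ
  have hZ0 : ∀ z, 0 ≤ hZ z := fun z => by simp only [hhZ]; split_ifs <;> positivity
  set ψ : ℕ → ℤ → ℂ := fun t z => (kerK t (z - y) : ℂ) * ee ((θ - N z) * y) -
    (kerK t (z - y') : ℂ) * ee ((θ - N z) * y') with hψ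
  have e1 : ∀ w, dem N Z h a b θ w = ∑ z ∈ Z, ∑ t ∈ Finset.Ico (a z) (b z),
      h z * ((kerK t (z - w) : ℂ) * ee ((θ - N z) * w)) := by
    intro w
    rw [dem, vop, Finset.mul_sum]
    refine Finset.sum_congr rfl fun z hz => ?_
    rw [kerN_eq_sum (hab z hz), Finset.mul_sum, Finset.mul_sum]
    refine Finset.sum_congr rfl fun t _ => ?_
    have : ee ((θ - N z) * w) = ee (θ * w) * ee (-(N z * w)) := by
      rw [← ee_add]; congr 1; ring
    rw [this]; ring
  rw [e1, e1, ← Finset.sum_sub_distrib]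
  simp only [← Finset.sum_sub_distrib, ← mul_sub]
  set T := Z.sup b
  set d : ℝ := |((y - y' : ℤ) : ℝ)| with hd
  have h1 : ∀ z ∈ Z, ∀ t ∈ Finset.Ico (a z) (b z), ‖h z * ψ t z‖ ≤
      if t ∈ Finset.Ico τ T ∧ Near (t + 2) y' z then ‖h z‖ * (18 * d / 4 ^ t) else 0 := by
    intro z hz t ht
    rw [Finset.mem_Ico] at ht
    have htT : t < T := lt_of_lt_of_le ht.2 (Finset.le_sup hz)
    have h0 : 0 ≤ ‖h z‖ * (18 * d / 4 ^ t) := by positivity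
    by_cases hh : |z - y| < 2 ^ (t + 1) ∨ |z - y'| < 2 ^ (t + 1)
    · have hτt := hτ z hz t ht.1 ht.2 hh
      have hp : (2 : ℤ) ^ τ ≤ 2 ^ t := pow_le_pow_right₀ (by norm_num) hτt
      have hnear : Near (t + 2) y' z := by
        refine near_of_abs_lt ?_
        have e2 : (2 : ℤ) ^ (t + 2) = 4 * 2 ^ t := by ring
        have e3 : (2 : ℤ) ^ (t + 1) = 2 * 2 ^ t := by ring
        rw [abs_le] at *
        rw [abs_lt, abs_lt] at hh
        constructor <;> omega
      rw [if_pos ⟨Finset.mem_Ico.2 ⟨hτt, htT⟩, hnear⟩, norm_mul]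
      refine mul_le_mul_of_nonneg_left ?_ (norm_nonneg _)
      have e4 : ψ t z = ((kerK t (z - y) - kerK t (z - y') : ℝ) : ℂ) * ee ((θ - N z) * y) +
          (kerK t (z - y') : ℂ) * (ee ((θ - N z) * y) - ee ((θ - N z) * y')) := by
        rw [hψ]; push_cast; ring
      have h3 := abs_kerK_sub_le' t (z - y) (z - y')
      have e5 : |((z - y - (z - y') : ℤ) : ℝ)| = d := by
        rw [hd, ← abs_neg]; push_cast; congr 1; ring
      rw [e5] at h3
      have h4 : ‖ee ((θ - N z) * y) - ee ((θ - N z) * y')‖ ≤ 4 / 2 ^ t * d := by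
        refine (norm_ee_sub_le _ _).trans ?_
        rw [← mul_sub, abs_mul, hd]
        push_cast
        have : (2 : ℝ) ^ t ≤ 2 ^ b z := pow_le_pow_right₀ (by norm_num) ht.2.le
        refine mul_le_mul_of_nonneg_right ((hθ z hz).trans ?_) (abs_nonneg _)
        gcongr
      rw [e4]
      refine (norm_add_le _ _).trans ?_
      rw [norm_mul, norm_mul, norm_ee, mul_one, Complex.norm_real, Complex.norm_real,
        Real.norm_eq_abs, Real.norm_eq_abs]
      calc _ ≤ 10 * d / 4 ^ t + 2 / 2 ^ t * (4 / 2 ^ t * d) := by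
            gcongr
            exact abs_kerK_le _ _
        _ = 18 * d / 4 ^ t := by rw [four_pow_eq]; field_simp; ring
    · push Not at hh
      have h2 : ψ t z = 0 := by
        have e2 : ∀ w, 2 ^ (t + 1) ≤ |z - w| → kerK t (z - w) = 0 := by
          intro w hw
          by_contra hne
          have h5 := (kerK_support hne).2
          have : (|z - w| : ℤ) < 2 ^ (t + 1) := by exact_mod_cast h5
          omega
        rw [hψ]
        simp only [e2 y hh.1, e2 y' hh.2]
        simp
      rw [h2, mul_zero, norm_zero]
      split_ifs <;> positivity
  calc _ ≤ ∑ z ∈ Z, ∑ t ∈ Finset.Ico (a z) (b z),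
        if t ∈ Finset.Ico τ T ∧ Near (t + 2) y' z then ‖h z‖ * (18 * d / 4 ^ t) else 0 := by
        refine (norm_sum_le _ _).trans (Finset.sum_le_sum fun z hz => ?_)
        exact (norm_sum_le _ _).trans (Finset.sum_le_sum fun t ht => h1 z hz t ht)
    _ ≤ ∑ z ∈ Z, ∑ t ∈ Finset.Ico τ T,
        if Near (t + 2) y' z then ‖h z‖ * (18 * d / 4 ^ t) else 0 := by
        refine Finset.sum_le_sum fun z hz => ?_
        simp only [ite_and]
        rw [← Finset.sum_filter]
        refine Finset.sum_le_sum_of_subset_of_nonneg ?_ ?_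
        · intro t ht
          exact (Finset.mem_filter.1 ht).2
        · intro t _ _
          split_ifs <;> positivity
    _ ≤ ∑ t ∈ Finset.Ico τ T, 72 * d / 2 ^ t * mx W hZ y' := by
        rw [Finset.sum_comm]
        refine Finset.sum_le_sum fun t _ => ?_
        calc _ = ∑ z ∈ Z, if Near (t + 2) y' z then hZ z * (18 * d / 4 ^ t) else 0 := by
              refine Finset.sum_congr rfl fun z hz => ?_
              simp only [hhZ, if_pos hz]
          _ ≤ ∑ z ∈ W, if Near (t + 2) y' z then hZ z * (18 * d / 4 ^ t) else 0 := by
              refine Finset.sum_le_sum_of_subset_of_nonneg hZW fun z _ _ => ?_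
              have := hZ0 z
              split_ifs <;> positivity
          _ = 72 * d / 2 ^ t * avg W (t + 2) hZ y' := by
              rw [← Finset.sum_filter, ← Finset.sum_mul, avg, four_pow_eq, pow_add]
              field_simp
              ring
          _ ≤ _ := by
              have := avg_le_mx (W := W) hZ0 (t + 2) y'
              gcongr
    _ = 72 * d / 2 ^ τ * mx W hZ y' * ∑ t ∈ Finset.Ico τ T, (2 : ℝ) ^ τ / 2 ^ t := by
        rw [Finset.mul_sum]
        refine Finset.sum_congr rfl fun t _ => ?_
        field_simp
    _ ≤ 72 * d / 2 ^ τ * mx W hZ y' * 2 := by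
        have h5 := mx_nonneg (W := W) hZ0 y'
        refine mul_le_mul_of_nonneg_left ?_ (by positivity)
        refine le_trans (Finset.sum_le_sum_of_subset_of_nonneg ?_ ?_) (sum_two_pow_Icc_le τ T)
        · intro t ht
          rw [Finset.mem_Ico] at ht
          rw [Finset.mem_Icc]; omega
        · intro t _ _; positivity
    _ = _ := by ring

lemma sum_mx_indicator_sq_le {W Z : Finset ℤ} (hZW : Z ⊆ W) (h : ℤ → ℂ) :
    ∑ y ∈ W, mx W (fun z => if z ∈ Z then ‖h z‖ else 0) y ^ 2 ≤ 580 * ∑ z ∈ Z, ‖h z‖ ^ 2 := by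
  refine (sum_mx_sq_le fun y => by split_ifs <;> positivity).trans (le_of_eq ?_)
  congr 1
  rw [← Finset.sum_subset hZW]
  · exact Finset.sum_congr rfl fun z hz => by rw [if_pos hz]
  · intro z _ hz; rw [if_neg hz]; simp

lemma vop_eq_zero {N : ℤ → ℝ} {Z : Finset ℤ} {a b : ℤ → ℕ} {h : ℤ → ℂ} {y : ℤ}
    (hab : ∀ z ∈ Z, a z ≤ b z)
    (hy : ∀ z ∈ Z, ∀ t, a z ≤ t → t < b z → 2 ^ (t + 1) ≤ |z - y|) : vop N Z h a b y = 0 := by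
  refine Finset.sum_eq_zero fun z hz => ?_
  rw [kerN_eq_sum (hab z hz), Finset.sum_eq_zero, mul_zero]
  intro t ht
  rw [Finset.mem_Ico] at ht
  have : kerK t (z - y) = 0 := by
    by_contra hne
    have h5 := (kerK_support hne).2
    have h6 : (|z - y| : ℤ) < 2 ^ (t + 1) := by exact_mod_cast h5
    have := hy z hz t ht.1 ht.2
    omega
  rw [this]; simp

/-- Gain in the tree estimate on a set which is sparse around the tree. -/
lemma sum_norm_vop_tree_sq_le_of_thin {N : ℤ → ℝ} {W G Z F : Finset ℤ} {δ γ : ℝ} {a b : ℤ → ℕ}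
    {θ : ℝ} (hδ : 0 ≤ δ) (hδ1 : δ ≤ 1) (hγ : 0 ≤ γ) (hZ : Z ⊆ G) (hab : ∀ z ∈ Z, a z ≤ b z)
    (hθ : ∀ z ∈ Z, |θ - N z| ≤ 4 / 2 ^ b z) (hL : ∀ z ∈ Z, Low N G δ z (a z + 1))
    (hW : ∀ z ∈ Z, ∀ y, |z - y| ≤ 2 ^ (b z + 1) → y ∈ W) (h : ℤ → ℂ)
    (hF : ∀ z ∈ Z, ∀ s, ((F.filter fun y => Near s z y).card : ℝ) ≤ γ * 2 ^ s) :
    ∑ y ∈ F, ‖vop N Z h a b y‖ ^ 2 ≤ 20000000000 * γ * ∑ z ∈ Z, ‖h z‖ ^ 2 := by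
  classical
  have hZW : Z ⊆ W := fun z hz => hW z hz z (by simp)
  have htree := sum_norm_vop_tree_sq_le (W := W) hδ hZ hab hθ hL (fun z hz y hy => hW z hz y
    (hy.trans (pow_le_pow_right₀ (by norm_num) (Nat.le_succ _)))) h
  set M : ℤ → ℝ := mx W (fun z => if z ∈ Z then ‖h z‖ else 0) with hM
  have hM0 : ∀ y, 0 ≤ M y := fun y => mx_nonneg (fun z => by split_ifs <;> positivity) y
  have hMs := sum_mx_indicator_sq_le hZW h
  rw [← hM] at hMs
  set Q := F.filter fun y => vop N Z h a b y ≠ 0 with hQ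
  have hex : ∀ y, y ∈ Q → ∃ t, ∃ z ∈ Z, a z ≤ t ∧ t < b z ∧ |z - y| < 2 ^ (t + 1) := by
    intro y hy
    by_contra! hcon
    exact (Finset.mem_filter.1 hy).2 (vop_eq_zero hab fun z hz t h1 h2 => hcon t z hz h1 h2)
  rcases Z.eq_empty_or_nonempty with rfl | ⟨z₀, hz₀⟩
  · simp [vop]
  have hhit : ∀ y, ∃ t, ∃ z ∈ Z, a z ≤ t ∧ |z - y| < 2 ^ (t + 1) := by
    intro y
    obtain ⟨k, hk⟩ := pow_unbounded_of_one_lt |z₀ - y| (by norm_num : (1 : ℤ) < 2)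
    refine ⟨max k (a z₀), z₀, hz₀, le_max_right _ _, hk.trans_le ?_⟩
    exact pow_le_pow_right₀ (by norm_num) (by omega)
  set â : ℤ → ℕ := fun y => Nat.find (hhit y) + 1 with hâ
  have hspec : ∀ y, ∃ z ∈ Z, a z ≤ â y - 1 ∧ |z - y| < 2 ^ (â y) := fun y => by
    have := Nat.find_spec (hhit y)
    simpa [hâ] using this
  have hmin : ∀ y t z, z ∈ Z → a z ≤ t → |z - y| < 2 ^ (t + 1) → â y ≤ t + 1 := fun y t z h1 h2 h3 => by
    have := Nat.find_min' (hhit y) ⟨z, h1, h2, h3⟩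
    simp only [hâ]; omega
  obtain ⟨c, hc⟩ := exists_stopping (W ∪ Q) â (fun z _ => by simp [hâ])
  have hc' := fun y (hy : y ∈ Q) => hc y ⟨y, Finset.mem_union_right _ hy, â y, rfl, le_rfl⟩
  have hblk : ∀ y ∈ Q, ∀ y', blk (c y) y' = blk (c y) y → y' ∈ W := by
    intro y hy y' hyy
    obtain ⟨t, z, hz, h1, h2, h3⟩ := hex y hy
    have h4 := (hc' y hy).1 y (Finset.mem_union_right _ hy) rfl
    have h5 := hmin y t z hz h1 h3
    refine hW z hz y' ?_
    have h6 : |y - y'| < 2 ^ (c y) := by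
      have h7 := blk_bounds (c y) y
      have h8 := blk_bounds (c y) y'
      rw [hyy] at h8
      have e4 : (blk (c y) y + 1) * 2 ^ c y = blk (c y) y * 2 ^ c y + 2 ^ c y := by ring
      rw [e4] at h7 h8
      rw [abs_lt]; constructor <;> omega
    have h7 : (2 : ℤ) ^ c y ≤ 2 ^ b z := pow_le_pow_right₀ (by norm_num) (by omega)
    have h8 : (2 : ℤ) ^ (t + 1) ≤ 2 ^ b z := pow_le_pow_right₀ (by norm_num) (by omega)
    rw [pow_succ]
    rw [abs_lt] at *
    rw [abs_le]
    constructor <;> omega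
  have hmain := sum_le_of_stopping Q W c (4 * γ) (fun y => ‖vop N Z h a b y‖ ^ 2)
    (fun y => (‖vop N Z h a b y‖ + 144 * M y) ^ 2) (by positivity)
    (fun y hy y' _ hyy => (hc' y hy).2.2 y' hyy) ?_ ?_ (fun _ _ => sq_nonneg _) ?_
  · have h1 : ∑ y ∈ W, (‖vop N Z h a b y‖ + 144 * M y) ^ 2 ≤
        ∑ y ∈ W, (2 * ‖vop N Z h a b y‖ ^ 2 + 41472 * M y ^ 2) := by
      refine Finset.sum_le_sum fun y _ => ?_
      nlinarith [sq_nonneg (‖vop N Z h a b y‖ - 144 * M y)]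
    rw [Finset.sum_add_distrib, ← Finset.mul_sum, ← Finset.mul_sum] at h1
    have h0 : 0 ≤ ∑ z ∈ Z, ‖h z‖ ^ 2 := Finset.sum_nonneg fun _ _ => sq_nonneg _
    have h2 : ∑ y ∈ W, (‖vop N Z h a b y‖ + 144 * M y) ^ 2 ≤
        5000000000 * ∑ z ∈ Z, ‖h z‖ ^ 2 := by
      have h3 : 2000000000 * δ * ∑ z ∈ Z, ‖h z‖ ^ 2 ≤ 2000000000 * ∑ z ∈ Z, ‖h z‖ ^ 2 :=
        mul_le_mul_of_nonneg_right (by linarith) h0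
      linarith
    have h4 : ∑ y ∈ F, ‖vop N Z h a b y‖ ^ 2 = ∑ y ∈ Q, ‖vop N Z h a b y‖ ^ 2 := by
      rw [hQ, Finset.sum_filter]
      refine Finset.sum_congr rfl fun y _ => ?_
      split_ifs with h5
      · rfl
      · push Not at h5; simp [h5]
    rw [h4]
    calc _ ≤ _ := hmain
      _ ≤ 4 * γ * (5000000000 * ∑ z ∈ Z, ‖h z‖ ^ 2) := by gcongr
      _ = _ := by ring
  · intro y hy
    obtain ⟨-, ⟨w, hw, hwb, hwc⟩, -⟩ := hc' y hy
    obtain ⟨z, hz, hza, hzw⟩ := hspec w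
    calc _ ≤ ((F.filter fun y' => Near (c y + 2) z y').card : ℝ) := by
          refine Nat.cast_le.2 (Finset.card_le_card fun y' hy' => ?_)
          rw [Finset.mem_filter] at hy' ⊢
          refine ⟨(Finset.mem_filter.1 hy'.1).1, near_of_abs_lt ?_⟩
          have h7 := blk_bounds (c y + 1) w
          have h8 := blk_bounds (c y + 1) y'
          rw [blk_mono (Nat.le_add_right (c y) 1) hy'.2] at h8
          rw [hwb] at h7
          have e4 : (blk (c y + 1) y + 1) * 2 ^ (c y + 1) =
            blk (c y + 1) y * 2 ^ (c y + 1) + 2 ^ (c y + 1) := by ring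
          have h9 : (2 : ℤ) ^ â w ≤ 2 ^ (c y + 1) := pow_le_pow_right₀ (by norm_num) hwc
          have e5 : (2 : ℤ) ^ (c y + 2) = 2 * 2 ^ (c y + 1) := by ring
          rw [e4] at h7 h8
          rw [abs_lt] at hzw
          rw [abs_le]; constructor <;> omega
      _ ≤ γ * 2 ^ (c y + 2) := hF z hz _
      _ = _ := by ring
  · intro y hy y' hy'
    rw [mem_blkSet] at hy'
    exact hblk y hy y' hy'
  · intro y hy y' hyy
    refine pow_le_pow_left₀ (norm_nonneg _) ?_ 2
    have hyy' : |y - y'| ≤ 2 ^ (c y) := by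
      have h7 := blk_bounds (c y) y
      have h8 := blk_bounds (c y) y'
      rw [hyy] at h8
      have e4 : (blk (c y) y + 1) * 2 ^ c y = blk (c y) y * 2 ^ c y + 2 ^ c y := by ring
      rw [e4] at h7 h8
      rw [abs_le]; constructor <;> omega
    have h1 := norm_dem_sub_le (W := W) (τ := c y) hZW hab hθ hyy' h (by
      intro z hz t h1 h2 h3
      rcases h3 with h3 | h3
      · have := hmin y t z hz h1 h3
        have := (hc' y hy).1 y (Finset.mem_union_right _ hy) rfl
        omega
      · have := hmin y' t z hz h1 h3
        have := (hc' y hy).1 y' (Finset.mem_union_left _ (hblk y hy y' hyy)) hyy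
        omega)
    rw [← norm_dem N Z h a b θ y, ← norm_dem N Z h a b θ y']
    have h2 : 144 * |((y - y' : ℤ) : ℝ)| / 2 ^ c y * M y' ≤ 144 * M y' := by
      refine mul_le_mul_of_nonneg_right ?_ (hM0 y')
      rw [div_le_iff₀ (by positivity)]
      have : |((y - y' : ℤ) : ℝ)| ≤ 2 ^ c y := by exact_mod_cast hyy'
      linarith
    have h3 := norm_sub_norm_le (dem N Z h a b θ y) (dem N Z h a b θ y')
    rw [← hM] at h1
    linarith

/-! ### Few scales -/

lemma kerN_add {N : ℤ → ℝ} (a b c : ℕ) (x y : ℤ) :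
    kerN N a c x y = kerN N a b x y + kerN N b c x y := by
  simp only [kerN]; push_cast; ring

lemma vop_add (N : ℤ → ℝ) (A : Finset ℤ) (h : ℤ → ℂ) (a b c : ℤ → ℕ) (y : ℤ) :
    vop N A h a c y = vop N A h a b y + vop N A h b c y := by
  simp only [vop, ← Finset.sum_add_distrib, ← mul_add]
  exact Finset.sum_congr rfl fun x _ => by rw [← kerN_add]

lemma vop_filter (N : ℤ → ℝ) (A : Finset ℤ) (p : ℤ → Prop) [DecidablePred p] (h : ℤ → ℂ)
    (a b : ℤ → ℕ) (hp : ∀ x ∈ A, ¬ p x → h x = 0 ∨ a x = b x) (y : ℤ) :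
    vop N A h a b y = vop N (A.filter p) h a b y := by
  rw [vop, vop, Finset.sum_filter]
  refine Finset.sum_congr rfl fun x hx => ?_
  split_ifs with h1
  · rfl
  · rcases hp x hx h1 with h2 | h2
    · rw [h2, zero_mul]
    · rw [h2, kerN, sub_self]; simp

lemma vop_congr {N : ℤ → ℝ} {A : Finset ℤ} {h h' : ℤ → ℂ} {a a' b b' : ℤ → ℕ} {y : ℤ}
    (hh : ∀ x ∈ A, h x = h' x) (ha : ∀ x ∈ A, a x = a' x) (hb : ∀ x ∈ A, b x = b' x) :
    vop N A h a b y = vop N A h' a' b' y :=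
  Finset.sum_congr rfl fun x hx => by rw [hh x hx, ha x hx, hb x hx]

lemma vop_eq_sum_single {N : ℤ → ℝ} {A : Finset ℤ} {a b : ℤ → ℕ} {h : ℤ → ℂ} {L : ℕ}
    (hab : ∀ x ∈ A, a x ≤ b x) (hL : ∀ x ∈ A, b x ≤ a x + L) (y : ℤ) :
    vop N A h a b y = ∑ i ∈ Finset.range L, vop N (A.filter fun x => a x + i < b x) h
      (fun x => a x + i) (fun x => a x + i + 1) y := by
  simp only [vop]
  simp only [Finset.sum_filter]
  rw [Finset.sum_comm]
  refine Finset.sum_congr rfl fun x hx => ?_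
  rw [← Finset.sum_filter, ← Finset.mul_sum, kerN_eq_sum (hab x hx)]
  congr 1
  have : Finset.filter (fun i => a x + i < b x) (Finset.range L) = Finset.range (b x - a x) := by
    ext i
    have := hL x hx
    have := hab x hx
    simp only [Finset.mem_filter, Finset.mem_range]
    omega
  rw [this, Finset.sum_Ico_eq_sum_range]
  rfl

/-- Boundedly many scales. -/
lemma sum_norm_vop_few_sq_le {N : ℤ → ℝ} {W G A : Finset ℤ} {δ : ℝ} {a b : ℤ → ℕ} {L : ℕ}
    {h : ℤ → ℂ} (hδ : 0 < δ) (hδ1 : δ ≤ 1) (hA : A ⊆ G) (hN : ∀ x, N x ∈ Set.Icc (0 : ℝ) 1)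
    (hab : ∀ x ∈ A, a x ≤ b x) (hL : ∀ x ∈ A, b x ≤ a x + L)
    (hlow : ∀ x ∈ A, a x < b x → Low N G δ x (a x + 1)) (hh : ∀ x, ‖h x‖ ≤ 1)
    (hW : ∀ x ∈ A, ∀ y, |x - y| ≤ 2 ^ b x → y ∈ W) :
    ∑ y ∈ W, ‖vop N A h a b y‖ ^ 2 ≤ L ^ 2 * (11400 * √δ * G.card) := by
  simp only [vop_eq_sum_single hab hL]
  calc _ ≤ ∑ y ∈ W, (L : ℝ) * ∑ i ∈ Finset.range L,
        ‖vop N (A.filter fun x => a x + i < b x) h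
          (fun x => a x + i) (fun x => a x + i + 1) y‖ ^ 2 := by
        refine Finset.sum_le_sum fun y _ => ?_
        refine (pow_le_pow_left₀ (norm_nonneg _) (norm_sum_le _ _) 2).trans ?_
        refine (sq_sum_le_card_mul_sum_sq).trans (le_of_eq ?_)
        rw [Finset.card_range]
    _ = (L : ℝ) * ∑ i ∈ Finset.range L, ∑ y ∈ W,
        ‖vop N (A.filter fun x => a x + i < b x) h
          (fun x => a x + i) (fun x => a x + i + 1) y‖ ^ 2 := by
        rw [← Finset.mul_sum, Finset.sum_comm]
    _ ≤ (L : ℝ) * ∑ i ∈ Finset.range L, 11400 * √δ * G.card := by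
        refine mul_le_mul_of_nonneg_left (Finset.sum_le_sum fun i _ => ?_) (by positivity)
        refine (sum_norm_vop_single_sq_le (G := G) hδ hδ1 ((Finset.filter_subset _ _).trans hA) hN
          (fun x hx => ?_) hh (fun x hx y hy => ?_)).trans ?_
        · rw [Finset.mem_filter] at hx
          exact (hlow x hx.1 (by omega)).mono (by omega)
        · rw [Finset.mem_filter] at hx
          exact hW x hx.1 y (hy.trans (pow_le_pow_right₀ (by norm_num) (by omega)))
        · have : (((A.filter fun x => a x + i < b x).card : ℝ)) ≤ G.card := by
            exact_mod_cast Finset.card_le_card ((Finset.filter_subset _ _).trans hA)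
          gcongr
    _ = _ := by rw [Finset.sum_const, Finset.card_range, nsmul_eq_mul]; ring

lemma sum_norm_vop_few_le_of_thin {N : ℤ → ℝ} {G A F : Finset ℤ} {γ : ℝ} {a b : ℤ → ℕ} {L : ℕ}
    {h : ℤ → ℂ} (hγ : 0 ≤ γ) (hA : A ⊆ G) (hab : ∀ x ∈ A, a x ≤ b x)
    (hL : ∀ x ∈ A, b x ≤ a x + L) (hh : ∀ x, ‖h x‖ ≤ 1)
    (hF : ∀ z ∈ A, ∀ s, ((F.filter fun y => Near s z y).card : ℝ) ≤ γ * 2 ^ s) :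
    ∑ y ∈ F, ‖vop N A h a b y‖ ≤ L * (4 * γ * G.card) := by
  simp only [vop_eq_sum_single hab hL]
  calc _ ≤ ∑ y ∈ F, ∑ i ∈ Finset.range L, ∑ x ∈ A.filter fun x => a x + i < b x,
        ‖kerN N (a x + i) (a x + i + 1) x y‖ := by
        refine Finset.sum_le_sum fun y _ => (norm_sum_le _ _).trans
          (Finset.sum_le_sum fun i _ => (norm_sum_le _ _).trans (Finset.sum_le_sum fun x _ => ?_))
        rw [norm_mul]
        exact mul_le_of_le_one_left (norm_nonneg _) (hh x)
    _ = ∑ i ∈ Finset.range L, ∑ x ∈ A.filter fun x => a x + i < b x, ∑ y ∈ F,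
        ‖kerN N (a x + i) (a x + i + 1) x y‖ := by
        rw [Finset.sum_comm]
        exact Finset.sum_congr rfl fun i _ => Finset.sum_comm
    _ ≤ ∑ i ∈ Finset.range L, ∑ x ∈ A.filter fun x => a x + i < b x, 4 * γ := by
        refine Finset.sum_le_sum fun i _ => Finset.sum_le_sum fun x hx => ?_
        have h1 := hF x (Finset.mem_filter.1 hx).1 (a x + i + 1)
        calc _ ≤ ∑ y ∈ F.filter fun y => Near (a x + i + 1) x y, (2 : ℝ) / 2 ^ (a x + i) := by
              rw [Finset.sum_filter]
              refine Finset.sum_le_sum fun y _ => ?_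
              rw [kerN_succ, norm_mul, norm_ee, mul_one, Complex.norm_real, Real.norm_eq_abs]
              split_ifs with h2
              · exact abs_kerK_le _ _
              · by_contra h3
                have h4 : kerK (a x + i) (x - y) ≠ 0 := fun h5 => by simp [h5] at h3
                refine h2 (near_of_abs_lt (le_of_lt ?_))
                exact_mod_cast (kerK_support h4).2
          _ ≤ γ * 2 ^ (a x + i + 1) * (2 / 2 ^ (a x + i)) := by
              rw [Finset.sum_const, nsmul_eq_mul]
              gcongr
          _ = 4 * γ := by rw [pow_succ]; field_simp; ring
    _ ≤ ∑ i ∈ Finset.range L, G.card * (4 * γ) := by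
        refine Finset.sum_le_sum fun i _ => ?_
        rw [Finset.sum_const, nsmul_eq_mul]
        have : (((A.filter fun x => a x + i < b x).card : ℝ)) ≤ G.card := by
          exact_mod_cast Finset.card_le_card ((Finset.filter_subset _ _).trans hA)
        gcongr
    _ = _ := by rw [Finset.sum_const, Finset.card_range, nsmul_eq_mul]; ring

/-! ### Forests -/

/-- The set `Z` is organized in separated trees with tops `U`, the tree of `z` having top `u z`.
Points close to the boundary of their tree have been removed. -/
structure IsForest (N : ℤ → ℝ) (U Z : Finset ℤ) (u : ℤ → ℤ) (a b : ℤ → ℕ) (l : ℕ) : Prop where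
  mem : ∀ z ∈ Z, u z ∈ U
  le : ∀ z ∈ Z, b z ≤ b (u z)
  blk_eq : ∀ z ∈ Z, blk (b (u z)) z = blk (b (u z)) (u z)
  freq : ∀ z ∈ Z, |N (u z) - N z| ≤ 4 / 2 ^ b z
  long : ∀ z ∈ Z, a z + 3 * l + 10 ≤ b z
  sep : ∀ z ∈ Z, ∀ u' ∈ U, u' ≠ u z → blk (b u') z = blk (b u') u' → a z + 1 < b u' →
    1 / 4 / 2 ^ (a z + 1) ≤ |N (u z) - N u'|
  inner : ∀ z ∈ Z, ∀ y, |z - y| < 2 ^ (b (u z) - l) → blk (b (u z)) y = blk (b (u z)) z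

section
variable {N : ℤ → ℝ} {U Z : Finset ℤ} {u : ℤ → ℤ} {a b : ℤ → ℕ} {l : ℕ}

/-- The tree with top `w`. -/
def tree (Z : Finset ℤ) (u : ℤ → ℤ) (w : ℤ) : Finset ℤ := Z.filter fun z => u z = w

lemma mem_tree {w z : ℤ} : z ∈ tree Z u w ↔ z ∈ Z ∧ u z = w := Finset.mem_filter

/-- The part of the adjoint operator coming from the tree with top `w`. -/
noncomputable def treeOp (N : ℤ → ℝ) (Z : Finset ℤ) (u : ℤ → ℤ) (h : ℤ → ℂ) (a b : ℤ → ℕ) (l : ℕ)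
    (w : ℤ) (y : ℤ) : ℂ :=
  vop N (tree Z u w) h (fun z => a z + l) (fun z => b z - (l + 2)) y

/-- Majorant for the operator of the tree with top `w`. -/
noncomputable def treeMaj (N : ℤ → ℝ) (W Z : Finset ℤ) (u : ℤ → ℤ) (h : ℤ → ℂ) (a b : ℤ → ℕ)
    (l : ℕ) (w : ℤ) (y : ℤ) : ℝ :=
  ‖treeOp N Z u h a b l w y‖ + 144 * mx W (fun z => if z ∈ tree Z u w then ‖h z‖ else 0) y

lemma mx_tree_nonneg (W : Finset ℤ) (h : ℤ → ℂ) (w y : ℤ) :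
    0 ≤ mx W (fun z => if z ∈ tree Z u w then ‖h z‖ else 0) y :=
  mx_nonneg (fun z => by split_ifs <;> positivity) y

lemma treeMaj_nonneg (W : Finset ℤ) (h : ℤ → ℂ) (w y : ℤ) : 0 ≤ treeMaj N W Z u h a b l w y :=
  add_nonneg (norm_nonneg _) (mul_nonneg (by norm_num) (mx_tree_nonneg W h w y))

lemma sum_tree {M : Type*} [AddCommMonoid M] (hm : ∀ z ∈ Z, u z ∈ U) (f : ℤ → M) :
    ∑ w ∈ U, ∑ z ∈ tree Z u w, f z = ∑ z ∈ Z, f z :=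
  Finset.sum_fiberwise_of_maps_to hm f

namespace IsForest

lemma vop_eq (hfor : IsForest N U Z u a b l) (h : ℤ → ℂ) (y : ℤ) :
    vop N Z h (fun z => a z + l) (fun z => b z - (l + 2)) y =
      ∑ w ∈ U, treeOp N Z u h a b l w y :=
  (sum_tree hfor.mem _).symm

lemma exists_near (hfor : IsForest N U Z u a b l)
    {h : ℤ → ℂ} {w y : ℤ} (hy : treeOp N Z u h a b l w y ≠ 0) :
    ∃ z ∈ tree Z u w, |z - y| < 2 ^ (b w - (l + 2)) := by
  by_contra! hcon
  refine hy (vop_eq_zero (fun z hz => ?_) fun z hz t h1 h2 => ?_)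
  · have := hfor.long z (mem_tree.1 hz).1
    omega
  · refine le_trans (pow_le_pow_right₀ (by norm_num) ?_) (hcon z hz)
    have := hfor.le z (mem_tree.1 hz).1
    rw [(mem_tree.1 hz).2] at this
    omega

lemma blk_of_near (hfor : IsForest N U Z u a b l)
    {w z y y' : ℤ} (hz : z ∈ tree Z u w) (hzy : |z - y| < 2 ^ (b w - (l + 2)))
    (hyy : |y - y'| ≤ 1) : blk (b w) y' = blk (b w) w := by
  obtain ⟨hzZ, rfl⟩ := mem_tree.1 hz
  rw [← hfor.blk_eq z hzZ]
  refine hfor.inner z hzZ y' ?_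
  have h1 := hfor.long z hzZ
  have h2 := hfor.le z hzZ
  have e : b (u z) - l = (b (u z) - (l + 2)) + 2 := by omega
  have h3 : (1 : ℤ) ≤ 2 ^ (b (u z) - (l + 2)) := one_le_pow₀ (by norm_num)
  rw [e, pow_add]
  rw [abs_lt] at *
  rw [abs_le] at *
  constructor <;> omega

lemma tree_hyp (hfor : IsForest N U Z u a b l) {w : ℤ} :
    (∀ z ∈ tree Z u w, a z + l ≤ b z - (l + 2)) ∧
    (∀ z ∈ tree Z u w, |N w - N z| ≤ 4 / 2 ^ (b z - (l + 2))) := by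
  refine ⟨fun z hz => ?_, fun z hz => ?_⟩
  · have := hfor.long z (mem_tree.1 hz).1; omega
  · have := hfor.freq z (mem_tree.1 hz).1
    rw [(mem_tree.1 hz).2] at this
    refine this.trans ?_
    have : (2 : ℝ) ^ (b z - (l + 2)) ≤ 2 ^ b z := pow_le_pow_right₀ (by norm_num) (by omega)
    gcongr

lemma sum_treeOp_sq_le (hfor : IsForest N U Z u a b l)
    {W G : Finset ℤ} {δ : ℝ} (hδ : 0 ≤ δ) (hZ : Z ⊆ G)
    (hL : ∀ z ∈ Z, Low N G δ z (a z + 1))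
    (hW : ∀ z ∈ Z, ∀ y, |z - y| ≤ 2 ^ (b z + 1) → y ∈ W) (h : ℤ → ℂ) (w : ℤ) :
    ∑ y ∈ W, ‖treeOp N Z u h a b l w y‖ ^ 2 ≤
      2000000000 * δ * ∑ z ∈ tree Z u w, ‖h z‖ ^ 2 := by
  refine sum_norm_vop_tree_sq_le hδ ((Finset.filter_subset _ _).trans hZ)
    hfor.tree_hyp.1 (θ := N w) hfor.tree_hyp.2 (fun z hz => ?_) (fun z hz y hy => ?_) h
  · exact (hL z (mem_tree.1 hz).1).mono (by omega)
  · exact hW z (mem_tree.1 hz).1 y (hy.trans (pow_le_pow_right₀ (by norm_num) (by omega)))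

lemma sum_treeMaj_sq_le (hfor : IsForest N U Z u a b l)
    {W G : Finset ℤ} {δ : ℝ} (hδ : 0 ≤ δ) (hδ1 : δ ≤ 1) (hZ : Z ⊆ G)
    (hL : ∀ z ∈ Z, Low N G δ z (a z + 1))
    (hW : ∀ z ∈ Z, ∀ y, |z - y| ≤ 2 ^ (b z + 1) → y ∈ W) (h : ℤ → ℂ) (w : ℤ) :
    ∑ y ∈ W, treeMaj N W Z u h a b l w y ^ 2 ≤ 5000000000 * ∑ z ∈ tree Z u w, ‖h z‖ ^ 2 := by
  have h1 := hfor.sum_treeOp_sq_le hδ hZ hL hW h w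
  have hZW : tree Z u w ⊆ W := fun z hz => hW z (mem_tree.1 hz).1 z (by simp)
  have h2 := sum_mx_indicator_sq_le hZW h
  set M : ℤ → ℝ := mx W (fun z => if z ∈ tree Z u w then ‖h z‖ else 0) with hM
  have h3 : ∑ y ∈ W, treeMaj N W Z u h a b l w y ^ 2 ≤
      ∑ y ∈ W, (2 * ‖treeOp N Z u h a b l w y‖ ^ 2 + 41472 * M y ^ 2) := by
    refine Finset.sum_le_sum fun y _ => ?_
    simp only [treeMaj, ← hM]
    nlinarith [sq_nonneg (‖treeOp N Z u h a b l w y‖ - 144 * M y)]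
  rw [Finset.sum_add_distrib, ← Finset.mul_sum, ← Finset.mul_sum] at h3
  have h0 : 0 ≤ ∑ z ∈ tree Z u w, ‖h z‖ ^ 2 := Finset.sum_nonneg fun _ _ => sq_nonneg _
  have h4 : 2000000000 * δ * ∑ z ∈ tree Z u w, ‖h z‖ ^ 2 ≤
      2000000000 * ∑ z ∈ tree Z u w, ‖h z‖ ^ 2 :=
    mul_le_mul_of_nonneg_right (by linarith) h0
  linarith

/-- Scales contributing to both trees are much finer than their frequency separation. -/
lemma scale_le (hfor : IsForest N U Z u a b l)
    {w w' y y₀ z' z : ℤ} {t : ℕ} (hw : w ∈ U) (hw' : w' ∈ U) (hne : w ≠ w')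
    (hb : b w' ≤ b w)
    (hy₀ : blk (b w) y₀ = blk (b w) w) (hz' : z' ∈ tree Z u w')
    (hz'y : |z' - y₀| < 2 ^ (b w' - (l + 2))) (hyy : |y₀ - y| ≤ 1)
    (hz : z ∈ tree Z u w ∨ z ∈ tree Z u w') (hat : a z + l ≤ t)
    (hzy : |z - y| < 2 ^ (t + 1)) :
    1 / 2 ^ t ≤ |N w - N w'| * 8 / 2 ^ l := by
  have key : ∀ m, 1 / 4 / 2 ^ (m + 1) ≤ |N w - N w'| → m + l ≤ t →
      1 / 2 ^ t ≤ |N w - N w'| * 8 / 2 ^ l := by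
    intro m hm hmt
    calc (1 : ℝ) / 2 ^ t ≤ 1 / 2 ^ (m + l) := by
          have : (2 : ℝ) ^ (m + l) ≤ 2 ^ t := pow_le_pow_right₀ (by norm_num) hmt
          gcongr
      _ = 1 / 4 / 2 ^ (m + 1) * 8 / 2 ^ l := by rw [pow_add, pow_add]; field_simp; norm_num
      _ ≤ _ := by gcongr
  have hblk : ∀ x, blk (b w') x = blk (b w') w' → blk (b w) x = blk (b w) w := by
    intro x hx
    rw [← hy₀]
    refine blk_mono hb (hx.trans ?_)
    exact (hfor.blk_of_near hz' hz'y (by simp)).symm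
  have hin : ∀ x ∈ tree Z u w', 1 / 4 / 2 ^ (a x + 1) ≤ |N w - N w'| := by
    intro x hx
    obtain ⟨hxZ, hxu⟩ := mem_tree.1 hx
    have h1 := hfor.long x hxZ
    have h2 := hfor.le x hxZ
    have h3 := hfor.blk_eq x hxZ
    have h4 := hfor.sep x hxZ w hw
    rw [hxu] at h2 h3 h4
    rw [abs_sub_comm]
    exact h4 hne (hblk x h3) (by omega)
  obtain ⟨hz'Z, hz'u⟩ := mem_tree.1 hz'
  have hlz' := hfor.long z' hz'Z
  have hlez' := hfor.le z' hz'Z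
  rw [hz'u] at hlez'
  rcases hz with hz | hz
  swap
  · exact key _ (hin z hz) hat
  obtain ⟨hzZ, hzu⟩ := mem_tree.1 hz
  by_cases hzI : blk (b w') z = blk (b w') w'
  · by_cases hc : a z + 1 < b w'
    · have := hfor.sep z hzZ w' hw' (by rw [hzu]; exact hne.symm) hzI hc
      rw [hzu] at this
      exact key _ this hat
    · exact key _ (hin z' hz') (by omega)
  · refine key _ (hin z' hz') ?_
    have h5 : ¬ |z' - z| < 2 ^ (b w' - l) := by
      intro h6
      have := hfor.inner z' hz'Z z
      rw [hz'u] at this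
      exact hzI ((this h6).trans (by have := hfor.blk_eq z' hz'Z; rwa [hz'u] at this))
    by_contra! hlt
    have e : b w' - l = (b w' - (l + 2)) + 2 := by omega
    have h6 : (2 : ℤ) ^ (t + 2) ≤ 2 ^ (b w' - (l + 2)) :=
      pow_le_pow_right₀ (by norm_num) (by omega)
    have h7 : (1 : ℤ) ≤ 2 ^ (t + 1) := one_le_pow₀ (by norm_num)
    have e2 : (2 : ℤ) ^ (t + 2) = 2 * 2 ^ (t + 1) := by ring
    have h8 : |z' - z| ≤ |z' - y₀| + |y₀ - y| + |y - z| := by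
      have h9 := abs_sub_le z' y₀ z
      have h10 := abs_sub_le y₀ y z
      linarith
    rw [e, pow_add] at h5
    rw [abs_sub_comm y z] at h8
    omega

lemma norm_inner_le (hfor : IsForest N U Z u a b l)
    {W : Finset ℤ} (hN : ∀ x, N x ∈ Set.Icc (0 : ℝ) 1)
    (hW : ∀ z ∈ Z, ∀ y, |z - y| ≤ 2 ^ (b z + 1) → y ∈ W) (h : ℤ → ℂ) {w w' : ℤ}
    (hw : w ∈ U) (hw' : w' ∈ U) (hne : w ≠ w') (hb : b w' ≤ b w) :
    ‖∑ y ∈ W, treeOp N Z u h a b l w y * (starRingEnd ℂ) (treeOp N Z u h a b l w' y)‖ ≤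
      32 / 2 ^ l * ∑ y ∈ W, (if blk (b w) y = blk (b w) w then treeMaj N W Z u h a b l w y else 0) *
        (if blk (b w') y = blk (b w') w' then treeMaj N W Z u h a b l w' y else 0) := by
  classical
  have hZW : ∀ v, tree Z u v ⊆ W := fun v z hz => hW z (mem_tree.1 hz).1 z (by simp)
  have hpos : ∀ v y, 0 ≤ (if blk (b v) y = blk (b v) v then treeMaj N W Z u h a b l v y else 0) :=
    fun v y => by
      split_ifs
      · exact treeMaj_nonneg _ _ _ _
      · exact le_rfl
  have hRHS : 0 ≤ 32 / 2 ^ l * ∑ y ∈ W,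
      (if blk (b w) y = blk (b w) w then treeMaj N W Z u h a b l w y else 0) *
        (if blk (b w') y = blk (b w') w' then treeMaj N W Z u h a b l w' y else 0) :=
    mul_nonneg (by positivity) (Finset.sum_nonneg fun y _ => mul_nonneg (hpos _ _) (hpos _ _))
  set V : ℤ → ℤ → ℂ := fun v y =>
    dem N (tree Z u v) h (fun z => a z + l) (fun z => b z - (l + 2)) (N v) y with hV
  have hVn : ∀ v y, ‖V v y‖ = ‖treeOp N Z u h a b l v y‖ := fun v y => norm_dem _ _ _ _ _ _ _
  have hVo : ∀ v y, treeOp N Z u h a b l v y = ee (-(N v * y)) * V v y := fun v y =>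
    vop_eq_dem _ _ _ _ _ _ _
  set Φ : ℤ → ℂ := fun y => V w y * (starRingEnd ℂ) (V w' y) with hΦ
  have e1 : ∀ y, treeOp N Z u h a b l w y * (starRingEnd ℂ) (treeOp N Z u h a b l w' y) =
      ee (-(N w - N w') * y) * Φ y := by
    intro y
    rw [hVo, hVo, map_mul, conj_ee, hΦ]
    have : ee (-(N w - N w') * y) = ee (-(N w * y)) * ee (- -(N w' * y)) := by
      rw [← ee_add]; congr 1; ring
    rw [this]; ring
  simp only [e1]
  have hΦ0 : ∀ y, Φ y ≠ 0 → treeOp N Z u h a b l w y ≠ 0 ∧ treeOp N Z u h a b l w' y ≠ 0 := by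
    intro y hy
    have hne : ∀ v, V v y ≠ 0 → treeOp N Z u h a b l v y ≠ 0 := fun v hv =>
      norm_ne_zero_iff.1 (by rw [← hVn]; exact norm_ne_zero_iff.2 hv)
    refine ⟨hne _ (left_ne_zero_of_mul hy), hne _ fun h0 => hy ?_⟩
    simp only [hΦ, h0, map_zero, mul_zero]
  by_cases hall : ∀ y, Φ y = 0
  · simp only [hall, mul_zero, Finset.sum_const_zero, norm_zero]
    exact hRHS
  push Not at hall
  -- any point where both operators are active gives a frequency separation
  have hsup : ∀ y₀ y, Φ y₀ ≠ 0 → |y₀ - y| ≤ 1 → blk (b w) y = blk (b w) w ∧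
      blk (b w') y = blk (b w') w' ∧ y ∈ W ∧
      ∃ z' ∈ tree Z u w', |z' - y₀| < 2 ^ (b w' - (l + 2)) := by
    intro y₀ y hy₀ hyy
    obtain ⟨z, hz, hzy⟩ := hfor.exists_near (hΦ0 y₀ hy₀).1
    obtain ⟨z', hz', hzy'⟩ := hfor.exists_near (hΦ0 y₀ hy₀).2
    refine ⟨hfor.blk_of_near hz hzy hyy, hfor.blk_of_near hz' hzy' hyy, ?_, z', hz', hzy'⟩
    obtain ⟨x, hx, t, h1, h2, h3⟩ : ∃ x ∈ tree Z u w, ∃ t, a x + l ≤ t ∧ t < b x - (l + 2) ∧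
        |x - y₀| < 2 ^ (t + 1) := by
      by_contra! hcon
      exact (hΦ0 y₀ hy₀).1 (vop_eq_zero hfor.tree_hyp.1 fun z hz t h1 h2 => hcon z hz t h1 h2)
    refine hW x (mem_tree.1 hx).1 y ?_
    have h4 : (2 : ℤ) ^ (t + 1) ≤ 2 ^ b x := pow_le_pow_right₀ (by norm_num) (by omega)
    have h5 : (1 : ℤ) ≤ 2 ^ b x := one_le_pow₀ (by norm_num)
    rw [pow_succ]
    rw [abs_lt] at h3
    rw [abs_le] at *
    constructor <;> omega
  set Δ := |N w - N w'| with hΔ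
  have hΔ0 : 0 < Δ := by
    obtain ⟨y₀, hy₀⟩ := hall
    obtain ⟨h1, h2, -, z', hz', hzy'⟩ := hsup y₀ y₀ hy₀ (by simp)
    obtain ⟨k, hk⟩ := pow_unbounded_of_one_lt |z' - y₀| (by norm_num : (1 : ℤ) < 2)
    have h3 := hfor.scale_le hw hw' hne hb (y := y₀) h1 hz' hzy' (by simp) (Or.inr hz')
      (t := a z' + l + k) (by omega)
      (hk.trans_le (pow_le_pow_right₀ (by norm_num) (by omega)))
    rw [← hΔ] at h3
    by_contra! h4
    have h5 : Δ * 8 / 2 ^ l ≤ 0 := div_nonpos_of_nonpos_of_nonneg (by linarith) (by positivity)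
    have h6 : (0 : ℝ) < 1 / 2 ^ (a z' + l + k) := by positivity
    linarith
  have hτex : ∃ τ : ℕ, (1 : ℝ) / 2 ^ τ ≤ Δ * 8 / 2 ^ l := by
    obtain ⟨τ, hτ⟩ := exists_pow_lt_of_lt_one (show 0 < Δ * 8 / 2 ^ l by positivity)
      (show (1 / 2 : ℝ) < 1 by norm_num)
    exact ⟨τ, by rw [← one_div_pow]; exact hτ.le⟩
  set τ := Nat.find hτex with hτ
  have hτ1 : (1 : ℝ) / 2 ^ τ ≤ Δ * 8 / 2 ^ l := Nat.find_spec hτex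
  have hτ2 : ∀ t : ℕ, (1 : ℝ) / 2 ^ t ≤ Δ * 8 / 2 ^ l → τ ≤ t := fun t ht => Nat.find_min' hτex ht
  set W' := W.filter fun y => Φ y ≠ 0 ∨ Φ (y + 1) ≠ 0 with hW'
  have h1 := norm_sum_ee_mul_le (W := W) (W' := W') (Δ := -(N w - N w'))
    (by
      have h1 := hN w
      have h2 := hN w'
      rw [Set.mem_Icc] at h1 h2
      rw [abs_le]; constructor <;> linarith)
    (by intro h; rw [hΔ, ← abs_neg, h, abs_zero] at hΔ0; exact lt_irrefl _ hΔ0) Φ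
    (fun y hy => (hsup y y hy (by simp)).2.2.1) (fun y hy => by
      refine ⟨Finset.mem_filter.2 ⟨(hsup y y hy (by simp)).2.2.1, Or.inl hy⟩,
        Finset.mem_filter.2 ⟨(hsup y (y - 1) hy (by simp)).2.2.1, Or.inr ?_⟩⟩
      rwa [sub_add_cancel])
  rw [abs_neg, ← hΔ] at h1
  refine h1.trans ?_
  have h2 : ∀ y ∈ W', ‖Φ (y + 1) - Φ y‖ ≤ 2 * (1 / 2 ^ τ) *
      ((if blk (b w) y = blk (b w) w then treeMaj N W Z u h a b l w y else 0) *
        (if blk (b w') y = blk (b w') w' then treeMaj N W Z u h a b l w' y else 0)) := by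
    intro y hy
    obtain ⟨y₀, hy₀, hd, hd'⟩ : ∃ y₀, Φ y₀ ≠ 0 ∧ |y₀ - y| ≤ 1 ∧ |y₀ - (y + 1)| ≤ 1 := by
      rcases (Finset.mem_filter.1 hy).2 with h | h
      · exact ⟨y, h, by simp, by simp⟩
      · exact ⟨y + 1, h, by simp, by simp⟩
    obtain ⟨hb1, hb2, hyW, z', hz', hzy'⟩ := hsup y₀ y hy₀ hd
    have hb0 := (hsup y₀ y₀ hy₀ (by simp)).1
    rw [if_pos hb1, if_pos hb2]
    have hdiff : ∀ v, v = w ∨ v = w' → ‖V v (y + 1) - V v y‖ ≤ 1 / 2 ^ τ *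
        (144 * mx W (fun z => if z ∈ tree Z u v then ‖h z‖ else 0) y) := by
      intro v hv
      have h3 := norm_dem_sub_le (N := N) (W := W) (τ := τ) (y := y + 1) (y' := y) (hZW v)
        (hfor.tree_hyp (w := v)).1
        (hfor.tree_hyp (w := v)).2 (by simp; exact one_le_pow₀ (by norm_num)) h
        (fun z hz t h4 h5 h6 => ?_)
      · refine h3.trans (le_of_eq ?_)
        simp
        ring
      · refine hτ2 t ?_
        have hz2 : z ∈ tree Z u w ∨ z ∈ tree Z u w' := by
          rcases hv with rfl | rfl
          · exact Or.inl hz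
          · exact Or.inr hz
        rcases h6 with h6 | h6
        · exact hfor.scale_le hw hw' hne hb hb0 hz' hzy' hd' hz2 h4 h6
        · exact hfor.scale_le hw hw' hne hb hb0 hz' hzy' hd hz2 h4 h6
    have d1 := hdiff w (Or.inl rfl)
    have d2 := hdiff w' (Or.inr rfl)
    set ε : ℝ := 1 / 2 ^ τ with hε
    have hε0 : 0 ≤ ε := by positivity
    have hε1 : ε ≤ 1 := by
      rw [hε, div_le_one (by positivity)]; exact one_le_pow₀ (by norm_num)
    have m1 := mx_tree_nonneg (u := u) (Z := Z) W h w y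
    have m2 := mx_tree_nonneg (u := u) (Z := Z) W h w' y
    simp only [treeMaj, ← hVn]
    set m := 144 * mx W (fun z => if z ∈ tree Z u w then ‖h z‖ else 0) y
    set m' := 144 * mx W (fun z => if z ∈ tree Z u w' then ‖h z‖ else 0) y
    have hm : 0 ≤ m := by positivity
    have hm' : 0 ≤ m' := by positivity
    have e2 : Φ (y + 1) - Φ y = (V w (y + 1) - V w y) * (starRingEnd ℂ) (V w' y) +
        V w (y + 1) * (starRingEnd ℂ) (V w' (y + 1) - V w' y) := by
      rw [hΦ, map_sub]; ring
    have h5 : ‖V w (y + 1)‖ ≤ ‖V w y‖ + m := by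
      have h6 := norm_sub_norm_le (V w (y + 1)) (V w y)
      have h7 : ε * m ≤ m := mul_le_of_le_one_left hm hε1
      linarith
    rw [e2]
    refine (norm_add_le _ _).trans ?_
    rw [norm_mul, norm_mul, RCLike.norm_conj, RCLike.norm_conj]
    calc _ ≤ ε * m * ‖V w' y‖ + (‖V w y‖ + m) * (ε * m') := by gcongr
      _ ≤ 2 * ε * ((‖V w y‖ + m) * (‖V w' y‖ + m')) := by
        have p1 : 0 ≤ ε * (‖V w y‖ * ‖V w' y‖) := by positivity
        have p2 : 0 ≤ ε * (‖V w y‖ * m') := by positivity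
        have p3 : 0 ≤ ε * (m * ‖V w' y‖) := by positivity
        have p4 : 0 ≤ ε * (m * m') := by positivity
        nlinarith
  calc 2 / Δ * ∑ y ∈ W', ‖Φ (y + 1) - Φ y‖
      ≤ 2 / Δ * ∑ y ∈ W', 2 * (Δ * 8 / 2 ^ l) *
      ((if blk (b w) y = blk (b w) w then treeMaj N W Z u h a b l w y else 0) *
        (if blk (b w') y = blk (b w') w' then treeMaj N W Z u h a b l w' y else 0)) := by
        refine mul_le_mul_of_nonneg_left (Finset.sum_le_sum fun y hy => ?_) (by positivity)
        refine (h2 y hy).trans (mul_le_mul_of_nonneg_right ?_ (mul_nonneg (hpos _ _) (hpos _ _)))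
        linarith
    _ ≤ 2 / Δ * (2 * (Δ * 8 / 2 ^ l) * ∑ y ∈ W,
      ((if blk (b w) y = blk (b w) w then treeMaj N W Z u h a b l w y else 0) *
        (if blk (b w') y = blk (b w') w' then treeMaj N W Z u h a b l w' y else 0))) := by
        rw [← Finset.mul_sum]
        gcongr
        · exact fun y _ _ => mul_nonneg (hpos _ _) (hpos _ _)
        · exact Finset.filter_subset _ _
    _ = _ := by field_simp; ring

lemma sum_norm_vop_sq_le (hfor : IsForest N U Z u a b l)
    {W G : Finset ℤ} {δ : ℝ} {K : ℕ} (hN : ∀ x, N x ∈ Set.Icc (0 : ℝ) 1)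
    (hδ : 0 ≤ δ) (hδ1 : δ ≤ 1) (hZ : Z ⊆ G) (hL : ∀ z ∈ Z, Low N G δ z (a z + 1))
    (hW : ∀ z ∈ Z, ∀ y, |z - y| ≤ 2 ^ (b z + 1) → y ∈ W)
    (hK : ∀ y, (U.filter fun w => blk (b w) y = blk (b w) w).card ≤ K) (h : ℤ → ℂ) :
    ∑ y ∈ W, ‖vop N Z h (fun z => a z + l) (fun z => b z - (l + 2)) y‖ ^ 2 ≤
      (4000000000 * δ + 320000000000 * K / 2 ^ l) * ∑ z ∈ Z, ‖h z‖ ^ 2 := by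
  classical
  set T : ℤ → ℤ → ℂ := treeOp N Z u h a b l with hT
  set g : ℤ → ℤ → ℝ := fun w y =>
    if blk (b w) y = blk (b w) w then treeMaj N W Z u h a b l w y else 0 with hg
  have hg0 : ∀ w y, 0 ≤ g w y := fun w y => by
    simp only [hg]; split_ifs
    · exact treeMaj_nonneg _ _ _ _
    · exact le_rfl
  set c : ℝ := 32 / 2 ^ l with hc
  have hc0 : 0 ≤ c := by positivity
  set S : ℤ → ℝ := fun w => ∑ y ∈ W, ‖T w y‖ ^ 2 with hS
  have hS0 : ∀ w, 0 ≤ S w := fun w => Finset.sum_nonneg fun _ _ => sq_nonneg _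
  have hp0 : ∀ w w', 0 ≤ c * ∑ y ∈ W, g w y * g w' y := fun w w' =>
    mul_nonneg hc0 (Finset.sum_nonneg fun y _ => mul_nonneg (hg0 _ _) (hg0 _ _))
  set d : ℤ → ℤ → ℝ := fun w w' =>
    (if w = w' then S w else 0) + c * ∑ y ∈ W, g w y * g w' y with hd
  have hd0 : ∀ w w', 0 ≤ d w w' := fun w w' => by
    refine add_nonneg ?_ (hp0 w w')
    split_ifs
    · exact hS0 w
    · exact le_rfl
  have h1 := sum_norm_sq_le_of_inner (W := W) (A := U) T (fun _ => 1) d ?_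
  swap
  · intro w hw w' hw'
    rcases eq_or_ne w w' with rfl | hne
    · refine le_trans ?_ (le_add_of_nonneg_right (hd0 w w))
      refine le_trans ?_ (le_add_of_nonneg_right (hp0 w w))
      rw [if_pos rfl]
      refine (norm_sum_le _ _).trans (le_of_eq (Finset.sum_congr rfl fun y _ => ?_))
      rw [norm_mul, RCLike.norm_conj, sq]
    · rcases le_total (b w') (b w) with hb | hb
      · refine le_trans ?_ (le_add_of_nonneg_right (hd0 w' w))
        refine le_trans ?_ (le_add_of_nonneg_left (by rw [if_neg hne]))
        exact hfor.norm_inner_le hN hW h hw hw' hne hb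
      · refine le_trans ?_ (le_add_of_nonneg_left (hd0 w w'))
        refine le_trans ?_ (le_add_of_nonneg_left (by rw [if_neg hne.symm]))
        refine le_trans (le_of_eq ?_) (hfor.norm_inner_le hN hW h hw' hw hne.symm hb)
        rw [← RCLike.norm_conj, map_sum]
        congr 1
        refine Finset.sum_congr rfl fun y _ => ?_
        rw [map_mul, RCLike.conj_conj, mul_comm]
  simp only [one_mul, norm_one] at h1
  have e1 : ∑ w ∈ U, ∑ w' ∈ U, d w w' = ∑ w ∈ U, S w + c * ∑ y ∈ W, (∑ w ∈ U, g w y) ^ 2 := by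
    simp only [hd, Finset.sum_add_distrib]
    congr 1
    · refine Finset.sum_congr rfl fun w hw => ?_
      rw [Finset.sum_ite_eq, if_pos hw]
    · simp only [← Finset.mul_sum, sq, Finset.sum_mul_sum]
      rw [Finset.sum_comm (s := W)]
      congr 1
      refine Finset.sum_congr rfl fun w _ => ?_
      rw [Finset.sum_comm]
      exact Finset.sum_congr rfl fun y _ => (Finset.mul_sum _ _ _).symm
  have h2 : ∀ y, (∑ w ∈ U, g w y) ^ 2 ≤ K * ∑ w ∈ U, treeMaj N W Z u h a b l w y ^ 2 := by
    intro y
    simp only [hg]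
    rw [← Finset.sum_filter]
    refine sq_sum_le_card_mul_sum_sq.trans ?_
    gcongr
    · exact hK y
    · exact Finset.filter_subset _ _
  have h3 : ∑ y ∈ W, (∑ w ∈ U, g w y) ^ 2 ≤ K * (5000000000 * ∑ z ∈ Z, ‖h z‖ ^ 2) := by
    refine (Finset.sum_le_sum fun y _ => h2 y).trans ?_
    rw [← Finset.mul_sum, Finset.sum_comm, ← sum_tree hfor.mem]
    refine mul_le_mul_of_nonneg_left ?_ (by positivity)
    rw [Finset.mul_sum]
    exact Finset.sum_le_sum fun w _ => hfor.sum_treeMaj_sq_le hδ hδ1 hZ hL hW h w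
  have h4 : ∑ w ∈ U, S w ≤ 2000000000 * δ * ∑ z ∈ Z, ‖h z‖ ^ 2 := by
    rw [← sum_tree hfor.mem, Finset.mul_sum]
    exact Finset.sum_le_sum fun w _ => hfor.sum_treeOp_sq_le hδ hZ hL hW h w
  have h5 := mul_le_mul_of_nonneg_left h3 hc0
  simp only [hfor.vop_eq]
  refine h1.trans ?_
  rw [e1]
  calc _ ≤ 2 * (2000000000 * δ * ∑ z ∈ Z, ‖h z‖ ^ 2 +
        c * (K * (5000000000 * ∑ z ∈ Z, ‖h z‖ ^ 2))) := by gcongr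
    _ = _ := by rw [hc]; ring

lemma sum_norm_vop_sq_le_of_thin (hfor : IsForest N U Z u a b l)
    {W G F : Finset ℤ} {δ γ : ℝ} {K : ℕ} (hδ : 0 ≤ δ) (hδ1 : δ ≤ 1)
    (hγ : 0 ≤ γ) (hZ : Z ⊆ G) (hL : ∀ z ∈ Z, Low N G δ z (a z + 1))
    (hW : ∀ z ∈ Z, ∀ y, |z - y| ≤ 2 ^ (b z + 1) → y ∈ W)
    (hK : ∀ y, (U.filter fun w => blk (b w) y = blk (b w) w).card ≤ K) (h : ℤ → ℂ)
    (hF : ∀ z ∈ Z, ∀ s, ((F.filter fun y => Near s z y).card : ℝ) ≤ γ * 2 ^ s) :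
    ∑ y ∈ F, ‖vop N Z h (fun z => a z + l) (fun z => b z - (l + 2)) y‖ ^ 2 ≤
      K * (20000000000 * γ * ∑ z ∈ Z, ‖h z‖ ^ 2) := by
  have hpt : ∀ y, ‖vop N Z h (fun z => a z + l) (fun z => b z - (l + 2)) y‖ ^ 2 ≤
      K * ∑ w ∈ U, ‖treeOp N Z u h a b l w y‖ ^ 2 := by
    intro y
    have h0 : ∀ w ∈ U, ‖treeOp N Z u h a b l w y‖ ≠ 0 → blk (b w) y = blk (b w) w := by
      intro w _ hw
      obtain ⟨z, hz, hzy⟩ := hfor.exists_near (norm_ne_zero_iff.1 hw)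
      exact hfor.blk_of_near hz hzy (by simp)
    rw [hfor.vop_eq]
    calc _ ≤ (∑ w ∈ U, ‖treeOp N Z u h a b l w y‖) ^ 2 :=
          pow_le_pow_left₀ (norm_nonneg _) (norm_sum_le _ _) 2
      _ = (∑ w ∈ U.filter fun w => blk (b w) y = blk (b w) w,
            ‖treeOp N Z u h a b l w y‖) ^ 2 := by
          rw [Finset.sum_filter_of_ne h0]
      _ ≤ _ := sq_sum_le_card_mul_sum_sq
      _ ≤ _ := by
          gcongr
          · exact hK y
          · exact Finset.filter_subset _ _
  refine (Finset.sum_le_sum fun y _ => hpt y).trans ?_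
  rw [← Finset.mul_sum, Finset.sum_comm]
  refine mul_le_mul_of_nonneg_left ?_ (by positivity)
  rw [← sum_tree hfor.mem, Finset.mul_sum]
  refine Finset.sum_le_sum fun w _ => ?_
  refine sum_norm_vop_tree_sq_le_of_thin (W := W) hδ hδ1 hγ ((Finset.filter_subset _ _).trans hZ)
    hfor.tree_hyp.1 (θ := N w) hfor.tree_hyp.2 (fun z hz => ?_) (fun z hz y hy => ?_) h
    fun z hz s => hF z (mem_tree.1 hz).1 s
  · exact (hL z (mem_tree.1 hz).1).mono (by omega)
  · exact hW z (mem_tree.1 hz).1 y (hy.trans (pow_le_pow_right₀ (by norm_num) (by omega)))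

end IsForest
end

/-! ### Dense tiles and the construction of forests -/

section
variable {N : ℤ → ℝ} {G : Finset ℤ} {d : ℕ}

/-- If the density near `(x, s)` is large, then some point has many frequency neighbours. -/
lemma exists_dense_of_not_low (hN : ∀ x, N x ∈ Set.Icc (0 : ℝ) 1) {x : ℤ} {s : ℕ}
    (h : ¬ Low N G (1 / 2 ^ d) x s) :
    ∃ w ∈ G, ∃ t, s ≤ t ∧ blk t w = blk t x ∧
      (2 : ℝ) ^ t ≤ 2 ^ (d + 2) * (freqSet N G t w (N w) (1 / 2 ^ t)).card ∧
      ∀ v ∈ Set.Icc (0 : ℝ) 1, |v - N w| ≤ 2 / 2 ^ t → |v - N x| ≤ 1 / 2 ^ (s - (d + 2)) := by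
  simp only [Low, not_forall, not_le] at h
  obtain ⟨t, ht, θ, r, hr, hθ, hcard⟩ := h
  set E := freqSet N G t x θ (r / 2 ^ t) with hE
  have h2t : (0 : ℝ) < 2 ^ t := by positivity
  have hEle : (E.card : ℝ) ≤ 2 ^ t := by
    have : E ⊆ blkSet t x := fun z hz => mem_blkSet.2 (mem_freqSet.1 hz).2.1
    have := Finset.card_le_card this
    rw [card_blkSet] at this
    exact_mod_cast this
  have hrd : r < 2 ^ d := by
    by_contra! h
    have : (2 : ℝ) ^ t ≤ 1 / 2 ^ d * r * 2 ^ t := by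
      have : 1 ≤ 1 / 2 ^ d * r := by rw [one_div_mul_eq_div, one_le_div (by positivity)]; exact h
      nlinarith
    linarith
  set c : ℤ → ℤ := fun w => ⌊(N w - θ) * 2 ^ t⌋ with hc
  have hmaps : ∀ w ∈ E, c w ∈ Finset.Icc (-⌈r⌉) ⌊r⌋ := by
    intro w hw
    have h1 := (mem_freqSet.1 hw).2.2
    rw [abs_le, ← neg_div, div_le_iff₀ h2t, le_div_iff₀ h2t] at h1
    rw [Finset.mem_Icc]
    refine ⟨Int.le_floor.2 ?_, Int.floor_le_floor h1.2⟩
    push_cast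
    linarith [Int.le_ceil r]
  have hcells : ((Finset.Icc (-⌈r⌉) ⌊r⌋).card : ℝ) ≤ 4 * r := by
    rw [Int.card_Icc]
    have h1 : (0 : ℤ) ≤ ⌊r⌋ := Int.floor_nonneg.2 (by linarith)
    have h2 : (0 : ℤ) ≤ ⌈r⌉ := Int.ceil_nonneg (by linarith)
    have h3 : ((⌊r⌋ + 1 - -⌈r⌉).toNat : ℤ) = ⌊r⌋ + 1 + ⌈r⌉ := by
      rw [Int.toNat_of_nonneg (by omega)]; ring
    have h4 : ((⌊r⌋ + 1 - -⌈r⌉).toNat : ℝ) = ⌊r⌋ + 1 + ⌈r⌉ := by exact_mod_cast h3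
    rw [h4]
    linarith [Int.floor_le r, Int.ceil_lt_add_one r]
  obtain ⟨k, hk, hkc⟩ : ∃ k ∈ Finset.Icc (-⌈r⌉) ⌊r⌋,
      (2 : ℝ) ^ t < 2 ^ (d + 2) * (E.filter fun w => c w = k).card := by
    by_contra! hcon
    have h1 := Finset.card_eq_sum_card_fiberwise hmaps
    have h3 : (E.card : ℝ) = ∑ k ∈ Finset.Icc (-⌈r⌉) ⌊r⌋, ((E.filter fun w => c w = k).card : ℝ) := by
      exact_mod_cast h1
    have h4 : 2 ^ (d + 2) * (E.card : ℝ) ≤ 4 * r * 2 ^ t := by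
      rw [h3, Finset.mul_sum]
      refine (Finset.sum_le_sum hcon).trans ?_
      rw [Finset.sum_const, nsmul_eq_mul]
      gcongr
    rw [pow_add] at h4
    have h5 : 1 / 2 ^ d * r * 2 ^ t = r * 2 ^ t / 2 ^ d := by ring
    rw [h5, div_lt_iff₀ (by positivity)] at hcard
    nlinarith
  have hne : (E.filter fun w => c w = k).Nonempty := by
    rw [← Finset.card_pos]
    by_contra! h0
    have : (E.filter fun w => c w = k).card = 0 := by omega
    rw [this] at hkc
    simp at hkc
    linarith
  obtain ⟨w, hw⟩ := hne
  obtain ⟨hwE, hwk⟩ := Finset.mem_filter.1 hw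
  obtain ⟨hwG, hwb, hwθ⟩ := mem_freqSet.1 hwE
  have hsub : (E.filter fun w => c w = k) ⊆ freqSet N G t w (N w) (1 / 2 ^ t) := by
    intro z hz
    obtain ⟨hzE, hzk⟩ := Finset.mem_filter.1 hz
    obtain ⟨hzG, hzb, hzθ⟩ := mem_freqSet.1 hzE
    refine mem_freqSet.2 ⟨hzG, hzb.trans hwb.symm, ?_⟩
    have h1 := Int.abs_sub_lt_one_of_floor_eq_floor (hzk.trans hwk.symm)
    rw [← sub_mul, abs_mul, abs_of_pos h2t] at h1
    rw [le_div_iff₀ h2t]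
    refine le_trans (le_of_eq ?_) h1.le
    congr 2; ring
  have hdense : (2 : ℝ) ^ t ≤ 2 ^ (d + 2) * (freqSet N G t w (N w) (1 / 2 ^ t)).card := by
    refine hkc.le.trans ?_
    gcongr
  refine ⟨w, hwG, t, ht, hwb, hdense, fun v hv hvw => ?_⟩
  rcases le_total s (d + 2) with hs | hs
  · rw [Nat.sub_eq_zero_of_le hs, pow_zero, div_one]
    have := hN x
    rw [Set.mem_Icc] at hv this
    rw [abs_le]
    constructor <;> linarith
  · have hst : (2 : ℝ) ^ s ≤ 2 ^ t := pow_le_pow_right₀ (by norm_num) ht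
    have h1 : |v - N x| ≤ |v - N w| + |N w - θ| + |θ - N x| := by
      have := abs_sub_le v (N w) (N x)
      have := abs_sub_le (N w) θ (N x)
      linarith
    calc |v - N x| ≤ 2 / 2 ^ t + r / 2 ^ t + r / 2 ^ s := by linarith
      _ ≤ 2 / 2 ^ s + r / 2 ^ s + r / 2 ^ s := by gcongr
      _ = (2 + 2 * r) / 2 ^ s := by ring
      _ ≤ 2 ^ (d + 2) / 2 ^ s := by
          have : 2 + 2 * r ≤ 2 ^ (d + 2) := by rw [pow_add]; linarith
          gcongr
      _ = _ := by
          rw [div_eq_div_iff (by positivity) (by positivity), ← pow_add, one_mul]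
          congr 1; omega

/-- The counting function of the blocks in a family of tiles. -/
def cnt (M : Finset (ℤ × ℕ)) (x : ℤ) : ℕ := (M.filter fun m => blk m.2 x = blk m.2 m.1).card

lemma sum_cnt_le (M : Finset (ℤ × ℕ)) (Y : Finset ℤ) : ∑ y ∈ Y, cnt M y ≤ ∑ m ∈ M, 2 ^ m.2 := by
  simp only [cnt, Finset.card_filter]
  rw [Finset.sum_comm]
  refine Finset.sum_le_sum fun m _ => ?_
  rw [← Finset.card_filter, ← card_blkSet m.2 m.1]
  exact Finset.card_le_card fun y hy => mem_blkSet.2 (Finset.mem_filter.1 hy).2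

/-- Maximal dense tiles. -/
lemma exists_tiles (hN : ∀ x, N x ∈ Set.Icc (0 : ℝ) 1) (G : Finset ℤ) (d : ℕ) :
    ∃ M : Finset (ℤ × ℕ), ∑ m ∈ M, 2 ^ m.2 ≤ 2 ^ (d + 2) * G.card ∧
      ∀ x s, ¬ Low N G (1 / 2 ^ d) x s →
        ∃ m ∈ M, s ≤ m.2 ∧ blk m.2 x = blk m.2 m.1 ∧ |N m.1 - N x| ≤ 1 / 2 ^ (s - (d + 2)) := by
  classical
  set E : ℤ × ℕ → Finset ℤ := fun m => freqSet N G m.2 m.1 (N m.1) (1 / 2 ^ m.2) with hE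
  set P : Finset (ℤ × ℕ) := (G ×ˢ Finset.range (d + 2 + G.card)).filter fun m =>
    2 ^ m.2 ≤ 2 ^ (d + 2) * (E m).card with hP
  have hEne : ∀ m ∈ P, (E m ∩ E m).Nonempty := by
    intro m hm
    rw [Finset.inter_self]
    have h1 := (Finset.mem_product.1 (Finset.mem_filter.1 hm).1).1
    exact ⟨m.1, mem_freqSet.2 ⟨h1, rfl, by simp⟩⟩
  obtain ⟨M, hMP, hdisj, hmax⟩ := exists_greedy P (fun m m' => (E m ∩ E m').Nonempty) hEne
    (fun m m' h => by rwa [Finset.inter_comm]) (fun m => m.2)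
  refine ⟨M, ?_, fun x s hs => ?_⟩
  · have h1 : ∑ m ∈ M, (E m).card ≤ G.card := by
      rw [← Finset.card_biUnion]
      · exact Finset.card_le_card (Finset.biUnion_subset.2 fun m _ z hz => (mem_freqSet.1 hz).1)
      · intro m hm m' hm' hne
        rw [Function.onFun, Finset.disjoint_iff_inter_eq_empty, ← Finset.not_nonempty_iff_eq_empty]
        exact hdisj m hm m' hm' hne
    calc ∑ m ∈ M, 2 ^ m.2 ≤ ∑ m ∈ M, 2 ^ (d + 2) * (E m).card :=
          Finset.sum_le_sum fun m hm => (Finset.mem_filter.1 (hMP hm)).2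
      _ = 2 ^ (d + 2) * ∑ m ∈ M, (E m).card := (Finset.mul_sum _ _ _).symm
      _ ≤ _ := Nat.mul_le_mul_left _ h1
  · obtain ⟨w, hw, t, hst, hwx, hdense, hv⟩ := exists_dense_of_not_low hN hs
    have hdense' : 2 ^ t ≤ 2 ^ (d + 2) * (E (w, t)).card := by
      simp only [hE]; exact Nat.cast_le (α := ℝ).1 (by push_cast; exact hdense)
    have ht : t < d + 2 + G.card := by
      have h1 : (E (w, t)).card ≤ G.card := Finset.card_le_card fun z hz => (mem_freqSet.1 hz).1
      have h2 : G.card < 2 ^ G.card := Nat.lt_two_pow_self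
      have h3 : 2 ^ t < 2 ^ (d + 2 + G.card) := by
        rw [pow_add 2 (d + 2)]
        calc 2 ^ t ≤ 2 ^ (d + 2) * G.card := hdense'.trans (Nat.mul_le_mul_left _ h1)
          _ < _ := Nat.mul_lt_mul_of_pos_left h2 (by positivity)
      exact (Nat.pow_lt_pow_iff_right (by norm_num)).1 h3
    have hmem : (w, t) ∈ P := Finset.mem_filter.2
      ⟨Finset.mem_product.2 ⟨hw, Finset.mem_range.2 ht⟩, hdense'⟩
    obtain ⟨m, hm, ⟨z, hz⟩, htm⟩ := hmax _ hmem
    obtain ⟨hz1, hz2⟩ := Finset.mem_inter.1 hz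
    obtain ⟨-, hzb, hzN⟩ := mem_freqSet.1 hz1
    obtain ⟨-, hzb', hzN'⟩ := mem_freqSet.1 hz2
    simp only at hzb hzN htm
    refine ⟨m, hm, hst.trans htm, ?_, hv _ (hN _) ?_⟩
    · rw [← hzb']
      exact blk_mono htm (hwx.symm.trans hzb.symm)
    · have h1 := abs_sub_le (N m.1) (N z) (N w)
      rw [abs_sub_comm (N m.1) (N z)] at h1
      have h2 : (1 : ℝ) / 2 ^ m.2 ≤ 1 / 2 ^ t := by
        have : (2 : ℝ) ^ t ≤ 2 ^ m.2 := pow_le_pow_right₀ (by norm_num) htm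
        gcongr
      have h3 : (2 : ℝ) / 2 ^ t = 1 / 2 ^ t + 1 / 2 ^ t := by ring
      linarith

/-- Tiles of `M` above `(x, s)`. -/
noncomputable def tilesAt (M : Finset (ℤ × ℕ)) (N : ℤ → ℝ) (x : ℤ) (s : ℕ) : Finset (ℤ × ℕ) := by
  classical exact M.filter fun m => blk m.2 x = blk m.2 m.1 ∧ s ≤ m.2 ∧ |N m.1 - N x| ≤ 1 / 2 ^ s

variable {M : Finset (ℤ × ℕ)}

lemma mem_tilesAt {x : ℤ} {s : ℕ} {m : ℤ × ℕ} : m ∈ tilesAt M N x s ↔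
    m ∈ M ∧ blk m.2 x = blk m.2 m.1 ∧ s ≤ m.2 ∧ |N m.1 - N x| ≤ 1 / 2 ^ s := by
  simp [tilesAt]

lemma tilesAt_subset {x : ℤ} {s s' : ℕ} (h : s ≤ s') : tilesAt M N x s' ⊆ tilesAt M N x s := by
  intro m hm
  obtain ⟨h1, h2, h3, h4⟩ := mem_tilesAt.1 hm
  refine mem_tilesAt.2 ⟨h1, h2, h.trans h3, h4.trans ?_⟩
  have : (2 : ℝ) ^ s ≤ 2 ^ s' := pow_le_pow_right₀ (by norm_num) h
  gcongr

lemma card_tilesAt_le (x : ℤ) (s : ℕ) : (tilesAt M N x s).card ≤ cnt M x :=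
  Finset.card_le_card fun _ hm => Finset.mem_filter.2 ⟨(mem_tilesAt.1 hm).1, (mem_tilesAt.1 hm).2.1⟩

lemma exists_mem_tilesAt_both {Q t₀ : ℕ} {z x x' : ℤ} {s s' : ℕ} (hz : (tilesAt M N z t₀).card < 2 * Q)
    (hx : Q ≤ (tilesAt M N x s).card) (hx' : Q ≤ (tilesAt M N x' s').card)
    (hs : t₀ < s) (hs' : t₀ < s') (hb : blk s z = blk s x) (hb' : blk s' z = blk s' x')
    (hN : |N x - N z| ≤ 1 / 2 / 2 ^ t₀) (hN' : |N x' - N z| ≤ 1 / 2 / 2 ^ t₀) :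
    ∃ m, m ∈ tilesAt M N x s ∧ m ∈ tilesAt M N x' s' := by
  classical
  have hsub : ∀ x s, t₀ < s → blk s z = blk s x → |N x - N z| ≤ 1 / 2 / 2 ^ t₀ →
      tilesAt M N x s ⊆ tilesAt M N z t₀ := by
    intro x s hs hb hN m hm
    obtain ⟨h1, h2, h3, h4⟩ := mem_tilesAt.1 hm
    refine mem_tilesAt.2 ⟨h1, (blk_mono h3 hb).trans h2, by omega, ?_⟩
    have h5 := abs_sub_le (N m.1) (N x) (N z)
    have h6 : (1 : ℝ) / 2 ^ s ≤ 1 / 2 / 2 ^ t₀ := by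
      rw [div_div, ← pow_succ']
      have : (2 : ℝ) ^ (t₀ + 1) ≤ 2 ^ s := pow_le_pow_right₀ (by norm_num) hs
      gcongr
    have h7 : (1 : ℝ) / 2 ^ t₀ = 1 / 2 / 2 ^ t₀ + 1 / 2 / 2 ^ t₀ := by ring
    linarith
  by_contra! hcon
  have hd : Disjoint (tilesAt M N x s) (tilesAt M N x' s') := Finset.disjoint_left.2 hcon
  have h1 := Finset.card_le_card
    (Finset.union_subset (hsub x s hs hb hN) (hsub x' s' hs' hb' hN'))
  rw [Finset.card_union_of_disjoint hd] at h1
  omega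

lemma abs_sub_le_of_mem_tilesAt {x x' : ℤ} {s s' : ℕ} {m : ℤ × ℕ} (h : m ∈ tilesAt M N x s)
    (h' : m ∈ tilesAt M N x' s') : |N x - N x'| ≤ 4 / 2 ^ min s s' := by
  have h1 := (mem_tilesAt.1 h).2.2.2
  have h2 := (mem_tilesAt.1 h').2.2.2
  have h3 := abs_sub_le (N x) (N m.1) (N x')
  rw [abs_sub_comm (N x) (N m.1)] at h3
  have h4 : (1 : ℝ) / 2 ^ s ≤ 1 / 2 ^ min s s' := by
    have : (2 : ℝ) ^ min s s' ≤ 2 ^ s := pow_le_pow_right₀ (by norm_num) (min_le_left _ _)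
    gcongr
  have h5 : (1 : ℝ) / 2 ^ s' ≤ 1 / 2 ^ min s s' := by
    have : (2 : ℝ) ^ min s s' ≤ 2 ^ s' := pow_le_pow_right₀ (by norm_num) (min_le_right _ _)
    gcongr
  have h6 : (0 : ℝ) ≤ 1 / 2 ^ min s s' := by positivity
  have h7 : (4 : ℝ) / 2 ^ min s s' = 4 * (1 / 2 ^ min s s') := by ring
  linarith

/-- Points close to the boundary of their block. -/
lemma card_boundary_le (Y : Finset ℤ) {s l : ℕ} (hl : l ≤ s) (c : ℤ)
    (hY : ∀ x ∈ Y, blk s x = c ∧ ∃ y, |x - y| < 2 ^ (s - l) ∧ blk s y ≠ c) :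
    Y.card * 2 ^ l ≤ 2 * 2 ^ s := by
  classical
  set q : ℤ := 2 ^ (s - l) with hq
  have hsub : Y ⊆ Finset.Ico (c * 2 ^ s) (c * 2 ^ s + q) ∪
      Finset.Ico ((c + 1) * 2 ^ s - q) ((c + 1) * 2 ^ s) := by
    intro x hx
    obtain ⟨h1, y, h2, h3⟩ := hY x hx
    rw [blk_eq_iff] at h1
    rw [Ne, blk_eq_iff] at h3
    rw [abs_lt] at h2
    simp only [Finset.mem_union, Finset.mem_Ico]
    by_cases h4 : c * 2 ^ s ≤ y
    · right
      have : (c + 1) * 2 ^ s ≤ y := by by_contra! h5; exact h3 ⟨h4, h5⟩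
      omega
    · left; omega
  have h1 := (Finset.card_le_card hsub).trans (Finset.card_union_le _ _)
  have e : q = ((2 ^ (s - l) : ℕ) : ℤ) := by rw [hq]; push_cast; rfl
  rw [Int.card_Ico, Int.card_Ico] at h1
  have h2 : Y.card ≤ 2 * 2 ^ (s - l) := by omega
  calc Y.card * 2 ^ l ≤ 2 * 2 ^ (s - l) * 2 ^ l := Nat.mul_le_mul_right _ h2
    _ = 2 * 2 ^ s := by rw [mul_assoc, ← pow_add, Nat.sub_add_cancel hl]

/-- Points at which the number of tiles is constant up to a factor of two along a long range of
scales form a forest. -/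
lemma exists_forest {X : Finset ℤ} {a b : ℤ → ℕ} {l Q K : ℕ} (hQ : 1 ≤ Q)
    (hlong : ∀ x ∈ X, a x + 3 * l + 10 ≤ b x)
    (hlo : ∀ x ∈ X, ∀ s, a x < s → s ≤ b x → Q ≤ (tilesAt M N x s).card)
    (hhi : ∀ x ∈ X, ∀ s, a x < s → s ≤ b x → (tilesAt M N x s).card < 2 * Q)
    (hK : ∀ x ∈ X, cnt M x ≤ K) :
    ∃ (U : Finset ℤ) (u : ℤ → ℤ) (E : Finset ℤ), E ⊆ X ∧
      E.card * 2 ^ l ≤ 2 * ∑ m ∈ M, 2 ^ m.2 ∧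
      IsForest N U (X \ E) u a b l ∧
      ∀ y, (U.filter fun w => blk (b w) y = blk (b w) w).card ≤ K := by
  classical
  set σ : ℤ → ℤ → Prop := fun x x' => blk (max (b x) (b x')) x = blk (max (b x) (b x')) x' ∧
    |N x - N x'| ≤ 4 / 2 ^ min (b x) (b x') with hσ
  obtain ⟨U, hUX, hU, hmax⟩ := exists_greedy X σ (fun x _ => by simp only [hσ, max_self, sub_self, abs_zero, true_and]; positivity)
    (fun x x' h => by
      simp only [hσ] at h ⊢
      rw [max_comm, min_comm, abs_sub_comm]; exact ⟨h.1.symm, h.2⟩) b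
  have hex : ∀ z, ∃ w, z ∈ X → w ∈ U ∧ σ z w ∧ b z ≤ b w := fun z => by
    by_cases hz : z ∈ X
    · obtain ⟨w, h⟩ := hmax z hz; exact ⟨w, fun _ => h⟩
    · exact ⟨0, fun h => absurd h hz⟩
  choose u hu using hex
  have htop : ∀ x ∈ X, Q ≤ (tilesAt M N x (b x)).card := fun x hx =>
    hlo x hx _ (by have := hlong x hx; omega) le_rfl
  -- a tile common to two tops over a common point
  have hcommon : ∀ w ∈ U, ∀ w' ∈ U, ∀ y, blk (b w) y = blk (b w) w → blk (b w') y = blk (b w') w' →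
      ∀ m, m ∈ tilesAt M N w (b w) → m ∈ tilesAt M N w' (b w') → w = w' := by
    intro w hw w' hw' y hy hy' m hm hm'
    by_contra hne
    refine hU w hw w' hw' hne ⟨?_, abs_sub_le_of_mem_tilesAt hm hm'⟩
    exact (blk_mono (le_max_left _ _) hy).symm.trans (blk_mono (le_max_right _ _) hy')
  have hne : ∀ w, ∃ m, w ∈ U → m ∈ tilesAt M N w (b w) := fun w => by
    by_cases hw : w ∈ U
    · have : 0 < (tilesAt M N w (b w)).card := by have := htop w (hUX hw); omega
      obtain ⟨m, hm⟩ := Finset.card_pos.1 this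
      exact ⟨m, fun _ => hm⟩
    · exact ⟨(0, 0), fun h => absurd h hw⟩
  choose m hm using hne
  have hcnt : ∀ y, (U.filter fun w => blk (b w) y = blk (b w) w).card ≤ cnt M y := by
    intro y
    refine Finset.card_le_card_of_injOn m (fun w hw => ?_) fun w hw w' hw' he => ?_
    · obtain ⟨hwU, hwy⟩ := Finset.mem_filter.1 hw
      obtain ⟨h1, h2, h3, -⟩ := mem_tilesAt.1 (hm w hwU)
      exact Finset.mem_coe.2 (Finset.mem_filter.2 ⟨h1, (blk_mono h3 hwy).trans h2⟩)
    · obtain ⟨hwU, hwy⟩ := Finset.mem_filter.1 hw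
      obtain ⟨hwU', hwy'⟩ := Finset.mem_filter.1 hw'
      exact hcommon w hwU w' hwU' y hwy hwy' (m w) (hm w hwU) (he ▸ hm w' hwU')
  set E := X.filter fun x => ∃ y, |x - y| < 2 ^ (b (u x) - l) ∧ blk (b (u x)) y ≠ blk (b (u x)) x
    with hE
  have hsum : ∑ w ∈ U, 2 ^ b w ≤ ∑ m ∈ M, 2 ^ m.2 := by
    refine le_trans ?_ (sum_cnt_le M (U.biUnion fun w => blkSet (b w) w))
    refine le_trans ?_ (Finset.sum_le_sum fun y _ => hcnt y)
    simp only [Finset.card_filter]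
    rw [Finset.sum_comm]
    refine Finset.sum_le_sum fun w hw => ?_
    rw [← Finset.card_filter, ← card_blkSet (b w) w]
    exact Finset.card_le_card fun y hy => Finset.mem_filter.2
      ⟨Finset.mem_biUnion.2 ⟨w, hw, hy⟩, mem_blkSet.1 hy⟩
  have hblk : ∀ z ∈ X, blk (b (u z)) z = blk (b (u z)) (u z) := fun z hz => by
    have h1 := (hu z hz).2.1.1
    rwa [max_eq_right (hu z hz).2.2] at h1
  have hfreq : ∀ z ∈ X, |N (u z) - N z| ≤ 4 / 2 ^ b z := fun z hz => by
    have h1 := (hu z hz).2.1.2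
    rwa [min_eq_left (hu z hz).2.2, abs_sub_comm] at h1
  refine ⟨U, u, E, Finset.filter_subset _ _, ?_, ?_, fun y => ?_⟩
  · have hfib : E.card = ∑ w ∈ U, (E.filter fun x => u x = w).card :=
      Finset.card_eq_sum_card_fiberwise fun x hx =>
        (hu x (Finset.mem_filter.1 (Finset.mem_coe.1 hx)).1).1
    rw [hfib, Finset.sum_mul]
    refine le_trans ?_ (Nat.mul_le_mul_left 2 hsum)
    rw [Finset.mul_sum]
    refine Finset.sum_le_sum fun w hw => card_boundary_le _ ?_ (blk (b w) w) fun x hx => ?_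
    · have := hlong w (hUX hw); omega
    · obtain ⟨hxE, rfl⟩ := Finset.mem_filter.1 hx
      obtain ⟨hxX, y, h1, h2⟩ := Finset.mem_filter.1 hxE
      rw [← hblk x hxX]
      exact ⟨rfl, y, h1, h2⟩
  · refine ⟨fun z hz => ?_, fun z hz => ?_, fun z hz => ?_, fun z hz => ?_, fun z hz => ?_,
      fun z hz u' hu' hne hb ha => ?_, fun z hz y hy => ?_⟩
    all_goals obtain ⟨hzX, hzE⟩ := Finset.mem_sdiff.1 hz
    · exact (hu z hzX).1
    · exact (hu z hzX).2.2
    · exact hblk z hzX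
    · exact hfreq z hzX
    · exact hlong z hzX
    · by_contra! hlt
      have huz := hu z hzX
      have hl := hlong z hzX
      have hf : |N (u z) - N z| ≤ 1 / 4 / 2 ^ (a z + 1) := by
        refine (hfreq z hzX).trans ?_
        rw [div_div, div_le_div_iff₀ (by positivity) (by positivity), one_mul, ← mul_assoc]
        have : (2 : ℝ) ^ (a z + 5) ≤ 2 ^ b z := pow_le_pow_right₀ (by norm_num) (by omega)
        refine le_trans (le_of_eq ?_) this
        rw [pow_add, pow_add]; ring
      have e : (1 : ℝ) / 2 / 2 ^ (a z + 1) = 1 / 4 / 2 ^ (a z + 1) + 1 / 4 / 2 ^ (a z + 1) := by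
        ring
      have h0 : (0 : ℝ) ≤ 1 / 4 / 2 ^ (a z + 1) := by positivity
      obtain ⟨m, h1, h2⟩ := exists_mem_tilesAt_both (hhi z hzX (a z + 1) (by omega) (by omega))
        (htop _ (hUX huz.1)) (htop _ (hUX hu')) (by omega) ha (hblk z hzX) hb (by linarith) (by
          have h3 := abs_sub_le (N u') (N (u z)) (N z)
          rw [abs_sub_comm (N u') (N (u z))] at h3
          linarith)
      exact hne (hcommon _ huz.1 _ hu' z (hblk z hzX) hb m h1 h2).symm
    · by_contra hcon
      exact hzE (Finset.mem_filter.2 ⟨hzX, y, hy, hcon⟩)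
  · rcases (U.filter fun w => blk (b w) y = blk (b w) w).eq_empty_or_nonempty with h0 | h0
    · rw [h0]; simp
    · obtain ⟨w₀, hw₀, hmin⟩ := Finset.exists_min_image _ b h0
      obtain ⟨hw₀U, hw₀y⟩ := Finset.mem_filter.1 hw₀
      refine (Finset.card_le_card fun w hw => ?_).trans ((hcnt w₀).trans (hK _ (hUX hw₀U)))
      obtain ⟨hwU, hwy⟩ := Finset.mem_filter.1 hw
      exact Finset.mem_filter.2 ⟨hwU, (blk_mono (hmin w hw) hw₀y).symm.trans hwy⟩
end

/-! ### Classes of scales of comparable density -/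

open Classical in
/-- The last scale at which the density near `x` exceeds `1 / 16 ^ n`. -/
noncomputable def lev (N : ℤ → ℝ) (G : Finset ℤ) (S n : ℕ) (x : ℤ) : ℕ :=
  Nat.findGreatest (fun s => ¬ Low N G (1 / 16 ^ n) x s) S

open Classical in
/-- The last scale at which there are at least `Q` tiles above `x`. -/
noncomputable def tileLev (M : Finset (ℤ × ℕ)) (N : ℤ → ℝ) (S Q : ℕ) (x : ℤ) : ℕ :=
  Nat.findGreatest (fun s => Q ≤ (tilesAt M N x s).card) S

section
variable {N : ℤ → ℝ} {G : Finset ℤ} {S n : ℕ} {M : Finset (ℤ × ℕ)}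

open Classical in
lemma lev_le (x : ℤ) : lev N G S n x ≤ S := Nat.findGreatest_le _

open Classical in
lemma low_of_lev_lt {x : ℤ} {s : ℕ} (h : lev N G S n x < s) (hs : s ≤ S) :
    Low N G (1 / 16 ^ n) x s := by
  by_contra hcon
  exact Nat.findGreatest_is_greatest (P := fun s => ¬ Low N G (1 / 16 ^ n) x s) h hs hcon

open Classical in
lemma not_low_of_le_lev {x : ℤ} {s : ℕ} (h : s ≤ lev N G S n x) (hs : 1 ≤ s) :
    ¬ Low N G (1 / 16 ^ n) x s := fun hl =>
  Nat.findGreatest_of_ne_zero (P := fun s => ¬ Low N G (1 / 16 ^ n) x s) rfl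
    (by have := hs.trans h; unfold lev at this; omega) (hl.mono h)

open Classical in
lemma lev_mono (x : ℤ) : lev N G S n x ≤ lev N G S (n + 1) x := by
  refine Nat.findGreatest_mono_left (fun s hs hl => hs (hl.mono_left ?_)) _
  gcongr
  · norm_num
  · exact Nat.le_succ n

lemma lev_zero (x : ℤ) : lev N G S 0 x = 0 := by
  by_contra h
  refine not_low_of_le_lev le_rfl (Nat.one_le_iff_ne_zero.2 h) ?_
  intro t _ θ r hr _
  have h1 : freqSet N G t x θ (r / 2 ^ t) ⊆ blkSet t x := fun z hz =>
    mem_blkSet.2 (mem_freqSet.1 hz).2.1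
  have h2 := Finset.card_le_card h1
  rw [card_blkSet] at h2
  have h3 : ((freqSet N G t x θ (r / 2 ^ t)).card : ℝ) ≤ 2 ^ t := by exact_mod_cast h2
  have h4 : (0 : ℝ) < 2 ^ t := by positivity
  rw [pow_zero, div_one, one_mul]
  nlinarith

open Classical in
lemma lev_eq {x : ℤ} (hx : x ∈ G) : lev N G S S x = S := by
  rcases Nat.eq_zero_or_pos S with rfl | hS
  · exact Nat.le_zero.1 (lev_le x)
  refine le_antisymm (lev_le x) (Nat.le_findGreatest le_rfl fun hl => ?_)
  have h1 := hl S le_rfl (N x) 1 le_rfl (by simp)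
  have h2 : 1 ≤ (freqSet N G S x (N x) (1 / 2 ^ S)).card :=
    Finset.card_pos.2 ⟨x, mem_freqSet.2 ⟨hx, rfl, by simp⟩⟩
  have h3 : (1 : ℝ) ≤ (freqSet N G S x (N x) (1 / 2 ^ S)).card := by exact_mod_cast h2
  have h4 : (2 : ℝ) ^ S < 16 ^ S := pow_lt_pow_left₀ (by norm_num) (by norm_num) hS.ne'
  rw [mul_one, one_div_mul_eq_div, le_div_iff₀ (by positivity)] at h1
  have h5 : (0 : ℝ) < 16 ^ S := by positivity
  nlinarith

lemma le_card_of_le_tileLev {Q s : ℕ} {x : ℤ} (h : s ≤ tileLev M N S Q x) (hs : 1 ≤ s) :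
    Q ≤ (tilesAt M N x s).card :=
  (Nat.findGreatest_of_ne_zero (P := fun s => Q ≤ (tilesAt M N x s).card) rfl
    (by have := hs.trans h; unfold tileLev at this; omega)).trans
    (Finset.card_le_card (tilesAt_subset h))

lemma card_lt_of_tileLev_lt {Q s : ℕ} {x : ℤ} (h : tileLev M N S Q x < s) (hs : s ≤ S) :
    (tilesAt M N x s).card < Q :=
  not_le.1 (Nat.findGreatest_is_greatest (P := fun s => Q ≤ (tilesAt M N x s).card) h hs)

lemma IsForest.mono {U Z Z' : Finset ℤ} {u : ℤ → ℤ} {a b : ℤ → ℕ} {l : ℕ}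
    (h : IsForest N U Z u a b l) (hZ : Z' ⊆ Z) : IsForest N U Z' u a b l :=
  ⟨fun z hz => h.mem z (hZ hz), fun z hz => h.le z (hZ hz), fun z hz => h.blk_eq z (hZ hz),
    fun z hz => h.freq z (hZ hz), fun z hz => h.long z (hZ hz), fun z hz => h.sep z (hZ hz),
    fun z hz => h.inner z (hZ hz)⟩

lemma sum_vop_chain (N : ℤ → ℝ) (A : Finset ℤ) (h : ℤ → ℂ) (e : ℕ → ℤ → ℕ) (J : ℕ) (y : ℤ) :
    ∑ j ∈ Finset.range J, vop N A h (e (j + 1)) (e j) y = vop N A h (e J) (e 0) y := by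
  induction J with
  | zero => simp [vop, kerN]
  | succ J ih => rw [Finset.sum_range_succ, ih, add_comm, ← vop_add]

lemma sum_norm_add_le {F : Finset ℤ} {f g : ℤ → ℂ} {p q : ℝ} (hf : ∑ y ∈ F, ‖f y‖ ≤ p)
    (hg : ∑ y ∈ F, ‖g y‖ ≤ q) : ∑ y ∈ F, ‖f y + g y‖ ≤ p + q := by
  refine (Finset.sum_le_sum fun y _ => norm_add_le (f y) (g y)).trans ?_
  rw [Finset.sum_add_distrib]
  exact add_le_add hf hg

lemma sixteen_pow_mul_le {n J : ℕ} {T g g₁ : ℝ} {f : ℕ → ℝ} (hJ : J ≤ 12 * n + 13) (hg : 0 ≤ g)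
    (hT : T ≤ 2 ^ (4 * n + 4 + 2) * g) (h1 : g₁ * 2 ^ (12 * n + 12) ≤ T)
    (hf : ∀ j ∈ Finset.range J, f j * 2 ^ (16 * n + 36) ≤ 2 * T) :
    16 ^ (n + 1) * (g₁ + ∑ j ∈ Finset.range J, f j) ≤ g := by
  obtain ⟨D, hD⟩ : ∃ D : ℝ, D = 16 ^ (n + 1) := ⟨_, rfl⟩
  have e1 : (2 : ℝ) ^ (4 * n + 4 + 2) = 4 * D := by
    rw [hD, pow_add, show 4 * n + 4 = 4 * (n + 1) by ring, pow_mul]; norm_num; ring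
  have e2 : (2 : ℝ) ^ (12 * n + 12) = D ^ 3 := by
    rw [hD, show 12 * n + 12 = 4 * (n + 1) * 3 by ring, pow_mul, pow_mul]; norm_num
  have e3 : (2 : ℝ) ^ (16 * n + 36) = D ^ 4 * 2 ^ 20 := by
    rw [hD, show 16 * n + 36 = 4 * (n + 1) * 4 + 20 by ring, pow_add, pow_mul, pow_mul]; norm_num
  have hD16 : 16 ≤ D := by
    rw [hD, pow_succ]; nlinarith [one_le_pow₀ (n := n) (by norm_num : (1 : ℝ) ≤ 16)]
  have hJD : (J : ℝ) ≤ 13 * D := by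
    have h2 : (n : ℝ) + 1 ≤ D := by
      rw [hD]; exact_mod_cast (Nat.lt_pow_self (by norm_num : 1 < 16)).le
    have h3 : (J : ℝ) ≤ 12 * n + 13 := by exact_mod_cast hJ
    have h4 : (0 : ℝ) ≤ n := n.cast_nonneg
    linarith
  rw [e1] at hT
  rw [e2] at h1
  have hD0 : 0 < D := by linarith
  have h1' : D * g₁ ≤ g / 4 := by
    have h2 : D ^ 2 * (D * g₁) ≤ D ^ 2 * (g / 4) := by
      have : 4 * D * g ≤ D ^ 2 * (g / 4) := by nlinarith [mul_nonneg hD0.le hg]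
      nlinarith
    exact le_of_mul_le_mul_left h2 (by positivity)
  have hf' : ∀ j ∈ Finset.range J, f j ≤ g / (26 * D ^ 2) := by
    intro j hj
    have h2 := hf j hj
    rw [e3] at h2
    rw [le_div_iff₀ (by positivity)]
    have h3 : D ^ 2 * 2 ^ 15 * (f j * (26 * D ^ 2)) ≤ D ^ 2 * 2 ^ 15 * g := by
      have h4 : 26 * (8 * D * g) ≤ D ^ 2 * 2 ^ 20 * g := by
        nlinarith [mul_nonneg hD0.le hg]
      nlinarith
    exact le_of_mul_le_mul_left h3 (by positivity)
  have h5 := Finset.sum_le_card_nsmul _ _ _ hf'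
  rw [Finset.card_range, nsmul_eq_mul] at h5
  have h6 : (J : ℝ) * (g / (26 * D ^ 2)) ≤ 13 * D * (g / (26 * D ^ 2)) := by gcongr
  have h7 : D * (13 * D * (g / (26 * D ^ 2))) = g / 2 := by field_simp; ring
  rw [← hD, mul_add]
  nlinarith

/-- The scales of density between `1 / 16 ^ (n + 1)` and `1 / 16 ^ n` are, away from a small set,
the union of a few forests and of short ranges of scales. -/
lemma exists_class (hN : ∀ x, N x ∈ Set.Icc (0 : ℝ) 1) (G : Finset ℤ) (S n : ℕ) :
    ∃ E ⊆ G, (16 : ℝ) ^ (n + 1) * E.card ≤ G.card ∧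
      ∀ h : ℤ → ℂ, (∀ x ∈ E, h x = 0) → ∀ (F : Finset ℤ) (ω : ℝ), 0 ≤ ω →
      (∀ A ⊆ G.filter fun x => h x ≠ 0, ∀ (a b : ℤ → ℕ) (L : ℕ), (∀ x ∈ A, a x ≤ b x) →
        (∀ x ∈ A, b x ≤ a x + L) → (∀ x ∈ A, a x < b x → Low N G (1 / 16 ^ n) x (a x + 1)) →
        (∀ x ∈ A, b x ≤ S) → ∑ y ∈ F, ‖vop N A h a b y‖ ≤ L * ω) →
      (∀ Z ⊆ G.filter fun x => h x ≠ 0, ∀ (U : Finset ℤ) (u : ℤ → ℤ) (a b : ℤ → ℕ),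
        IsForest N U Z u a b (16 * n + 36) → (∀ z ∈ Z, Low N G (1 / 16 ^ n) z (a z + 1)) →
        (∀ z ∈ Z, b z ≤ S) →
        (∀ y, (U.filter fun w => blk (b w) y = blk (b w) w).card ≤ 2 ^ (12 * n + 12)) →
        ∑ y ∈ F, ‖vop N Z h (fun z => a z + (16 * n + 36))
          (fun z => b z - (16 * n + 36 + 2)) y‖ ≤ ω) →
      ∑ y ∈ F, ‖vop N G h (lev N G S n) (lev N G S (n + 1)) y‖ ≤ 10000 * (n + 1) ^ 2 * ω := by
  classical
  obtain ⟨M, hMsum, hM⟩ := exists_tiles hN G (4 * n + 4)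
  obtain ⟨l, hl⟩ : ∃ l, l = 16 * n + 36 := ⟨_, rfl⟩
  obtain ⟨K, hK⟩ : ∃ K, K = 2 ^ (12 * n + 12) := ⟨_, rfl⟩
  obtain ⟨J, hJ⟩ : ∃ J, J = 12 * n + 13 := ⟨_, rfl⟩
  simp only [← hl, ← hK]
  set e : ℕ → ℤ → ℕ := fun j x =>
    max (lev N G S n x) (min (lev N G S (n + 1) x) (tileLev M N S (2 ^ j) x)) with he
  have he1 : ∀ j x, lev N G S n x ≤ e j x := fun j x => le_max_left _ _
  have he2 : ∀ j x, e j x ≤ lev N G S (n + 1) x := fun j x =>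
    max_le (lev_mono x) (min_le_left _ _)
  have heS : ∀ j x, e j x ≤ S := fun j x => (he2 j x).trans (lev_le x)
  have hpow : (1 : ℝ) / 16 ^ (n + 1) = 1 / 2 ^ (4 * n + 4) := by
    rw [show 4 * n + 4 = 4 * (n + 1) by ring, pow_mul]; norm_num
  have heanti : ∀ j x, e (j + 1) x ≤ e j x := by
    intro j x
    refine max_le_max le_rfl (min_le_min le_rfl ?_)
    exact Nat.findGreatest_mono_left
      (fun s hs => le_trans (Nat.pow_le_pow_right (by norm_num) (Nat.le_succ j)) hs) _
  have helow : ∀ j x s, e j x < s → s ≤ S → Low N G (1 / 16 ^ n) x s := fun j x s h1 h2 =>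
    low_of_lev_lt ((he1 j x).trans_lt h1) h2
  have hlo : ∀ j x s, lev N G S n x < s → s ≤ e j x → 2 ^ j ≤ (tilesAt M N x s).card := by
    intro j x s h1 h2
    refine le_card_of_le_tileLev (S := S) ?_ (by omega)
    simp only [he] at h2
    omega
  have hhi : ∀ j x s, e j x < s → s ≤ lev N G S (n + 1) x → (tilesAt M N x s).card < 2 ^ j := by
    intro j x s h1 h2
    refine card_lt_of_tileLev_lt (S := S) ?_ (h2.trans (lev_le x))
    simp only [he] at h1
    omega
  have hlast : ∀ x, lev N G S (n + 1) x ≤ e 0 x + (4 * n + 6) := by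
    intro x
    by_contra! hcon
    set s := lev N G S (n + 1) x with hs
    obtain ⟨m, hm, h1, h2, h3⟩ := hM x s
      (by rw [← hpow]; exact not_low_of_le_lev le_rfl (by omega))
    have h4 := hhi 0 x (s - (4 * n + 4 + 2)) (by omega) (by omega)
    rw [pow_zero, Nat.lt_one_iff, Finset.card_eq_zero] at h4
    have h5 : m ∈ tilesAt M N x (s - (4 * n + 4 + 2)) := mem_tilesAt.2 ⟨hm, h2, by omega, h3⟩
    rw [h4] at h5
    simp at h5
  set G₁ := G.filter fun x => K < cnt M x with hG₁
  set X : ℕ → Finset ℤ := fun j =>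
    (G \ G₁).filter fun x => e (j + 1) x + 3 * l + 10 ≤ e j x with hX
  have hcntX : ∀ x ∈ G, x ∉ G₁ → cnt M x ≤ K := fun x hx hx1 => by
    by_contra! hc; exact hx1 (Finset.mem_filter.2 ⟨hx, hc⟩)
  have hforest := fun j => exists_forest (N := N) (M := M) (X := X j) (a := e (j + 1)) (b := e j)
    (l := l) (Q := 2 ^ j) (K := K) Nat.one_le_two_pow
    (fun x hx => (Finset.mem_filter.1 hx).2)
    (fun x hx s h1 h2 => hlo j x s ((he1 _ _).trans_lt h1) h2)
    (fun x hx s h1 h2 => by rw [← pow_succ']; exact hhi (j + 1) x s h1 (h2.trans (he2 _ _)))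
    (fun x hx => by
      have := Finset.mem_sdiff.1 (Finset.mem_filter.1 hx).1
      exact hcntX x this.1 this.2)
  choose U u E₀ hE₀X hE₀card hfor hcount using hforest
  refine ⟨G₁ ∪ (Finset.range J).biUnion E₀, ?_, ?_, fun h hh F ω hω hfew hfo => ?_⟩
  · refine Finset.union_subset (Finset.filter_subset _ _) (Finset.biUnion_subset.2 fun j _ => ?_)
    exact (hE₀X j).trans ((Finset.filter_subset _ _).trans Finset.sdiff_subset)
  · have hT := hMsum
    have hG₁s : (G₁.card : ℝ) * 2 ^ (12 * n + 12) ≤ ∑ m ∈ M, (2 : ℝ) ^ m.2 := by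
      have h1 : G₁.card * K ≤ ∑ x ∈ G₁, cnt M x := by
        rw [← smul_eq_mul]
        exact Finset.card_nsmul_le_sum _ _ _ fun x hx => (Finset.mem_filter.1 hx).2.le
      have h2 := h1.trans (sum_cnt_le M G₁)
      rw [hK] at h2
      exact_mod_cast h2
    have hE₀s : ∀ j, ((E₀ j).card : ℝ) * 2 ^ (16 * n + 36) ≤ 2 * ∑ m ∈ M, (2 : ℝ) ^ m.2 := by
      intro j
      have h2 := hE₀card j
      rw [hl] at h2
      exact_mod_cast h2
    have hsum : (((G₁ ∪ (Finset.range J).biUnion E₀).card : ℕ) : ℝ) ≤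
        G₁.card + ∑ j ∈ Finset.range J, ((E₀ j).card : ℝ) := by
      exact_mod_cast (Finset.card_union_le _ _).trans
        (Nat.add_le_add_left Finset.card_biUnion_le _)
    have hT' : ∑ m ∈ M, (2 : ℝ) ^ m.2 ≤ 2 ^ (4 * n + 4 + 2) * G.card := by exact_mod_cast hT
    exact (mul_le_mul_of_nonneg_left hsum (by positivity)).trans
      (sixteen_pow_mul_le hJ.le (by positivity) hT' hG₁s fun j _ => hE₀s j)
  set A := G.filter fun x => h x ≠ 0 with hA
  have hAG : ∀ x ∈ A, x ∈ G := fun x hx => (Finset.mem_filter.1 hx).1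
  have hAE : ∀ x ∈ A, x ∉ G₁ ∧ ∀ j < J, x ∉ E₀ j := by
    intro x hx
    have h1 := (Finset.mem_filter.1 hx).2
    refine ⟨fun h2 => h1 (hh x (Finset.mem_union_left _ h2)), fun j hj h2 => h1 (hh x ?_)⟩
    exact Finset.mem_union_right _ (Finset.mem_biUnion.2 ⟨j, Finset.mem_range.2 hj, h2⟩)
  have heJ : ∀ x ∈ A, e J x = lev N G S n x := by
    intro x hx
    by_contra hne
    have h1 := hlo J x (e J x) (lt_of_le_of_ne (he1 J x) (Ne.symm hne)) le_rfl
    have h2 := (card_tilesAt_le (N := N) (M := M) x (e J x)).trans (hcntX x (hAG x hx) (hAE x hx).1)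
    have h3 : K < 2 ^ J := hK ▸ Nat.pow_lt_pow_right (by norm_num) (by omega)
    omega
  have hsplit : ∀ y, vop N G h (lev N G S n) (lev N G S (n + 1)) y =
      ∑ j ∈ Finset.range J, vop N A h (e (j + 1)) (e j) y + vop N A h (e 0) (lev N G S (n + 1)) y := by
    intro y
    rw [vop_filter N G (fun x => h x ≠ 0) h _ _ (fun x _ hx => Or.inl (not_not.1 hx)),
      sum_vop_chain, ← hA, ← vop_add]
    exact vop_congr (fun _ _ => rfl) (fun x hx => (heJ x hx).symm) fun _ _ => rfl
  have hpiece : ∀ j < J, ∑ y ∈ F, ‖vop N A h (e (j + 1)) (e j) y‖ ≤ (5 * l + 13 : ℕ) * ω := by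
    intro j hj
    set A₁ := A.filter fun x => e (j + 1) x + 3 * l + 10 ≤ e j x with hA₁
    set A₂ := A.filter fun x => ¬ (e (j + 1) x + 3 * l + 10 ≤ e j x) with hA₂
    have hA₁l : ∀ x ∈ A₁, e (j + 1) x + 3 * l + 10 ≤ e j x := fun x hx => (Finset.mem_filter.1 hx).2
    have hA₁A : A₁ ⊆ A := Finset.filter_subset _ _
    have hZ : A₁ ⊆ X j \ E₀ j := by
      intro x hx
      have hxA := hA₁A hx
      exact Finset.mem_sdiff.2 ⟨Finset.mem_filter.2 ⟨Finset.mem_sdiff.2 ⟨hAG x hxA, (hAE x hxA).1⟩,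
        hA₁l x hx⟩, (hAE x hxA).2 j hj⟩
    have q1 := hfew A₂ (Finset.filter_subset _ _) (e (j + 1)) (e j) (3 * l + 10)
      (fun x _ => heanti j x) (fun x hx => by have := (Finset.mem_filter.1 hx).2; omega)
      (fun x _ h1 => helow (j + 1) x _ (Nat.lt_succ_self _) (h1.trans_le (heS j x)))
      (fun x _ => heS j x)
    have q2 := hfew A₁ hA₁A (e (j + 1)) (fun x => e (j + 1) x + l) l
      (fun x _ => Nat.le_add_right _ _) (fun x _ => le_rfl)
      (fun x hx h1 => helow (j + 1) x _ (Nat.lt_succ_self _) (by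
        have := hA₁l x hx; have := heS j x; omega))
      (fun x hx => by have := hA₁l x hx; have := heS j x; omega)
    have q3 := hfo A₁ hA₁A (U j) (u j) (e (j + 1)) (e j) ((hfor j).mono hZ)
      (fun x hx => helow (j + 1) x _ (Nat.lt_succ_self _) (by
        have := hA₁l x hx; have := heS j x; omega))
      (fun x _ => heS j x) (hcount j)
    have q4 := hfew A₁ hA₁A (fun x => e j x - (l + 2)) (e j) (l + 2)
      (fun x _ => Nat.sub_le _ _) (fun x hx => by omega)
      (fun x hx h1 => helow (j + 1) x _ (by have := hA₁l x hx; omega) (by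
        have := hA₁l x hx; have := heS j x; omega))
      (fun x _ => heS j x)
    have hsum : ∀ y, vop N A h (e (j + 1)) (e j) y = vop N A₂ h (e (j + 1)) (e j) y +
        (vop N A₁ h (e (j + 1)) (fun x => e (j + 1) x + l) y +
        (vop N A₁ h (fun x => e (j + 1) x + l) (fun x => e j x - (l + 2)) y +
          vop N A₁ h (fun x => e j x - (l + 2)) (e j) y)) := by
      intro y
      rw [← vop_add, ← vop_add, add_comm (vop N A₂ h _ _ y)]
      exact (Finset.sum_filter_add_sum_filter_not A
        (fun x => e (j + 1) x + 3 * l + 10 ≤ e j x) _).symm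
    simp only [hsum]
    refine (sum_norm_add_le q1 (sum_norm_add_le q2 (sum_norm_add_le q3 q4))).trans (le_of_eq ?_)
    push_cast
    ring
  have hfinal := hfew A (Finset.Subset.refl _) (e 0) (lev N G S (n + 1)) (4 * n + 6)
    (fun x _ => he2 0 x) (fun x _ => hlast x)
    (fun x _ h1 => helow 0 x _ (Nat.lt_succ_self _) (h1.trans_le (lev_le x))) (fun x _ => lev_le x)
  simp only [hsplit]
  have hJs : ∑ y ∈ F, ‖∑ j ∈ Finset.range J, vop N A h (e (j + 1)) (e j) y‖ ≤
      J * ((5 * l + 13 : ℕ) * ω) := by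
    refine (Finset.sum_le_sum fun y _ => norm_sum_le _ _).trans ?_
    rw [Finset.sum_comm]
    refine (Finset.sum_le_sum fun j hj => hpiece j (Finset.mem_range.1 hj)).trans (le_of_eq ?_)
    simp
  refine (sum_norm_add_le hJs hfinal).trans ?_
  rw [hl, hJ]
  push_cast
  have hn : (0 : ℝ) ≤ n := by positivity
  have hn2 : (0 : ℝ) ≤ n ^ 2 := by positivity
  have : (12 * (n : ℝ) + 13) * (5 * (16 * n + 36) + 13) + (4 * n + 6) ≤ 10000 * (n + 1) ^ 2 := by
    nlinarith
  nlinarith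
end

/-! ### Restricted weak-type estimates with gain -/

section
variable {N : ℤ → ℝ} {G F : Finset ℤ} {S n : ℕ}

lemma sum_norm_le_sqrt {F W : Finset ℤ} (hFW : F ⊆ W) (f : ℤ → ℂ) {B : ℝ}
    (hB : ∑ y ∈ W, ‖f y‖ ^ 2 ≤ B) : ∑ y ∈ F, ‖f y‖ ≤ √(F.card * B) := by
  refine Real.le_sqrt_of_sq_le ?_
  refine (sq_sum_le_card_mul_sum_sq (s := F) (f := fun y => ‖f y‖)).trans ?_
  refine mul_le_mul_of_nonneg_left (le_trans ?_ hB) (Nat.cast_nonneg _)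
  exact Finset.sum_le_sum_of_subset_of_nonneg hFW fun _ _ _ => by positivity

/-- A window containing `F` and all points within distance `2 ^ (S + 1)` of `G`. -/
lemma exists_window (F G : Finset ℤ) (S : ℕ) :
    ∃ W : Finset ℤ, F ⊆ W ∧ ∀ x ∈ G, ∀ y, |x - y| ≤ 2 ^ (S + 1) → y ∈ W := by
  refine ⟨F ∪ G.biUnion fun x => Finset.Icc (x - 2 ^ (S + 1)) (x + 2 ^ (S + 1)),
    Finset.subset_union_left, fun x hx y hy => ?_⟩
  rw [abs_le] at hy
  exact Finset.mem_union_right _ (Finset.mem_biUnion.2 ⟨x, hx, Finset.mem_Icc.2 (by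
    constructor <;> linarith [hy.1, hy.2])⟩)

open Classical in
lemma exists_class_bounds (hN : ∀ x, N x ∈ Set.Icc (0 : ℝ) 1) (G : Finset ℤ) (S n : ℕ) :
    ∃ E ⊆ G, (16 : ℝ) ^ (n + 1) * E.card ≤ G.card ∧
      ∀ h : ℤ → ℂ, (∀ x ∈ E, h x = 0) → (∀ x, ‖h x‖ ≤ 1) → ∀ F : Finset ℤ,
      (∑ y ∈ F, ‖vop N G h (lev N G S n) (lev N G S (n + 1)) y‖ ≤
        10 ^ 12 * ((n + 1) ^ 2 * ((1 / 2) ^ n * √(F.card * G.card)))) ∧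
      ∀ γ : ℝ, 0 ≤ γ → γ * G.card ≤ 20 * F.card →
        (∀ z ∈ G, h z ≠ 0 → ∀ s, ((F.filter fun y => Near s z y).card : ℝ) ≤ γ * 2 ^ s) →
        ∑ y ∈ F, ‖vop N G h (lev N G S n) (lev N G S (n + 1)) y‖ ≤
          10 ^ 12 * ((n + 1) ^ 2 * ((2 ^ 8) ^ n * F.card)) := by
  obtain ⟨E, hEG, hE, hmain⟩ := exists_class hN G S n
  refine ⟨E, hEG, hE, fun h hh h1 F => ⟨?_, fun γ hγ hγG hthin => ?_⟩⟩
  all_goals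
    obtain ⟨W, hFW, hW⟩ := exists_window F G S
    have hδ : (0 : ℝ) < 1 / 16 ^ n := by positivity
    have hδ1 : (1 : ℝ) / 16 ^ n ≤ 1 := by
      rw [div_le_one (by positivity)]; exact one_le_pow₀ (by norm_num)
    have hsub : ∀ Z ⊆ G.filter (fun x => h x ≠ 0), Z ⊆ G := fun Z hZ =>
      hZ.trans (Finset.filter_subset _ _)
    have hWb : ∀ Z ⊆ G.filter (fun x => h x ≠ 0), ∀ b : ℤ → ℕ, (∀ z ∈ Z, b z ≤ S) →
        ∀ z ∈ Z, ∀ y, |z - y| ≤ 2 ^ (b z + 1) → y ∈ W := fun Z hZ b hb z hz y hy =>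
      hW z (hsub Z hZ hz) y (hy.trans (pow_le_pow_right₀ (by norm_num) (by have := hb z hz; omega)))
    have hh2 : ∀ Z ⊆ G.filter (fun x => h x ≠ 0), ∑ z ∈ Z, ‖h z‖ ^ 2 ≤ (G.card : ℝ) := by
      intro Z hZ
      refine (Finset.sum_le_card_nsmul _ _ 1 fun z _ => ?_).trans ?_
      · exact pow_le_one₀ (norm_nonneg _) (h1 z)
      · rw [nsmul_one]; exact_mod_cast Finset.card_le_card (hsub Z hZ)
    have hg : (0 : ℝ) ≤ G.card := Nat.cast_nonneg _
    have hf : (0 : ℝ) ≤ F.card := Nat.cast_nonneg _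
  · have hq : (0 : ℝ) < (1 / 2) ^ n := by positivity
    obtain ⟨q, hqd⟩ : ∃ q : ℝ, q = (1 / 2) ^ n := ⟨_, rfl⟩
    rw [← hqd] at hq ⊢
    have hq4 : (1 : ℝ) / 16 ^ n = q ^ 4 := by
      rw [hqd, ← pow_mul, mul_comm, pow_mul, one_div, ← inv_pow]; norm_num
    have hω : ∀ c B : ℝ, 0 ≤ c → B ≤ (c * (10 ^ 6 * q)) ^ 2 * G.card →
        √(F.card * B) ≤ c * (10 ^ 6 * q * √(F.card * G.card)) := by
      intro c B hc hB
      have : c * (10 ^ 6 * q * √(F.card * G.card)) =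
          √((c * (10 ^ 6 * q)) ^ 2 * (F.card * G.card)) := by
        rw [Real.sqrt_mul (sq_nonneg _), Real.sqrt_sq (by positivity)]; ring
      rw [this]
      refine Real.sqrt_le_sqrt ?_
      nlinarith
    refine (hmain h hh F (10 ^ 6 * q * √(F.card * G.card)) (by positivity) ?_ ?_).trans ?_
    rotate_left 2
    · calc 10000 * ((n : ℝ) + 1) ^ 2 * (10 ^ 6 * q * √(F.card * G.card))
          = 10 ^ 10 * (((n : ℝ) + 1) ^ 2 * (q * √(F.card * G.card))) := by ring
        _ ≤ _ := mul_le_mul_of_nonneg_right (by norm_num) (by positivity)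
    · intro A hA a b L hab hL hlow hbS
      refine (sum_norm_le_sqrt hFW _ (sum_norm_vop_few_sq_le hδ hδ1 (hsub A hA) hN hab hL hlow h1
        fun x hx y hy => hWb A hA b hbS x hx y (hy.trans
          (pow_le_pow_right₀ (by norm_num) (Nat.le_succ _))))).trans (hω L _ (by positivity) ?_)
      rw [hq4, show q ^ 4 = (q ^ 2) ^ 2 by ring, Real.sqrt_sq (by positivity)]
      have : (0 : ℝ) ≤ (L : ℝ) ^ 2 * q ^ 2 * G.card := by positivity
      nlinarith
    · intro Z hZ U u a b hfor hlow hbS hK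
      rw [← one_mul (10 ^ 6 * q * √(F.card * G.card))]
      refine (sum_norm_le_sqrt hFW _ (hfor.sum_norm_vop_sq_le hN hδ.le hδ1 (hsub Z hZ) hlow
        (hWb Z hZ b hbS) hK h)).trans (hω 1 _ zero_le_one ?_)
      have e1 : ((2 ^ (12 * n + 12) : ℕ) : ℝ) / 2 ^ (16 * n + 36) = q ^ 4 / 2 ^ 24 := by
        rw [← hq4, div_div, div_eq_div_iff (by positivity) (by positivity)]
        push_cast
        rw [show (16 : ℝ) = 2 ^ 4 by norm_num, ← pow_mul, ← pow_add, ← pow_add, one_mul]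
        congr 1
        ring
      rw [mul_div_assoc, e1, hq4]
      have hq1 : q ≤ 1 := by rw [hqd]; exact pow_le_one₀ (by norm_num) (by norm_num)
      have hq2 : q ^ 4 ≤ q ^ 2 := pow_le_pow_of_le_one hq.le hq1 (by norm_num)
      have hB : 4000000000 * q ^ 4 + 320000000000 * (q ^ 4 / 2 ^ 24) ≤ (1 * (10 ^ 6 * q)) ^ 2 := by
        nlinarith [sq_nonneg q]
      exact mul_le_mul hB (hh2 Z hZ) (Finset.sum_nonneg fun _ _ => by positivity) (by positivity)
  · obtain ⟨q, hqd⟩ : ∃ q : ℝ, q = 2 ^ (6 * n + 6) := ⟨_, rfl⟩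
    have hq1 : 1 ≤ q := by rw [hqd]; exact one_le_pow₀ (by norm_num)
    have hqK : ((2 ^ (12 * n + 12) : ℕ) : ℝ) = q ^ 2 := by
      rw [hqd, ← pow_mul]; push_cast; congr 1; ring
    refine (hmain h hh F (10 ^ 6 * q * F.card) (by positivity) ?_ ?_).trans ?_
    · intro A hA a b L hab hL hlow hbS
      refine (sum_norm_vop_few_le_of_thin hγ (hsub A hA) hab hL h1 fun z hz =>
        hthin z (hsub A hA hz) (Finset.mem_filter.1 (hA hz)).2).trans ?_
      refine mul_le_mul_of_nonneg_left ?_ (Nat.cast_nonneg _)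
      nlinarith [mul_nonneg (sub_nonneg.2 hq1) hf]
    · intro Z hZ U u a b hfor hlow hbS hK
      refine (sum_norm_le_sqrt (Finset.Subset.refl F) _ (hfor.sum_norm_vop_sq_le_of_thin hδ.le hδ1
        hγ (hsub Z hZ) hlow (hWb Z hZ b hbS) hK h fun z hz =>
        hthin z (hsub Z hZ hz) (Finset.mem_filter.1 (hZ hz)).2)).trans ?_
      refine Real.sqrt_le_iff.2 ⟨by positivity, ?_⟩
      rw [hqK]
      have : γ * ∑ z ∈ Z, ‖h z‖ ^ 2 ≤ 20 * F.card :=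
        (mul_le_mul_of_nonneg_left (hh2 Z hZ) hγ).trans hγG
      have h3 : (0 : ℝ) ≤ F.card * q ^ 2 := by positivity
      calc (F.card : ℝ) * (q ^ 2 * (20000000000 * γ * ∑ z ∈ Z, ‖h z‖ ^ 2))
          = F.card * q ^ 2 * (20000000000 * (γ * ∑ z ∈ Z, ‖h z‖ ^ 2)) := by ring
        _ ≤ F.card * q ^ 2 * (20000000000 * (20 * F.card)) := by gcongr
        _ ≤ (10 ^ 6 * q * F.card) ^ 2 := by nlinarith [mul_nonneg h3 hf]
    · have e1 : q ≤ 64 * (2 ^ 8) ^ n := by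
        rw [hqd, pow_add, pow_mul, mul_comm]
        gcongr <;> norm_num
      have h4 : (0 : ℝ) ≤ ((n : ℝ) + 1) ^ 2 * F.card := by positivity
      calc 10000 * ((n : ℝ) + 1) ^ 2 * (10 ^ 6 * q * F.card)
          = 10 ^ 10 * ((((n : ℝ) + 1) ^ 2 * F.card) * q) := by ring
        _ ≤ 10 ^ 10 * ((((n : ℝ) + 1) ^ 2 * F.card) * (64 * (2 ^ 8) ^ n)) := by gcongr
        _ = 64 * 10 ^ 10 * (((n : ℝ) + 1) ^ 2 * ((2 ^ 8) ^ n * F.card)) := by ring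
        _ ≤ _ := mul_le_mul_of_nonneg_right (by norm_num) (by positivity)

lemma sum_range_sq_mul_pow_le (S : ℕ) :
    ∑ n ∈ Finset.range S, ((n : ℝ) + 1) ^ 2 * (3 / 4 : ℝ) ^ n ≤ 112 := by
  have h : ∑ n ∈ Finset.range S, ((n : ℝ) + 1) ^ 2 * (3 / 4 : ℝ) ^ n =
      112 - (3 / 4 : ℝ) ^ S * (4 * (S : ℝ) ^ 2 + 32 * S + 112) := by
    induction S with
    | zero => norm_num
    | succ S ih => rw [Finset.sum_range_succ, ih, pow_succ]; push_cast; ring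
  rw [h, sub_le_self_iff]
  positivity

lemma sum_norm_vop_le_of_classes (h : ℤ → ℂ) (F : Finset ℤ) {c : ℝ} (hc : 0 ≤ c)
    (hcl : ∀ n < S, ∑ y ∈ F, ‖vop N G h (lev N G S n) (lev N G S (n + 1)) y‖ ≤
      c * ((n + 1) ^ 2 * (3 / 4) ^ n)) :
    ∑ y ∈ F, ‖vop N G h (fun _ => 0) (fun _ => S) y‖ ≤ 112 * c := by
  have hchain : ∀ (m : ℕ) (y : ℤ), vop N G h (lev N G S 0) (lev N G S m) y =
      ∑ n ∈ Finset.range m, vop N G h (lev N G S n) (lev N G S (n + 1)) y := by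
    intro m y
    induction m with
    | zero => simp [vop, kerN]
    | succ m ih => rw [Finset.sum_range_succ, ← ih, ← vop_add]
  have htot : ∀ y, vop N G h (fun _ => 0) (fun _ => S) y =
      ∑ n ∈ Finset.range S, vop N G h (lev N G S n) (lev N G S (n + 1)) y := fun y => by
    rw [← hchain]
    exact vop_congr (fun _ _ => rfl) (fun x _ => (lev_zero x).symm) fun x hx => (lev_eq hx).symm
  simp only [htot]
  refine (Finset.sum_le_sum fun y _ => norm_sum_le _ _).trans ?_
  rw [Finset.sum_comm]
  refine (Finset.sum_le_sum fun n hn => hcl n (Finset.mem_range.1 hn)).trans ?_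
  rw [← Finset.mul_sum, mul_comm]
  exact mul_le_mul_of_nonneg_right (sum_range_sq_mul_pow_le S) hc

/-- Away from a small exceptional set all classes of scales satisfy both estimates. -/
lemma exists_exceptional (hN : ∀ x, N x ∈ Set.Icc (0 : ℝ) 1) (G : Finset ℤ) (S : ℕ) :
    ∃ E ⊆ G, 4 * (E.card : ℝ) ≤ G.card ∧
      ∀ h : ℤ → ℂ, (∀ x ∈ E, h x = 0) → (∀ x, ‖h x‖ ≤ 1) → ∀ F : Finset ℤ, ∀ n < S,
      (∑ y ∈ F, ‖vop N G h (lev N G S n) (lev N G S (n + 1)) y‖ ≤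
        10 ^ 12 * ((n + 1) ^ 2 * ((1 / 2) ^ n * √(F.card * G.card)))) ∧
      ∀ γ : ℝ, 0 ≤ γ → γ * G.card ≤ 20 * F.card →
        (∀ z ∈ G, h z ≠ 0 → ∀ s, (F.filter fun y => Near s z y).card ≤ γ * 2 ^ s) →
        ∑ y ∈ F, ‖vop N G h (lev N G S n) (lev N G S (n + 1)) y‖ ≤
          10 ^ 12 * ((n + 1) ^ 2 * ((2 ^ 8) ^ n * F.card)) := by
  classical
  choose E hEG hE hmain using exists_class_bounds hN G S
  refine ⟨(Finset.range S).biUnion E, Finset.biUnion_subset.2 fun n _ => hEG n, ?_,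
    fun h hh h1 F n hn => ?_⟩
  · have h1 : (((Finset.range S).biUnion E).card : ℝ) ≤
        ∑ n ∈ Finset.range S, (G.card : ℝ) / 16 * (1 / 16) ^ n := by
      refine le_trans (b := ∑ n ∈ Finset.range S, ((E n).card : ℝ))
        (by exact_mod_cast Finset.card_biUnion_le) (Finset.sum_le_sum fun n _ => ?_)
      rw [div_mul_eq_mul_div, one_div_pow, mul_one_div, div_div, le_div_iff₀ (by positivity),
        ← pow_succ, mul_comm]
      exact hE n
    have h2 : ∑ n ∈ Finset.range S, ((1 : ℝ) / 16) ^ n ≤ 16 / 15 := by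
      rw [geom_sum_eq (by norm_num)]
      have : (0 : ℝ) ≤ (1 / 16) ^ S := by positivity
      rw [div_le_iff_of_neg (by norm_num)]
      linarith
    rw [← Finset.mul_sum] at h1
    have h3 : (0 : ℝ) ≤ G.card := Nat.cast_nonneg _
    nlinarith
  · have h2 := hmain n h (fun x hx => hh x (Finset.mem_biUnion.2 ⟨n, Finset.mem_range.2 hn, hx⟩))
      h1 F
    convert h2
end

/-! ### Iteration over exceptional sets -/

/-- The interpolated quantity `f ^ (17 / 32) * g ^ (15 / 32)`. -/
noncomputable def mixed (f g : ℝ) : ℝ := f ^ ((17 : ℝ) / 32) * g ^ ((15 : ℝ) / 32)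

section
variable {f g x y : ℝ}

lemma mixed_nonneg (hf : 0 ≤ f) (hg : 0 ≤ g) : 0 ≤ mixed f g := by unfold mixed; positivity

lemma mixed_pow (hf : 0 ≤ f) (hg : 0 ≤ g) : mixed f g ^ 32 = f ^ 17 * g ^ 15 := by
  rw [mixed, mul_pow, ← Real.rpow_mul_natCast hf, ← Real.rpow_mul_natCast hg,
    ← Real.rpow_natCast f, ← Real.rpow_natCast g]
  norm_num

lemma le_of_pow_32_le (hy : 0 ≤ y) (h : x ^ 32 ≤ y ^ 32) : x ≤ y :=
  le_of_pow_le_pow_left₀ (by norm_num) hy h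

lemma sqrt_mul_pow_32 (hf : 0 ≤ f) (hg : 0 ≤ g) : √(f * g) ^ 32 = f ^ 16 * g ^ 16 := by
  rw [show 32 = 2 * 16 by norm_num, pow_mul, Real.sq_sqrt (by positivity), mul_pow]

lemma mixed_le_of_le_half (hf : 0 ≤ f) (hx : 0 ≤ x) (hxg : x ≤ g / 2) :
    mixed f x ≤ 3 / 4 * mixed f g := by
  have hg : 0 ≤ g := by linarith
  refine le_of_pow_32_le (mul_nonneg (by norm_num) (mixed_nonneg hf hg)) ?_
  rw [mul_pow, mixed_pow hf hx, mixed_pow hf hg]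
  have h1 : x ^ 15 ≤ (g / 2) ^ 15 := pow_le_pow_left₀ hx hxg 15
  calc f ^ 17 * x ^ 15 ≤ f ^ 17 * (g / 2) ^ 15 := by gcongr
    _ = (1 / 2) ^ 15 * (f ^ 17 * g ^ 15) := by ring
    _ ≤ _ := mul_le_mul_of_nonneg_right (by norm_num) (by positivity)

lemma le_mixed (hf : 0 ≤ f) (hfg : f ≤ g) : f ≤ mixed f g := by
  refine le_of_pow_32_le (mixed_nonneg hf (hf.trans hfg)) ?_
  rw [mixed_pow hf (hf.trans hfg)]
  calc f ^ 32 = f ^ 17 * f ^ 15 := by ring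
    _ ≤ f ^ 17 * g ^ 15 := by gcongr

lemma mixed_le_mixed_swap (hf : 0 ≤ f) (hfg : f ≤ g) : mixed f g ≤ mixed g f := by
  have hg := hf.trans hfg
  refine le_of_pow_32_le (mixed_nonneg hg hf) ?_
  rw [mixed_pow hf hg, mixed_pow hg hf]
  calc f ^ 17 * g ^ 15 = f ^ 15 * g ^ 15 * f ^ 2 := by ring
    _ ≤ f ^ 15 * g ^ 15 * g ^ 2 := by gcongr
    _ = _ := by ring

lemma le_pow_mul_mixed {n : ℕ} (hf : 0 ≤ f) (hg : 0 ≤ g) (hx : 0 ≤ x)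
    (h1 : x ≤ (1 / 2) ^ n * √(f * g)) (h2 : x ≤ (2 ^ 8) ^ n * f) :
    x ≤ (3 / 4) ^ n * mixed f g := by
  refine le_of_pow_32_le (mul_nonneg (by positivity) (mixed_nonneg hf hg)) ?_
  have h3 : x ^ 30 ≤ ((1 / 2) ^ n) ^ 30 * (f ^ 15 * g ^ 15) := by
    refine (pow_le_pow_left₀ hx h1 30).trans (le_of_eq ?_)
    rw [mul_pow, show 30 = 2 * 15 by norm_num, pow_mul √(f * g), Real.sq_sqrt (by positivity),
      mul_pow f g]
  have h4 : x ^ 2 ≤ ((2 ^ 8) ^ n) ^ 2 * f ^ 2 := by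
    rw [← mul_pow]; exact pow_le_pow_left₀ hx h2 2
  have h5 : (((1 : ℝ) / 2) ^ n) ^ 30 * ((2 ^ 8) ^ n) ^ 2 ≤ ((3 / 4) ^ n) ^ 32 := by
    rw [pow_right_comm _ n 30, pow_right_comm _ n 2, pow_right_comm _ n 32, ← mul_pow]
    exact pow_le_pow_left₀ (by norm_num) (by norm_num) n
  calc x ^ 32 = x ^ 30 * x ^ 2 := by ring
    _ ≤ ((1 / 2) ^ n) ^ 30 * (f ^ 15 * g ^ 15) * (((2 ^ 8) ^ n) ^ 2 * f ^ 2) := by gcongr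
    _ = ((1 / 2) ^ n) ^ 30 * ((2 ^ 8) ^ n) ^ 2 * (f ^ 17 * g ^ 15) := by ring
    _ ≤ ((3 / 4) ^ n) ^ 32 * (f ^ 17 * g ^ 15) := by gcongr
    _ = ((3 / 4) ^ n * mixed f g) ^ 32 := by rw [mul_pow, mixed_pow hf hg]

end

section
variable {N : ℤ → ℝ} {G F : Finset ℤ} {S n : ℕ} {h : ℤ → ℂ}

lemma vop_split {E : Finset ℤ} (hE : E ⊆ G) (h : ℤ → ℂ) (a b : ℤ → ℕ) (y : ℤ) :
    vop N G h a b y = vop N G (fun x => if x ∈ E then 0 else h x) a b y + vop N E h a b y := by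
  have h1 : vop N G (fun x => if x ∈ E then 0 else h x) a b y =
      ∑ x ∈ G \ E, h x * kerN N (a x) (b x) x y := by
    rw [vop, ← Finset.sum_sdiff hE]
    rw [Finset.sum_eq_zero (s := E) (fun x hx => by simp [hx]), add_zero]
    exact Finset.sum_congr rfl fun x hx => by rw [if_neg (Finset.mem_sdiff.1 hx).2]
  rw [h1]
  exact (Finset.sum_sdiff hE).symm

lemma sum_norm_vop_iterate (hh : ∀ x, ‖h x‖ ≤ 1) (Φ : Finset ℤ → ℝ) (h0 : 0 ≤ Φ ∅)
    (hstep : ∀ G' ⊆ G, G'.Nonempty → ∃ E ⊂ G', ∀ h' : ℤ → ℂ, (∀ x ∈ E, h' x = 0) →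
      (∀ x, ‖h' x‖ ≤ 1) →
      ∑ y ∈ F, ‖vop N G' h' (fun _ => 0) (fun _ => S) y‖ ≤ Φ G' - Φ E) :
    ∑ y ∈ F, ‖vop N G h (fun _ => 0) (fun _ => S) y‖ ≤ Φ G := by
  induction G using Finset.strongInduction with
  | H G ih =>
    rcases G.eq_empty_or_nonempty with rfl | hG
    · simpa [vop] using h0
    obtain ⟨E, hE, hEG⟩ := hstep G (Finset.Subset.refl G) hG
    have h1 := hEG (fun x => if x ∈ E then 0 else h x) (fun x hx => if_pos hx) (fun x => by
      split_ifs
      · simp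
      · exact hh x)
    have h2 := ih E hE fun G' hG' => hstep G' (hG'.trans hE.1)
    simp only [vop_split hE.1 h]
    exact (sum_norm_add_le h1 h2).trans (by linarith)

lemma ssubset_of_two_mul_card_le {E : Finset ℤ} (hE : E ⊆ G) (hG : G.Nonempty)
    (h : 2 * (E.card : ℝ) ≤ G.card) : E ⊂ G := by
  refine Finset.ssubset_iff_subset_ne.2 ⟨hE, fun he => ?_⟩
  have : (0 : ℝ) < G.card := by exact_mod_cast hG.card_pos
  rw [he] at h
  linarith

lemma sqrt_le_half_sqrt {f e g : ℝ} (hf : 0 ≤ f) (he : 0 ≤ e) (h : 4 * e ≤ g) : √(f * e) ≤ √(f * g) / 2 := by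
  rw [le_div_iff₀ two_pos]
  refine Real.le_sqrt_of_sq_le ?_
  rw [mul_pow, Real.sq_sqrt (by positivity)]
  nlinarith

/-- The restricted weak type estimate without gain. -/
lemma sum_norm_vop_le_sqrt (hN : ∀ x, N x ∈ Set.Icc (0 : ℝ) 1) (F G : Finset ℤ)
    (hh : ∀ x, ‖h x‖ ≤ 1) :
    ∑ y ∈ F, ‖vop N G h (fun _ => 0) (fun _ => S) y‖ ≤ 10 ^ 16 * √(F.card * G.card) := by
  refine sum_norm_vop_iterate hh (fun G => 10 ^ 16 * √(F.card * G.card)) (by simp)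
    fun G' _ hG' => ?_
  obtain ⟨E, hEG, hE, hmain⟩ := exists_exceptional hN G' S
  refine ⟨E, ssubset_of_two_mul_card_le hEG hG' (by
    have : (0 : ℝ) ≤ E.card := Nat.cast_nonneg _
    linarith), fun h' h0 h1 => ?_⟩
  refine (sum_norm_vop_le_of_classes (N := N) h' F (c := 10 ^ 12 * √(F.card * G'.card))
    (by positivity) fun n hn => ((hmain h' h0 h1 F n hn).1).trans ?_).trans ?_
  · have h2 : ((1 : ℝ) / 2) ^ n ≤ (3 / 4) ^ n :=
      pow_le_pow_left₀ (by norm_num) (by norm_num) n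
    calc (10 : ℝ) ^ 12 * ((n + 1) ^ 2 * ((1 / 2) ^ n * √(F.card * G'.card)))
        ≤ 10 ^ 12 * ((n + 1) ^ 2 * ((3 / 4) ^ n * √(F.card * G'.card))) := by gcongr
      _ = _ := by ring
  · have h3 := sqrt_le_half_sqrt (Nat.cast_nonneg F.card) (Nat.cast_nonneg E.card) hE
    have h4 : 0 ≤ √((F.card : ℝ) * G'.card) := Real.sqrt_nonneg _
    linarith

/-- The restricted weak type estimate with gain when `F` is smaller than `G`. -/
lemma sum_norm_vop_le_mixed (hN : ∀ x, N x ∈ Set.Icc (0 : ℝ) 1) (hh : ∀ x, ‖h x‖ ≤ 1)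
    (hFG : F.card ≤ G.card) :
    ∑ y ∈ F, ‖vop N G h (fun _ => 0) (fun _ => S) y‖ ≤ 10 ^ 17 * mixed F.card G.card := by
  classical
  rcases F.eq_empty_or_nonempty with rfl | hF
  · simpa using mixed_nonneg le_rfl (Nat.cast_nonneg _)
  have hF0 : (0 : ℝ) < F.card := by exact_mod_cast hF.card_pos
  set Φ : Finset ℤ → ℝ := fun G => if F.card ≤ G.card then 10 ^ 17 * mixed F.card G.card else
    10 ^ 16 * √(F.card * G.card) with hΦ
  suffices ∑ y ∈ F, ‖vop N G h (fun _ => 0) (fun _ => S) y‖ ≤ Φ G by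
    simpa only [hΦ, if_pos hFG] using this
  have hΦ0 : Φ ∅ = 0 := by
    simp only [hΦ]; rw [if_neg (by simpa using hF.ne_empty)]; simp
  refine sum_norm_vop_iterate hh Φ hΦ0.ge fun G' _ hG' => ?_
  by_cases hc : F.card ≤ G'.card
  swap
  · refine ⟨∅, Finset.empty_ssubset.2 hG', fun h' _ h1 => ?_⟩
    rw [hΦ0, sub_zero]
    simp only [hΦ, if_neg hc]
    exact sum_norm_vop_le_sqrt hN F G' h1
  obtain ⟨E, hEG, hE, hmain⟩ := exists_exceptional hN G' S
  have hG0 : (0 : ℝ) < G'.card := by exact_mod_cast hG'.card_pos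
  set γ : ℝ := 20 * F.card / G'.card with hγ
  have hγ0 : 0 < γ := by positivity
  have hγG : γ * G'.card = 20 * F.card := by rw [hγ]; field_simp
  set B := G'.filter fun x => ∃ s, γ * 2 ^ s < (F.filter fun y => Near s x y).card with hB
  have hBcard : 4 * (B.card : ℝ) ≤ G'.card := by
    have h1 : γ * B.card ≤ 5 * F.card := by
      have := card_maximal_le G' F γ hγ0
      convert this
    have h2 : γ * (4 * B.card) ≤ γ * G'.card := by rw [hγG]; linarith
    exact le_of_mul_le_mul_left h2 hγ0
  have hEB : 2 * ((E ∪ B).card : ℝ) ≤ G'.card := by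
    have : ((E ∪ B).card : ℝ) ≤ E.card + B.card := by exact_mod_cast Finset.card_union_le E B
    linarith
  refine ⟨E ∪ B, ssubset_of_two_mul_card_le
    (Finset.union_subset hEG (Finset.filter_subset _ _)) hG' hEB, fun h' h0 h1 => ?_⟩
  have hm : 0 ≤ mixed F.card G'.card := mixed_nonneg hF0.le hG0.le
  have hstep : ∑ y ∈ F, ‖vop N G' h' (fun _ => 0) (fun _ => S) y‖ ≤
      112 * (10 ^ 12 * mixed F.card G'.card) := by
    refine sum_norm_vop_le_of_classes (N := N) h' F (by positivity) fun n hn => ?_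
    obtain ⟨b1, b2⟩ := hmain h' (fun x hx => h0 x (Finset.mem_union_left _ hx)) h1 F n hn
    have b3 := b2 γ hγ0.le hγG.le (fun z hz hz0 s => by
      by_contra! hcon
      refine hz0 (h0 z (Finset.mem_union_right _ (Finset.mem_filter.2 ⟨hz, s, ?_⟩)))
      convert hcon)
    have hp : (0 : ℝ) < 10 ^ 12 * (n + 1) ^ 2 := by positivity
    rw [← mul_assoc, ← div_le_iff₀' hp] at b1 b3
    have b4 := le_pow_mul_mixed hF0.le hG0.le (by positivity) b1 b3
    rw [div_le_iff₀' hp] at b4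
    exact b4.trans (le_of_eq (by ring))
  have hΦE : Φ (E ∪ B) ≤ 3 / 4 * (10 ^ 17 * mixed F.card G'.card) := by
    simp only [hΦ]
    split_ifs with h3
    · have := mixed_le_of_le_half hF0.le (Nat.cast_nonneg (E ∪ B).card)
        (show ((E ∪ B).card : ℝ) ≤ G'.card / 2 by linarith)
      linarith
    · have h4 : √(F.card * (E ∪ B).card) ≤ (F.card : ℝ) := by
        refine Real.sqrt_le_iff.2 ⟨hF0.le, ?_⟩
        have : ((E ∪ B).card : ℝ) ≤ F.card := by exact_mod_cast (not_le.1 h3).le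
        nlinarith
      have h5 : (F.card : ℝ) ≤ mixed F.card G'.card := le_mixed hF0.le (by exact_mod_cast hc)
      linarith
  have hΦG : Φ G' = 10 ^ 17 * mixed F.card G'.card := if_pos hc
  rw [hΦG]
  linarith

open Classical in
lemma exists_lt_card_near_of_vop_ne_zero {y : ℤ} {n : ℕ}
    (hne : vop N G h (lev N G S n) (lev N G S (n + 1)) y ≠ 0) :
    ∃ s, 1 / 16 ^ (n + 1) * 2 ^ s < ((G.filter fun z => Near s y z).card : ℝ) := by
  by_contra! hcon
  refine hne (vop_eq_zero (fun x _ => lev_mono x) fun z _ t h1 h2 => ?_)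
  by_contra! hlt
  refine not_low_of_le_lev (S := S) (n := n + 1) (N := N) (G := G) (x := z) (s := t + 1) h2
    (by omega) fun t' ht' θ r hr _ => ?_
  have hsub : freqSet N G t' (x := z) θ (r / 2 ^ t') ⊆ G.filter fun w => Near t' y w := by
    intro w hw
    obtain ⟨hwG, hwb, -⟩ := mem_freqSet.1 hw
    refine Finset.mem_filter.2 ⟨hwG, ?_⟩
    have h3 : Near t' z y := near_of_abs_lt
      (hlt.le.trans (pow_le_pow_right₀ (by norm_num) ht'))
    unfold Near at h3 ⊢
    rw [hwb, abs_sub_comm]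
    exact h3
  have h4 : ((freqSet N G t' z θ (r / 2 ^ t')).card : ℝ) ≤ 1 / 16 ^ (n + 1) * 2 ^ t' :=
    le_trans (by exact_mod_cast Finset.card_le_card hsub) (hcon t')
  refine h4.trans ?_
  have h5 : (0 : ℝ) < 1 / 16 ^ (n + 1) * 2 ^ t' := by positivity
  nlinarith

open Classical in
/-- The estimate for a set `F` near which `G` is everywhere thin. -/
lemma sum_norm_vop_le_of_thin (hN : ∀ x, N x ∈ Set.Icc (0 : ℝ) 1) (hh : ∀ x, ‖h x‖ ≤ 1) {τ : ℝ}
    (hτ : 0 ≤ τ)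
    (hthin : ∀ y ∈ F, ∀ s, ((G.filter fun z => Near s y z).card : ℝ) ≤ τ ^ 32 * 2 ^ s) :
    ∑ y ∈ F, ‖vop N G h (fun _ => 0) (fun _ => S) y‖ ≤ 10 ^ 16 * (τ * √(F.card * G.card)) := by
  refine sum_norm_vop_iterate hh (fun G => 10 ^ 16 * (τ * √(F.card * G.card))) (by simp)
    fun G' hsub hG' => ?_
  obtain ⟨E, hEG, hE, hmain⟩ := exists_exceptional hN G' S
  refine ⟨E, ssubset_of_two_mul_card_le hEG hG' (by
    have : (0 : ℝ) ≤ E.card := Nat.cast_nonneg _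
    linarith), fun h' h0 h1 => ?_⟩
  refine (sum_norm_vop_le_of_classes (N := N) h' F (c := 10 ^ 12 * (2 * τ * √(F.card * G'.card)))
    (by positivity) fun n hn => ?_).trans ?_
  · by_cases hz : ∀ y ∈ F, vop N G' h' (lev N G' S n) (lev N G' S (n + 1)) y = 0
    · rw [Finset.sum_eq_zero fun y hy => by rw [hz y hy, norm_zero]]
      positivity
    push Not at hz
    obtain ⟨y, hy, hne⟩ := hz
    obtain ⟨s, hs⟩ := exists_lt_card_near_of_vop_ne_zero hne
    have h2 : 1 / 16 ^ (n + 1) ≤ τ ^ 32 := by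
      have h3 : ((G'.filter fun z => Near s y z).card : ℝ) ≤
          ((G.filter fun z => Near s y z).card : ℝ) := by
        exact_mod_cast Finset.card_le_card (Finset.filter_subset_filter _ hsub)
      exact le_of_mul_le_mul_right (hs.le.trans (h3.trans (hthin y hy s))) (by positivity)
    have h4 : ((2 : ℝ) / 3) ^ n ≤ 2 * τ := by
      refine le_of_pow_32_le (by positivity) ?_
      rw [mul_pow, ← pow_mul, mul_comm n, pow_mul]
      calc (((2 : ℝ) / 3) ^ 32) ^ n ≤ (1 / 16) ^ n :=
            pow_le_pow_left₀ (by norm_num) (by norm_num) n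
        _ = 16 * (1 / 16 ^ (n + 1)) := by rw [pow_succ, one_div_pow]; field_simp
        _ ≤ 16 * τ ^ 32 := by gcongr
        _ ≤ 2 ^ 32 * τ ^ 32 := mul_le_mul_of_nonneg_right (by norm_num) (by positivity)
    refine ((hmain h' h0 h1 F n hn).1).trans ?_
    calc (10 : ℝ) ^ 12 * ((n + 1) ^ 2 * ((1 / 2) ^ n * √(F.card * G'.card)))
        = 10 ^ 12 * ((n + 1) ^ 2 * ((2 / 3) ^ n * (3 / 4) ^ n * √(F.card * G'.card))) := by
          rw [← mul_pow]; norm_num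
      _ ≤ 10 ^ 12 * ((n + 1) ^ 2 * (2 * τ * (3 / 4) ^ n * √(F.card * G'.card))) := by gcongr
      _ = _ := by ring
  · have h3 := mul_le_mul_of_nonneg_left
      (sqrt_le_half_sqrt (Nat.cast_nonneg F.card) (Nat.cast_nonneg E.card) hE) hτ
    have h4 : 0 ≤ τ * √((F.card : ℝ) * G'.card) := by positivity
    linarith

/-- The restricted weak type estimate with gain when `G` is smaller than `F`. -/
lemma sum_norm_vop_le_mixed_swap (hN : ∀ x, N x ∈ Set.Icc (0 : ℝ) 1) (hh : ∀ x, ‖h x‖ ≤ 1)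
    (hGF : G.card ≤ F.card) :
    ∑ y ∈ F, ‖vop N G h (fun _ => 0) (fun _ => S) y‖ ≤ 10 ^ 17 * mixed G.card F.card := by
  classical
  rcases G.eq_empty_or_nonempty with rfl | hG
  · simpa [vop] using mixed_nonneg le_rfl (Nat.cast_nonneg _)
  have hG0 : (0 : ℝ) < G.card := by exact_mod_cast hG.card_pos
  induction F using Finset.strongInduction with
  | H F ih =>
    have hGF' : (G.card : ℝ) ≤ F.card := by exact_mod_cast hGF
    have hF0 : (0 : ℝ) < F.card := hG0.trans_le hGF'
    have hm : 0 ≤ mixed G.card F.card := mixed_nonneg hG0.le hF0.le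
    set κ : ℝ := 10 * G.card / F.card with hκ
    have hκ0 : 0 < κ := by positivity
    have hκF : κ * F.card = 10 * G.card := by rw [hκ]; field_simp
    set B := F.filter fun x => ∃ s, κ * 2 ^ s < (G.filter fun y => Near s x y).card with hB
    have hBF : B ⊆ F := Finset.filter_subset _ _
    have hBcard : 2 * (B.card : ℝ) ≤ F.card := by
      have h1 : κ * B.card ≤ 5 * G.card := by
        have := card_maximal_le F G κ hκ0
        convert this
      have h2 : κ * (2 * B.card) ≤ κ * F.card := by rw [hκF]; linarith
      exact le_of_mul_le_mul_left h2 hκ0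
    have hFne : F.Nonempty := Finset.card_pos.1 (by exact_mod_cast hF0)
    rw [← Finset.sum_sdiff hBF]
    have hτ : (κ ^ ((1 : ℝ) / 32)) ^ 32 = κ := by
      rw [← Real.rpow_mul_natCast hκ0.le]; norm_num
    have q1 : ∑ y ∈ F \ B, ‖vop N G h (fun _ => 0) (fun _ => S) y‖ ≤
        10 ^ 16 * (2 * mixed G.card F.card) := by
      refine (sum_norm_vop_le_of_thin hN hh (τ := κ ^ ((1 : ℝ) / 32)) (by positivity)
        fun y hy s => ?_).trans ?_
      · rw [hτ]
        by_contra! hcon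
        obtain ⟨hyF, hyB⟩ := Finset.mem_sdiff.1 hy
        refine hyB (Finset.mem_filter.2 ⟨hyF, s, ?_⟩)
        convert hcon
      · refine mul_le_mul_of_nonneg_left ?_ (by positivity)
        have h3 : ((F \ B).card : ℝ) ≤ F.card := by
          exact_mod_cast Finset.card_le_card Finset.sdiff_subset
        refine le_trans (b := κ ^ ((1 : ℝ) / 32) * √(F.card * G.card)) (by gcongr) ?_
        refine le_of_pow_32_le (by positivity) ?_
        rw [mul_pow, mul_pow, hτ, mixed_pow hG0.le hF0.le, sqrt_mul_pow_32 hF0.le hG0.le]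
        have : κ * ((F.card : ℝ) ^ 16 * (G.card : ℝ) ^ 16) =
            10 * ((G.card : ℝ) ^ 17 * (F.card : ℝ) ^ 15) := by
          calc κ * ((F.card : ℝ) ^ 16 * (G.card : ℝ) ^ 16) =
                κ * F.card * ((F.card : ℝ) ^ 15 * (G.card : ℝ) ^ 16) := by ring
            _ = _ := by rw [hκF]; ring
        rw [this]
        exact mul_le_mul_of_nonneg_right (by norm_num) (by positivity)
    have q2 : ∑ y ∈ B, ‖vop N G h (fun _ => 0) (fun _ => S) y‖ ≤
        3 / 4 * (10 ^ 17 * mixed G.card F.card) := by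
      rcases le_or_gt G.card B.card with h3 | h3
      · refine (ih B (ssubset_of_two_mul_card_le hBF hFne hBcard) h3).trans ?_
        have := mixed_le_of_le_half hG0.le (Nat.cast_nonneg B.card)
          (show (B.card : ℝ) ≤ F.card / 2 by linarith)
        linarith
      · have h4 : √(B.card * G.card) ≤ (G.card : ℝ) := by
          refine Real.sqrt_le_iff.2 ⟨hG0.le, ?_⟩
          have : (B.card : ℝ) ≤ G.card := by exact_mod_cast h3.le
          nlinarith
        have h5 : (G.card : ℝ) ≤ mixed G.card F.card := le_mixed hG0.le hGF'
        refine (sum_norm_vop_le_sqrt hN B G hh).trans ?_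
        linarith
    linarith

/-- The restricted weak type estimates with gain in both directions. -/
lemma sum_norm_vop_le_mixed_both (hN : ∀ x, N x ∈ Set.Icc (0 : ℝ) 1) (F G : Finset ℤ) (S : ℕ)
    (hh : ∀ x, ‖h x‖ ≤ 1) :
    ∑ y ∈ F, ‖vop N G h (fun _ => 0) (fun _ => S) y‖ ≤ 10 ^ 17 * mixed F.card G.card ∧
      ∑ y ∈ F, ‖vop N G h (fun _ => 0) (fun _ => S) y‖ ≤ 10 ^ 17 * mixed G.card F.card := by
  rcases le_total F.card G.card with hc | hc
  · have h1 := sum_norm_vop_le_mixed (S := S) hN hh hc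
    refine ⟨h1, h1.trans (mul_le_mul_of_nonneg_left ?_ (by positivity))⟩
    exact mixed_le_mixed_swap (Nat.cast_nonneg _) (by exact_mod_cast hc)
  · have h1 := sum_norm_vop_le_mixed_swap (S := S) hN hh hc
    refine ⟨h1.trans (mul_le_mul_of_nonneg_left ?_ (by positivity)), h1⟩
    exact mixed_le_mixed_swap (Nat.cast_nonneg _) (by exact_mod_cast hc)
end

/-! ### From restricted weak-type estimates to the `ℓ²` bound -/

lemma sum_pow_natAbs_le {r : ℝ} (h0 : 0 ≤ r) (h1 : r < 1) (k : ℤ) (L : Finset ℤ) :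
    ∑ l ∈ L, r ^ (k - l).natAbs ≤ 2 / (1 - r) := by
  have hinj : ∀ L' : Finset ℤ, Set.InjOn (fun l : ℤ => (k - l).natAbs) L' →
      ∑ l ∈ L', r ^ (k - l).natAbs ≤ 1 / (1 - r) := by
    intro L' hL'
    rw [← Finset.sum_image (f := fun m : ℕ => r ^ m) hL', one_div, ← tsum_geometric_of_lt_one h0 h1]
    exact (summable_geometric_of_lt_one h0 h1).sum_le_tsum _ fun _ _ => by positivity
  rw [← Finset.sum_filter_add_sum_filter_not L (fun l => l ≤ k), show (2 : ℝ) = 1 + 1 by norm_num,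
    add_div]
  refine add_le_add (hinj _ fun a ha b hb hab => ?_) (hinj _ fun a ha b hb hab => ?_)
  all_goals
    have h2 := (Finset.mem_filter.1 ha).2
    have h3 := (Finset.mem_filter.1 hb).2
    simp only at hab
    omega

lemma zpow_mul_mixed_le {r : ℝ} (hr : 0 ≤ r) (hr32 : r ^ 32 = 1 / 4) {f g : ℝ} (hf : 0 ≤ f)
    (hg : 0 ≤ g) {k l : ℤ} (hkl : l ≤ k) :
    (2 : ℝ) ^ k * 2 ^ l * mixed f g ≤ r ^ (k - l).natAbs * (4 ^ k * f + 4 ^ l * g) := by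
  refine le_of_pow_32_le (by positivity) ?_
  obtain ⟨m, rfl⟩ : ∃ m : ℕ, k = l + m := ⟨(k - l).toNat, by omega⟩
  have h1 : (l + (m : ℤ) - l).natAbs = m := by omega
  have h2 : (4 : ℝ) ^ (l + (m : ℤ)) = (2 ^ (l + (m : ℤ))) ^ 2 := by
    rw [← zpow_natCast, ← zpow_mul, mul_comm, zpow_mul]; norm_num
  have h3 : (4 : ℝ) ^ l = (2 ^ l) ^ 2 := by
    rw [← zpow_natCast ((2 : ℝ) ^ l), ← zpow_mul, mul_comm, zpow_mul]; norm_num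
  rw [h1, h2, h3, zpow_add₀ two_ne_zero, zpow_natCast, mul_pow, mul_pow _ (2 ^ l) 32, mixed_pow hf hg,
    mul_pow (r ^ m), pow_right_comm, hr32]
  have ha : (0 : ℝ) < 2 ^ l := by positivity
  have hb : (0 : ℝ) < 2 ^ m := by positivity
  have hb4 : ((1 : ℝ) / 4) ^ m = 1 / (2 ^ m) ^ 2 := by
    rw [one_div_pow, ← pow_mul, mul_comm, pow_mul]; norm_num
  rw [hb4]
  generalize (2 : ℝ) ^ l = a at *
  generalize (2 : ℝ) ^ m = b at *
  have hP : 0 ≤ (a * b) ^ 2 * f := by positivity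
  have hQ : 0 ≤ a ^ 2 * g := by positivity
  have key : ((a * b) ^ 2 * f) ^ 17 * (a ^ 2 * g) ^ 15 ≤ ((a * b) ^ 2 * f + a ^ 2 * g) ^ 32 :=
    calc _ ≤ ((a * b) ^ 2 * f + a ^ 2 * g) ^ 17 * ((a * b) ^ 2 * f + a ^ 2 * g) ^ 15 := by
          gcongr <;> linarith
      _ = _ := by ring
  calc (a * b) ^ 32 * a ^ 32 * (f ^ 17 * g ^ 15)
      = 1 / b ^ 2 * (((a * b) ^ 2 * f) ^ 17 * (a ^ 2 * g) ^ 15) := by field_simp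
    _ ≤ 1 / b ^ 2 * ((a * b) ^ 2 * f + a ^ 2 * g) ^ 32 := by gcongr

lemma zpow_mul_min_mixed_le {r : ℝ} (hr : 0 ≤ r) (hr32 : r ^ 32 = 1 / 4) {f g x : ℝ} (hf : 0 ≤ f)
    (hg : 0 ≤ g) (h1 : x ≤ mixed f g) (h2 : x ≤ mixed g f) (k l : ℤ) :
    (2 : ℝ) ^ k * 2 ^ l * x ≤ r ^ (k - l).natAbs * (4 ^ k * f + 4 ^ l * g) := by
  rcases le_total l k with hkl | hkl
  · refine le_trans ?_ (zpow_mul_mixed_le hr hr32 hf hg hkl)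
    gcongr
  · rw [← Int.natAbs_neg, neg_sub, add_comm, mul_comm ((2 : ℝ) ^ k)]
    refine le_trans ?_ (zpow_mul_mixed_le hr hr32 hg hf hkl)
    gcongr

/-- The dyadic level set of `f` on `Y`. -/
noncomputable def levelSet (Y : Finset ℤ) (f : ℤ → ℂ) (k : ℤ) : Finset ℤ :=
  (Y.filter fun y => f y ≠ 0).filter fun y => Int.log 2 ‖f y‖ = k

section
variable {Y X : Finset ℤ} {f h : ℤ → ℂ} {k : ℤ}

lemma zpow_le_norm_of_mem_levelSet {y : ℤ} (hy : y ∈ levelSet Y f k) : (2 : ℝ) ^ k ≤ ‖f y‖ := by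
  obtain ⟨h1, rfl⟩ := Finset.mem_filter.1 hy
  have h2 := (Finset.mem_filter.1 h1).2
  exact_mod_cast Int.zpow_log_le_self (b := 2) (by norm_num) (norm_pos_iff.2 h2)

lemma norm_le_zpow_of_mem_levelSet {y : ℤ} (hy : y ∈ levelSet Y f k) :
    ‖f y‖ ≤ (2 : ℝ) ^ (k + 1) := by
  obtain ⟨h1, rfl⟩ := Finset.mem_filter.1 hy
  exact_mod_cast (Int.lt_zpow_succ_log_self (b := 2) (by norm_num) ‖f y‖).le

lemma exists_sum_levelSet (Y : Finset ℤ) (f : ℤ → ℂ) :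
    ∃ K : Finset ℤ, (∀ {E : Type} [AddCommMonoid E] (w : ℤ → E), (∀ y ∈ Y, f y = 0 → w y = 0) →
      ∑ y ∈ Y, w y = ∑ k ∈ K, ∑ y ∈ levelSet Y f k, w y) ∧
      ∑ k ∈ K, (4 : ℝ) ^ k * (levelSet Y f k).card ≤ ∑ y ∈ Y, ‖f y‖ ^ 2 := by
  have key : ∀ {E : Type} [AddCommMonoid E] (w : ℤ → E), (∀ y ∈ Y, f y = 0 → w y = 0) →
      ∑ y ∈ Y, w y = ∑ k ∈ (Y.filter fun y => f y ≠ 0).image fun y => Int.log 2 ‖f y‖,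
        ∑ y ∈ levelSet Y f k, w y := by
    intro E _ w hw
    rw [← Finset.sum_filter_of_ne (p := fun y => f y ≠ 0)
      fun y hy hne h0 => hne (hw y hy h0)]
    exact (Finset.sum_fiberwise_of_maps_to (fun y hy => Finset.mem_image_of_mem _ hy) _).symm
  refine ⟨_, key, ?_⟩
  rw [key (fun y => ‖f y‖ ^ 2) fun y _ h0 => by simp [h0]]
  refine Finset.sum_le_sum fun k _ => ?_
  rw [mul_comm, ← nsmul_eq_mul]
  refine Finset.card_nsmul_le_sum _ _ _ fun y hy => ?_
  have h2 : (4 : ℝ) ^ k = (2 ^ k) ^ 2 := by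
    rw [← zpow_natCast, ← zpow_mul, mul_comm, zpow_mul]; norm_num
  rw [h2]
  exact pow_le_pow_left₀ (by positivity) (zpow_le_norm_of_mem_levelSet hy) 2

variable {N : ℤ → ℝ} {S : ℕ}

/-- The normalised restriction of `h` to a level set. -/
noncomputable def levelFun (X : Finset ℤ) (h : ℤ → ℂ) (l : ℤ) (x : ℤ) : ℂ :=
  if x ∈ levelSet X h l then h x / (2 : ℂ) ^ (l + 1) else 0

lemma norm_levelFun_le (X : Finset ℤ) (h : ℤ → ℂ) (l x : ℤ) : ‖levelFun X h l x‖ ≤ 1 := by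
  unfold levelFun
  split_ifs with hx
  · rw [norm_div, norm_zpow, Complex.norm_two]
    exact div_le_one_of_le₀ (norm_le_zpow_of_mem_levelSet hx) (by positivity)
  · simp

lemma vop_levelSet (N : ℤ → ℝ) (X : Finset ℤ) (h : ℤ → ℂ) (l : ℤ) (a b : ℤ → ℕ) (y : ℤ) :
    ∑ x ∈ levelSet X h l, h x * kerN N (a x) (b x) x y =
      (2 : ℂ) ^ (l + 1) * vop N (levelSet X h l) (levelFun X h l) a b y := by
  rw [vop, Finset.mul_sum]
  refine Finset.sum_congr rfl fun x hx => ?_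
  rw [levelFun, if_pos hx, ← mul_assoc, mul_div_cancel₀ _ (zpow_ne_zero _ two_ne_zero)]

lemma sum_norm_mul_vop_le (hN : ∀ x, N x ∈ Set.Icc (0 : ℝ) 1) {r : ℝ} (hr : 0 ≤ r)
    (hr32 : r ^ 32 = 1 / 4) (Y X : Finset ℤ) (f h : ℤ → ℂ) (S : ℕ) :
    ∑ y ∈ Y, ‖f y‖ * ‖vop N X h (fun _ => 0) (fun _ => S) y‖ ≤
      4 * 10 ^ 17 * (2 / (1 - r)) * (∑ y ∈ Y, ‖f y‖ ^ 2 + ∑ x ∈ X, ‖h x‖ ^ 2) := by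
  have hr1 : r < 1 := by
    by_contra! hcon
    have := one_le_pow₀ (n := 32) hcon
    rw [hr32] at this
    norm_num at this
  obtain ⟨K, hK, hKs⟩ := exists_sum_levelSet Y f
  obtain ⟨L, hL, hLs⟩ := exists_sum_levelSet X h
  set v : ℤ → ℤ → ℂ := fun l y =>
    vop N (levelSet X h l) (levelFun X h l) (fun _ => 0) (fun _ => S) y with hv
  have h1 : ∀ y, ‖vop N X h (fun _ => 0) (fun _ => S) y‖ ≤ ∑ l ∈ L, 2 ^ (l + 1) * ‖v l y‖ := by
    intro y
    rw [vop, hL _ fun x _ h0 => by rw [h0, zero_mul]]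
    refine (norm_sum_le _ _).trans (le_of_eq (Finset.sum_congr rfl fun l _ => ?_))
    rw [vop_levelSet, norm_mul, norm_zpow, Complex.norm_two]
  have h2 : ∀ k l, ∑ y ∈ levelSet Y f k, ‖f y‖ * (2 ^ (l + 1) * ‖v l y‖) ≤
      4 * 10 ^ 17 * (r ^ (k - l).natAbs *
        (4 ^ k * (levelSet Y f k).card + 4 ^ l * (levelSet X h l).card)) := by
    intro k l
    obtain ⟨b1, b2⟩ := sum_norm_vop_le_mixed_both hN (levelSet Y f k) (levelSet X h l) S
      (norm_levelFun_le X h l)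
    have hp : (0 : ℝ) < 10 ^ 17 := by positivity
    rw [← div_le_iff₀' hp] at b1 b2
    have b3 := zpow_mul_min_mixed_le hr hr32 (Nat.cast_nonneg _) (Nat.cast_nonneg _) b1 b2 k l
    calc ∑ y ∈ levelSet Y f k, ‖f y‖ * (2 ^ (l + 1) * ‖v l y‖)
        ≤ ∑ y ∈ levelSet Y f k, 2 ^ (k + 1) * (2 ^ (l + 1) * ‖v l y‖) :=
          Finset.sum_le_sum fun y hy => mul_le_mul_of_nonneg_right
            (norm_le_zpow_of_mem_levelSet hy) (by positivity)
      _ = 4 * 10 ^ 17 * (2 ^ k * 2 ^ l * ((∑ y ∈ levelSet Y f k, ‖v l y‖) / 10 ^ 17)) := by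
          rw [← Finset.mul_sum, ← Finset.mul_sum, zpow_add_one₀ two_ne_zero,
            zpow_add_one₀ two_ne_zero]
          ring
      _ ≤ _ := mul_le_mul_of_nonneg_left b3 (by positivity)
  calc ∑ y ∈ Y, ‖f y‖ * ‖vop N X h (fun _ => 0) (fun _ => S) y‖
      ≤ ∑ y ∈ Y, ∑ l ∈ L, ‖f y‖ * (2 ^ (l + 1) * ‖v l y‖) := by
        refine Finset.sum_le_sum fun y _ => ?_
        rw [← Finset.mul_sum]
        exact mul_le_mul_of_nonneg_left (h1 y) (norm_nonneg _)
    _ = ∑ k ∈ K, ∑ l ∈ L, ∑ y ∈ levelSet Y f k, ‖f y‖ * (2 ^ (l + 1) * ‖v l y‖) := by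
        rw [hK _ fun y _ h0 => by simp [h0]]
        exact Finset.sum_congr rfl fun k _ => Finset.sum_comm
    _ ≤ ∑ k ∈ K, ∑ l ∈ L, 4 * 10 ^ 17 * (r ^ (k - l).natAbs *
        (4 ^ k * (levelSet Y f k).card + 4 ^ l * (levelSet X h l).card)) :=
        Finset.sum_le_sum fun k _ => Finset.sum_le_sum fun l _ => h2 k l
    _ = 4 * 10 ^ 17 * (∑ k ∈ K, ((4 : ℝ) ^ k * (levelSet Y f k).card) * ∑ l ∈ L, r ^ (k - l).natAbs +
        ∑ l ∈ L, ((4 : ℝ) ^ l * (levelSet X h l).card) * ∑ k ∈ K, r ^ (l - k).natAbs) := by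
        simp only [mul_add, Finset.sum_add_distrib, ← Finset.mul_sum]
        congr 2
        · exact Finset.sum_congr rfl fun k _ => by rw [← Finset.sum_mul, mul_comm]
        · rw [Finset.sum_comm]
          refine Finset.sum_congr rfl fun l _ => ?_
          rw [← Finset.sum_mul, mul_comm]
          refine congrArg _ (Finset.sum_congr rfl fun k _ => ?_)
          rw [← Int.natAbs_neg, neg_sub]
    _ ≤ 4 * 10 ^ 17 * ((∑ k ∈ K, (4 : ℝ) ^ k * (levelSet Y f k).card) * (2 / (1 - r)) +
        (∑ l ∈ L, (4 : ℝ) ^ l * (levelSet X h l).card) * (2 / (1 - r))) := by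
        simp only [Finset.sum_mul]
        gcongr <;> exact sum_pow_natAbs_le hr hr1 _ _
    _ = 4 * 10 ^ 17 * (2 / (1 - r)) * (∑ k ∈ K, (4 : ℝ) ^ k * (levelSet Y f k).card +
        ∑ l ∈ L, (4 : ℝ) ^ l * (levelSet X h l).card) := by ring
    _ ≤ _ := by
        have : 0 < 1 - r := by linarith
        gcongr

lemma exists_sum_sq_vop_le : ∃ C : ℝ, 0 < C ∧ ∀ N : ℤ → ℝ, (∀ x, N x ∈ Set.Icc (0 : ℝ) 1) →
    ∀ (Y X : Finset ℤ) (h : ℤ → ℂ) (S : ℕ),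
    ∑ y ∈ Y, ‖vop N X h (fun _ => 0) (fun _ => S) y‖ ^ 2 ≤ C * ∑ x ∈ X, ‖h x‖ ^ 2 := by
  obtain ⟨r, hr, hr32⟩ : ∃ r : ℝ, 0 ≤ r ∧ r ^ 32 = 1 / 4 :=
    ⟨(1 / 4 : ℝ) ^ ((1 : ℝ) / 32), by positivity, by
      rw [← Real.rpow_mul_natCast (by norm_num)]; norm_num⟩
  have hr1 : r < 1 := by
    by_contra! hcon
    have := one_le_pow₀ (n := 32) hcon
    rw [hr32] at this
    norm_num at this
  set B : ℝ := 4 * 10 ^ 17 * (2 / (1 - r)) with hB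
  have hB0 : 0 < B := by
    have : 0 < 1 - r := by linarith
    positivity
  refine ⟨4 * B ^ 2, by positivity, fun N hN Y X h S => ?_⟩
  set v : ℤ → ℂ := fun y => vop N X h (fun _ => 0) (fun _ => S) y
  set V := ∑ y ∈ Y, ‖v y‖ ^ 2 with hV
  set H := ∑ x ∈ X, ‖h x‖ ^ 2
  set c : ℝ := 1 / (2 * B) with hc
  have hc0 : 0 < c := by positivity
  have hcv : ∀ y, ‖(c : ℂ) * v y‖ = c * ‖v y‖ := fun y => by
    rw [norm_mul, Complex.norm_real, Real.norm_of_nonneg hc0.le]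
  have h1 := sum_norm_mul_vop_le hN hr hr32 Y X (fun y => (c : ℂ) * v y) h S
  have e1 : ∑ y ∈ Y, ‖(c : ℂ) * v y‖ * ‖v y‖ = c * V := by
    rw [hV, Finset.mul_sum]; exact Finset.sum_congr rfl fun y _ => by rw [hcv]; ring
  have e2 : ∑ y ∈ Y, ‖(c : ℂ) * v y‖ ^ 2 = c ^ 2 * V := by
    rw [hV, Finset.mul_sum]; exact Finset.sum_congr rfl fun y _ => by rw [hcv]; ring
  rw [e1, e2, ← hB, hc] at h1
  have h2 : 1 / (2 * B) * V ≤ 1 / (4 * B) * V + B * H := by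
    refine h1.trans (le_of_eq ?_); field_simp; ring
  have h3 : 1 / (2 * B) * V - 1 / (4 * B) * V = V / (4 * B) := by field_simp; ring
  have h4 : V / (4 * B) ≤ B * H := by linarith
  rw [div_le_iff₀ (by positivity)] at h4
  linarith
end

/-! ### Duality and Parseval -/

/-- A trigonometric polynomial whose frequency `n` is cut off to the interval `(0, x n]`. -/
noncomputable def cutPoly (x : ℤ → ℝ) (X : Finset ℤ) (h : ℤ → ℂ) (t : ℝ) : ℂ :=
  ∑ n ∈ X, h n * (Set.Ioc 0 (x n)).indicator (fun t => ee (n * t)) t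

lemma measurable_ee : Measurable ee := by unfold ee; fun_prop

lemma measurable_cutPoly (x : ℤ → ℝ) (X : Finset ℤ) (h : ℤ → ℂ) :
    Measurable (cutPoly x X h) := by
  unfold cutPoly
  refine Finset.measurable_sum _ fun n _ => Measurable.const_mul ?_ _
  exact (measurable_ee.comp (by fun_prop)).indicator measurableSet_Ioc

lemma norm_cutPoly_le (x : ℤ → ℝ) (X : Finset ℤ) (h : ℤ → ℂ) (t : ℝ) :
    ‖cutPoly x X h t‖ ≤ ∑ n ∈ X, ‖h n‖ := by
  refine norm_sum_le_of_le _ fun n _ => ?_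
  rw [norm_mul]
  refine mul_le_of_le_one_right (norm_nonneg _) ?_
  refine (norm_indicator_le_norm_self _ _).trans ?_
  rw [norm_ee]

lemma integral_mul_indicator_Ioc {F : ℝ → ℂ} {x b : ℝ} (hx : 0 ≤ x) (hxb : x ≤ b) :
    ∫ t in (0:ℝ)..b, (Set.Ioc 0 x).indicator F t = ∫ t in (0:ℝ)..x, F t := by
  rw [intervalIntegral.integral_of_le (hx.trans hxb), intervalIntegral.integral_of_le hx,
    setIntegral_indicator measurableSet_Ioc, Set.Ioc_inter_Ioc, max_self, min_eq_right hxb]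

lemma integral_ee_int_mul {k : ℤ} (hk : k ≠ 0) (x : ℝ) :
    ∫ t in (0:ℝ)..x, ee (k * t) = (ee (k * x) - 1) / (Complex.I * k) := by
  have hk' : (k : ℂ) ≠ 0 := by exact_mod_cast hk
  have h := integral_exp_mul_complex (a := 0) (b := x) (c := k * Complex.I)
    (mul_ne_zero hk' Complex.I_ne_zero)
  simp only [Complex.ofReal_zero, mul_zero, Complex.exp_zero] at h
  unfold ee
  push_cast
  rw [mul_comm Complex.I, mul_right_comm (k : ℂ) (x : ℂ), ← h]
  refine intervalIntegral.integral_congr fun t _ => ?_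
  ring_nf

lemma integral_cutPoly_mul_ee {x : ℤ → ℝ} (hx : ∀ n, x n ∈ Set.Icc (0:ℝ) 1) (X : Finset ℤ)
    (h : ℤ → ℂ) {b : ℝ} (hb : 1 ≤ b) {S : ℕ} {m : ℤ}
    (hS : ∀ n ∈ X, 2 * |((n - m : ℤ) : ℝ)| ≤ 2 ^ S) :
    ∫ t in (0:ℝ)..b, cutPoly x X h t * ee (-(m * t)) =
      1 / Complex.I * (vop x X (fun n => h n * ee (n * x n)) (fun _ => 0) (fun _ => S) m
        - vop (fun _ => 0) X h (fun _ => 0) (fun _ => S) m)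
        + if m ∈ X then (x m : ℂ) * h m else 0 := by
  have e1 : ∀ t, cutPoly x X h t * ee (-(m * t)) =
      ∑ n ∈ X, h n * (Set.Ioc 0 (x n)).indicator (fun t => ee ((n - m : ℤ) * t)) t := by
    intro t
    unfold cutPoly
    rw [Finset.sum_mul]
    refine Finset.sum_congr rfl fun n _ => ?_
    rw [mul_assoc]
    congr 1
    by_cases ht : t ∈ Set.Ioc 0 (x n)
    · simp only [Set.indicator_of_mem ht]
      rw [← ee_add]; congr 1; push_cast; ring
    · simp [Set.indicator_of_notMem ht]
  have hint : ∀ n, IntervalIntegrable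
      ((Set.Ioc 0 (x n)).indicator (fun t => ee ((n - m : ℤ) * t))) volume 0 b := by
    intro n
    have : IntervalIntegrable (fun t => ee ((n - m : ℤ) * t)) volume 0 b :=
      (continuous_ee.comp (by fun_prop)).intervalIntegrable _ _
    rw [intervalIntegrable_iff] at this ⊢
    exact this.indicator measurableSet_Ioc
  simp_rw [e1]
  rw [intervalIntegral.integral_finsetSum fun n _ => (hint n).const_mul _]
  simp_rw [intervalIntegral.integral_const_mul]
  unfold vop
  rw [← Finset.sum_sub_distrib, Finset.mul_sum]
  have e2 : (if m ∈ X then (x m : ℂ) * h m else 0)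
      = ∑ n ∈ X, if n = m then (x m : ℂ) * h m else 0 := by
    rw [Finset.sum_ite_eq']
  rw [e2, ← Finset.sum_add_distrib]
  refine Finset.sum_congr rfl fun n hn => ?_
  rw [integral_mul_indicator_Ioc (hx n).1 ((hx n).2.trans hb)]
  unfold kerN
  rw [kerR_zero_left, kerR_eq_inv (hS n hn)]
  by_cases hnm : n = m
  · subst hnm
    simp [ee_zero, mul_comm]
  · have hk : n - m ≠ 0 := sub_ne_zero.2 hnm
    have hk' : ((n - m : ℤ) : ℂ) ≠ 0 := by exact_mod_cast hk
    rw [integral_ee_int_mul hk, if_neg hnm]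
    have e3 : ee (((n - m : ℤ) : ℝ) * x n) = ee (n * x n) * ee (-(x n * m)) := by
      rw [← ee_add]; congr 1; push_cast; ring
    rw [e3]
    have e4 : ee (-(0 * (m : ℝ))) = 1 := by simp [ee_zero]
    rw [e4]
    push_cast at hk' ⊢
    field_simp
    ring

lemma fourierCoeffOn_eq_integral_ee (f : ℝ → ℂ) (m : ℤ) :
    fourierCoeffOn Real.two_pi_pos f m =
      (1 / (2 * Real.pi)) • ∫ t in (0:ℝ)..(2 * Real.pi), f t * ee (-(m * t)) := by
  rw [fourierCoeffOn_eq_integral]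
  have hpi : (Real.pi : ℂ) ≠ 0 := by exact_mod_cast Real.pi_ne_zero
  congr 1
  · simp
  · refine intervalIntegral.integral_congr fun t _ => ?_
    simp only [fourier_coe_apply, smul_eq_mul]
    rw [mul_comm]
    congr 1
    unfold ee
    congr 1
    push_cast
    field_simp
    ring

lemma norm_add_add_sq_le (a b c : ℂ) :
    ‖a - b + c‖ ^ 2 ≤ 3 * (‖a‖ ^ 2 + ‖b‖ ^ 2 + ‖c‖ ^ 2) := by
  have h : ‖a - b + c‖ ≤ ‖a‖ + ‖b‖ + ‖c‖ :=
    (norm_add_le _ _).trans (by gcongr; exact norm_sub_le _ _)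
  have := pow_le_pow_left₀ (norm_nonneg _) h 2
  nlinarith [sq_nonneg (‖a‖ - ‖b‖), sq_nonneg (‖a‖ - ‖c‖), sq_nonneg (‖b‖ - ‖c‖)]

lemma exists_integral_cutPoly_sq_le :
    ∃ C : ℝ, 0 < C ∧ ∀ x : ℤ → ℝ, (∀ n, x n ∈ Set.Icc (0:ℝ) 1) → ∀ (X : Finset ℤ) (h : ℤ → ℂ),
      ∫ t in (0:ℝ)..(2 * Real.pi), ‖cutPoly x X h t‖ ^ 2 ≤ C * ∑ n ∈ X, ‖h n‖ ^ 2 := by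
  obtain ⟨C, hC, hv⟩ := exists_sum_sq_vop_le
  refine ⟨2 * Real.pi * (3 * (2 * C + 1)), by positivity, fun x hx X h => ?_⟩
  have hpi1 : 1 ≤ 2 * Real.pi := by linarith [Real.pi_gt_three]
  set H := ∑ n ∈ X, ‖h n‖ ^ 2 with hH
  have hmem : MemLp (cutPoly x X h) 2 (volume.restrict (Set.Ioc 0 (2 * Real.pi))) :=
    MemLp.of_bound (measurable_cutPoly x X h).aestronglyMeasurable (∑ n ∈ X, ‖h n‖)
      (Filter.Eventually.of_forall (norm_cutPoly_le x X h))
  have hs := hasSum_sq_fourierCoeffOn Real.two_pi_pos hmem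
  have key : ∀ Y : Finset ℤ, ∑ m ∈ Y, ‖fourierCoeffOn Real.two_pi_pos (cutPoly x X h) m‖ ^ 2
      ≤ 3 * (2 * C + 1) * H := by
    intro Y
    obtain ⟨S, hS⟩ : ∃ S : ℕ, ∀ m ∈ Y, ∀ n ∈ X, 2 * |((n - m : ℤ) : ℝ)| ≤ 2 ^ S := by
      obtain ⟨S, hS⟩ := pow_unbounded_of_one_lt
        (∑ m ∈ Y, ∑ n ∈ X, 2 * |((n - m : ℤ) : ℝ)|) (one_lt_two)
      refine ⟨S, fun m hm n hn => le_trans ?_ hS.le⟩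
      refine (Finset.single_le_sum (f := fun n : ℤ => 2 * |((n - m : ℤ) : ℝ)|)
        (fun _ _ => by positivity) hn).trans ?_
      exact Finset.single_le_sum (f := fun m : ℤ => ∑ n ∈ X, 2 * |((n - m : ℤ) : ℝ)|)
        (fun _ _ => Finset.sum_nonneg fun _ _ => by positivity) hm
    have h1 := hv x hx Y X (fun n => h n * ee (n * x n)) S
    have h2 := hv (fun _ => 0) (fun _ => by simp) Y X h S
    simp only [norm_mul, norm_ee, mul_one] at h1
    have h3 : ∑ m ∈ Y, ‖if m ∈ X then (x m : ℂ) * h m else 0‖ ^ 2 ≤ H := by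
      calc _ ≤ ∑ m ∈ Y, if m ∈ X then ‖h m‖ ^ 2 else 0 := by
            refine Finset.sum_le_sum fun m _ => ?_
            split_ifs
            · rw [norm_mul, Complex.norm_real, Real.norm_of_nonneg (hx m).1]
              exact pow_le_pow_left₀ (mul_nonneg (hx m).1 (norm_nonneg _))
                (mul_le_of_le_one_left (norm_nonneg _) (hx m).2) 2
            · simp
        _ = ∑ m ∈ Y ∩ X, ‖h m‖ ^ 2 := by rw [Finset.sum_ite_mem]
        _ ≤ H := Finset.sum_le_sum_of_subset_of_nonneg Finset.inter_subset_right
            fun _ _ _ => by positivity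
    have h4 : ∀ m ∈ Y, ‖fourierCoeffOn Real.two_pi_pos (cutPoly x X h) m‖ ^ 2 ≤
        3 * (‖vop x X (fun n => h n * ee (n * x n)) (fun _ => 0) (fun _ => S) m‖ ^ 2
          + ‖vop (fun _ => 0) X h (fun _ => 0) (fun _ => S) m‖ ^ 2
          + ‖if m ∈ X then (x m : ℂ) * h m else 0‖ ^ 2) := by
      intro m hm
      rw [fourierCoeffOn_eq_integral_ee, integral_cutPoly_mul_ee hx X h hpi1 (hS m hm), norm_smul,
        Real.norm_of_nonneg (by positivity), mul_sub]
      have hle : 1 / (2 * Real.pi) ≤ 1 := by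
        rw [div_le_one (by positivity)]; exact hpi1
      refine (pow_le_pow_left₀ (by positivity)
        (mul_le_of_le_one_left (norm_nonneg _) hle) 2).trans ?_
      refine (norm_add_add_sq_le _ _ _).trans ?_
      simp
    refine (Finset.sum_le_sum h4).trans ?_
    rw [← Finset.mul_sum, Finset.sum_add_distrib, Finset.sum_add_distrib]
    linarith
  have hle := hasSum_le_of_sum_le hs key
  rw [smul_eq_mul, sub_zero, inv_mul_le_iff₀ Real.two_pi_pos] at hle
  linarith

/-- The linearized maximal Fourier coefficient. -/
noncomputable def cutCoeff (g : ℝ → ℂ) (x : ℤ → ℝ) (n : ℤ) : ℂ :=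
  ∫ t in (0:ℝ)..(x n), g t * ee (n * t)

/-- The maximal Bessel inequality: the linearized maximal operator is bounded from `L²[0,1]`
to `ℓ²`. -/
lemma exists_sum_sq_cutCoeff_le :
    ∃ C : ℝ, 0 < C ∧ ∀ x : ℤ → ℝ, (∀ n, x n ∈ Set.Icc (0:ℝ) 1) → ∀ g : ℝ → ℂ, Measurable g →
      IntervalIntegrable (fun t => ‖g t‖ ^ 2) volume 0 1 → ∀ X : Finset ℤ,
      ∑ n ∈ X, ‖cutCoeff g x n‖ ^ 2 ≤ C * ∫ t in (0:ℝ)..1, ‖g t‖ ^ 2 := by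
  obtain ⟨C, hC, hP⟩ := exists_integral_cutPoly_sq_le
  refine ⟨C, hC, fun x hx g hgm hg2 X => ?_⟩
  have hg : IntervalIntegrable g volume 0 1 := by
    rw [intervalIntegrable_iff] at hg2 ⊢
    have : IsFiniteMeasure (volume.restrict (Set.uIoc (0:ℝ) 1)) :=
      ⟨by simp⟩
    have : MemLp g 2 (volume.restrict (Set.uIoc 0 1)) := by
      rw [memLp_two_iff_integrable_sq_norm hgm.aestronglyMeasurable]
      exact hg2
    exact this.integrable (by norm_num)
  set h : ℤ → ℂ := fun n => (starRingEnd ℂ) (cutCoeff g x n) with hh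
  set V := ∑ n ∈ X, ‖cutCoeff g x n‖ ^ 2 with hV
  set G := ∫ t in (0:ℝ)..1, ‖g t‖ ^ 2 with hG
  have hmul : ∀ F : ℝ → ℂ, Measurable F → ∀ B : ℝ, (∀ t, ‖F t‖ ≤ B) →
      IntervalIntegrable (fun t => g t * F t) volume 0 1 := by
    intro F hF B hB
    rw [intervalIntegrable_iff] at hg ⊢
    exact hg.mul_bdd (c := B) hF.aestronglyMeasurable (Filter.Eventually.of_forall hB)
  have e1 : ((V : ℝ) : ℂ) = ∫ t in (0:ℝ)..1, g t * cutPoly x X h t := by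
    have e2 : ∀ t, g t * cutPoly x X h t =
        ∑ n ∈ X, h n * (g t * (Set.Ioc 0 (x n)).indicator (fun t => ee (n * t)) t) := by
      intro t; unfold cutPoly; rw [Finset.mul_sum]
      exact Finset.sum_congr rfl fun n _ => by ring
    simp_rw [e2]
    rw [intervalIntegral.integral_finsetSum]
    · rw [hV]
      push_cast
      refine Finset.sum_congr rfl fun n _ => ?_
      rw [intervalIntegral.integral_const_mul]
      have e3 : ∀ t, g t * (Set.Ioc 0 (x n)).indicator (fun t => ee (n * t)) t =
          (Set.Ioc 0 (x n)).indicator (fun t => g t * ee (n * t)) t := by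
        intro t
        by_cases ht : t ∈ Set.Ioc 0 (x n)
        · simp [Set.indicator_of_mem ht]
        · simp [Set.indicator_of_notMem ht]
      simp_rw [e3]
      rw [integral_mul_indicator_Ioc (hx n).1 (hx n).2]
      change _ = h n * cutCoeff g x n
      rw [hh]
      simp only
      rw [mul_comm, Complex.mul_conj, Complex.normSq_eq_norm_sq]
      push_cast; rfl
    · intro n _
      refine (hmul _ ((measurable_ee.comp (by fun_prop)).indicator measurableSet_Ioc) 1
        fun t => ?_).const_mul _
      exact (norm_indicator_le_norm_self _ _).trans (norm_ee _).le
  have hPi : IntervalIntegrable (fun t => ‖cutPoly x X h t‖ ^ 2) volume 0 (2 * Real.pi) := by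
    rw [intervalIntegrable_iff]
    refine Measure.integrableOn_of_bounded (M := (∑ n ∈ X, ‖h n‖) ^ 2)
      (by rw [Set.uIoc_of_le Real.two_pi_pos.le]; exact measure_Ioc_lt_top.ne)
      ((measurable_cutPoly x X h).norm.pow_const 2).aestronglyMeasurable
      (Filter.Eventually.of_forall fun t => ?_)
    rw [Real.norm_of_nonneg (by positivity)]
    exact pow_le_pow_left₀ (norm_nonneg _) (norm_cutPoly_le x X h t) 2
  have hpi1 : 1 ≤ 2 * Real.pi := by linarith [Real.pi_gt_three]
  have hPi1 : IntervalIntegrable (fun t => ‖cutPoly x X h t‖ ^ 2) volume 0 1 :=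
    hPi.mono_set (by
      rw [Set.uIcc_of_le (by norm_num), Set.uIcc_of_le (by linarith)]
      exact Set.Icc_subset_Icc_right hpi1)
  have hP1 : ∫ t in (0:ℝ)..1, ‖cutPoly x X h t‖ ^ 2 ≤ C * V := by
    have h1 := hP x hx X h
    have h2 : ∑ n ∈ X, ‖h n‖ ^ 2 = V := by simp [hh, hV]
    rw [h2] at h1
    refine le_trans ?_ h1
    refine intervalIntegral.integral_mono_interval le_rfl zero_le_one hpi1
      (Filter.Eventually.of_forall fun t => by positivity) hPi
  have hVle : V ≤ ∫ t in (0:ℝ)..1, (C * ‖g t‖ ^ 2 + C⁻¹ * ‖cutPoly x X h t‖ ^ 2) / 2 := by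
    have hV0 : 0 ≤ V := Finset.sum_nonneg fun _ _ => by positivity
    have h1 : V = ‖∫ t in (0:ℝ)..1, g t * cutPoly x X h t‖ := by
      rw [← e1, Complex.norm_real, Real.norm_of_nonneg hV0]
    rw [h1]
    refine intervalIntegral.norm_integral_le_of_norm_le zero_le_one ?_ ?_
    · refine Filter.Eventually.of_forall fun t _ => ?_
      rw [norm_mul]
      have h2 := sq_nonneg (C * ‖g t‖ - ‖cutPoly x X h t‖)
      have h3 : 0 ≤ C⁻¹ * (C * ‖g t‖ - ‖cutPoly x X h t‖) ^ 2 := by positivity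
      have h4 : C⁻¹ * (C * ‖g t‖ - ‖cutPoly x X h t‖) ^ 2 =
          C * ‖g t‖ ^ 2 + C⁻¹ * ‖cutPoly x X h t‖ ^ 2 - 2 * (‖g t‖ * ‖cutPoly x X h t‖) := by
        field_simp; ring
      linarith
    · exact ((hg2.const_mul C).add (hPi1.const_mul C⁻¹)).div_const 2
  rw [intervalIntegral.integral_div, intervalIntegral.integral_add (hg2.const_mul C)
    (hPi1.const_mul C⁻¹), intervalIntegral.integral_const_mul,
    intervalIntegral.integral_const_mul, ← hG] at hVle
  have h5 : C⁻¹ * ∫ t in (0:ℝ)..1, ‖cutPoly x X h t‖ ^ 2 ≤ V := by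
    rw [inv_mul_le_iff₀ hC]; exact hP1
  linarith

/-! ### Interpolation -/

lemma sum_two_zpow_le_of_le (K : Finset ℤ) :
    ∀ m : ℤ, (∀ k ∈ K, k ≤ m) → ∑ k ∈ K, (2:ℝ) ^ k ≤ 2 ^ (m + 1) := by
  induction K using Finset.induction_on_max with
  | empty => intro m _; simp only [Finset.sum_empty]; positivity
  | insert a s ha ih =>
    intro m hm
    rw [Finset.sum_insert fun h => lt_irrefl _ (ha a h)]
    have h1 := ih (a - 1) fun k hk => by have := ha k hk; omega
    rw [sub_add_cancel] at h1
    have h2 : (2:ℝ) ^ (a + 1) ≤ 2 ^ (m + 1) :=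
      zpow_le_zpow_right₀ one_le_two (by have := hm a (Finset.mem_insert_self _ _); omega)
    rw [zpow_add_one₀ two_ne_zero] at h2
    linarith

lemma sum_two_zpow_mul_le (K : Finset ℤ) {a D : ℝ} (ha : 0 ≤ a) (hD : 0 ≤ D) :
    ∑ k ∈ K with (2:ℝ) ^ k * a ≤ D, (2:ℝ) ^ k * a ≤ 2 * D := by
  set K' := K.filter fun k => (2:ℝ) ^ k * a ≤ D with hK'
  rcases K'.eq_empty_or_nonempty with h | h
  · rw [h]; simp [hD]
  · have h1 := sum_two_zpow_le_of_le K' (K'.max' h) fun k hk => K'.le_max' k hk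
    have h2 : (2:ℝ) ^ (K'.max' h) * a ≤ D := (Finset.mem_filter.1 (K'.max'_mem h)).2
    rw [zpow_add_one₀ two_ne_zero] at h1
    rw [← Finset.sum_mul]
    nlinarith [mul_le_mul_of_nonneg_right h1 ha]

lemma intervalIntegrable_of_rpow {p : ℝ} (hp : 1 ≤ p) {g : ℝ → ℂ} (hg : Measurable g)
    (hgp : IntervalIntegrable (fun t => ‖g t‖ ^ p) volume 0 1) :
    IntervalIntegrable g volume 0 1 := by
  refine (intervalIntegrable_const.add hgp).mono_fun (f := fun t => (1:ℝ) + ‖g t‖ ^ p)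
    hg.aestronglyMeasurable (Filter.Eventually.of_forall fun t => ?_)
  have h0 : 0 ≤ ‖g t‖ ^ p := by positivity
  simp only
  rw [Real.norm_of_nonneg (by positivity)]
  rcases le_total ‖g t‖ 1 with h | h
  · linarith
  · have := Real.rpow_le_rpow_of_exponent_le h hp
    rw [Real.rpow_one] at this
    linarith

lemma norm_cutCoeff_le {g : ℝ → ℂ} (hg : IntervalIntegrable g volume 0 1) {x : ℤ → ℝ} {n : ℤ}
    (hx : x n ∈ Set.Icc (0:ℝ) 1) : ‖cutCoeff g x n‖ ≤ ∫ t in (0:ℝ)..1, ‖g t‖ := by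
  unfold cutCoeff
  refine (intervalIntegral.norm_integral_le_integral_norm hx.1).trans ?_
  simp only [norm_mul, norm_ee, mul_one]
  exact intervalIntegral.integral_mono_interval le_rfl hx.1 hx.2
    (Filter.Eventually.of_forall fun t => norm_nonneg _) hg.norm

lemma intervalIntegrable_mul_ee {g : ℝ → ℂ} (hg : IntervalIntegrable g volume 0 1) {x c : ℝ}
    (hx : x ∈ Set.Icc (0:ℝ) 1) : IntervalIntegrable (fun t => g t * ee (c * t)) volume 0 x := by
  have h1 : IntervalIntegrable g volume 0 x := hg.mono_set (by
    rw [Set.uIcc_of_le zero_le_one, Set.uIcc_of_le hx.1]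
    exact Set.Icc_subset_Icc_right hx.2)
  exact h1.mul_continuousOn (continuous_ee.comp (by fun_prop)).continuousOn

lemma cutCoeff_add {f g : ℝ → ℂ} (hf : IntervalIntegrable f volume 0 1)
    (hg : IntervalIntegrable g volume 0 1) {x : ℤ → ℝ} {n : ℤ} (hx : x n ∈ Set.Icc (0:ℝ) 1) :
    cutCoeff (fun t => f t + g t) x n = cutCoeff f x n + cutCoeff g x n := by
  unfold cutCoeff
  rw [← intervalIntegral.integral_add (intervalIntegrable_mul_ee hf hx)
    (intervalIntegrable_mul_ee hg hx)]
  simp_rw [add_mul]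

lemma IntervalIntegrable.indicator_of_measurableSet {f : ℝ → ℂ} {a b : ℝ}
    (hf : IntervalIntegrable f volume a b) {s : Set ℝ} (hs : MeasurableSet s) :
    IntervalIntegrable (s.indicator f) volume a b := by
  rw [intervalIntegrable_iff] at hf ⊢
  exact hf.indicator hs

/-- The truncation of `g` at the level `‖g‖ ^ (2 - p) ≤ M`. -/
noncomputable def lowPart (p : ℝ) (g : ℝ → ℂ) (M : ℝ) : ℝ → ℂ :=
  {t | ‖g t‖ ^ (2 - p) ≤ M}.indicator g

lemma measurableSet_rpow_le {p M : ℝ} {g : ℝ → ℂ} (hg : Measurable g) :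
    MeasurableSet {t | ‖g t‖ ^ (2 - p) ≤ M} :=
  measurableSet_le (hg.norm.pow_const _) measurable_const

lemma rpow_mul_rpow_two_sub {p : ℝ} (hp1 : 1 < p) (hp2 : p < 2) {a : ℝ} (ha : 0 ≤ a) :
    a ^ p * a ^ (2 - p) = a ^ 2 := by
  rw [← Real.rpow_add_of_nonneg ha (by linarith) (by linarith)]
  norm_num

lemma norm_lowPart_sq_le {p M : ℝ} (hp1 : 1 < p) (hp2 : p < 2) (hM : 0 ≤ M) (g : ℝ → ℂ) (t : ℝ) :
    ‖lowPart p g M t‖ ^ 2 ≤ M * ‖g t‖ ^ p := by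
  unfold lowPart
  by_cases ht : t ∈ {t | ‖g t‖ ^ (2 - p) ≤ M}
  · rw [Set.indicator_of_mem ht, ← rpow_mul_rpow_two_sub hp1 hp2 (norm_nonneg _), mul_comm]
    exact mul_le_mul_of_nonneg_right ht (by positivity)
  · rw [Set.indicator_of_notMem ht, norm_zero, zero_pow two_ne_zero]; positivity

lemma intervalIntegrable_lowPart_sq {p M : ℝ} (hp1 : 1 < p) (hp2 : p < 2) (hM : 0 ≤ M) {g : ℝ → ℂ}
    (hg : Measurable g) (hgp : IntervalIntegrable (fun t => ‖g t‖ ^ p) volume 0 1) :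
    IntervalIntegrable (fun t => ‖lowPart p g M t‖ ^ 2) volume 0 1 := by
  refine (hgp.const_mul M).mono_fun
    ((hg.indicator (measurableSet_rpow_le hg)).norm.pow_const 2).aestronglyMeasurable
    (Filter.Eventually.of_forall fun t => ?_)
  simp only
  rw [Real.norm_of_nonneg (by positivity), Real.norm_of_nonneg (by positivity)]
  exact norm_lowPart_sq_le hp1 hp2 hM g t

lemma integral_norm_compl_lowPart_le {p l A : ℝ} (hp1 : 1 < p) (hp2 : p < 2) (hl : 0 < l)
    (hA : 0 < A) {g : ℝ → ℂ} (hg : Measurable g)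
    (hgp : IntervalIntegrable (fun t => ‖g t‖ ^ p) volume 0 1)
    (hgA : ∫ t in (0:ℝ)..1, ‖g t‖ ^ p = A) {M : ℝ}
    (hM : M = (2 * A / l) ^ ((2 - p) / (p - 1))) :
    ∫ t in (0:ℝ)..1, ‖{t | ‖g t‖ ^ (2 - p) ≤ M}ᶜ.indicator g t‖ ≤ l / 2 := by
  have hpw : ∀ t, ‖{t | ‖g t‖ ^ (2 - p) ≤ M}ᶜ.indicator g t‖ ≤ l / (2 * A) * ‖g t‖ ^ p := by
    intro t
    by_cases ht : t ∈ {t | ‖g t‖ ^ (2 - p) ≤ M}ᶜ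
    · rw [Set.indicator_of_mem ht]
      have ht' : M < ‖g t‖ ^ (2 - p) := not_le.1 ht
      have h1 : M ^ ((p - 1) / (2 - p)) ≤ (‖g t‖ ^ (2 - p)) ^ ((p - 1) / (2 - p)) :=
        Real.rpow_le_rpow (by rw [hM]; positivity) ht'.le
          (div_nonneg (by linarith) (by linarith))
      have hp' : (2 - p) ≠ 0 := by linarith
      have hp'' : (p - 1) ≠ 0 := by linarith
      rw [hM, ← Real.rpow_mul (by positivity), ← Real.rpow_mul (norm_nonneg _),
        show (2 - p) / (p - 1) * ((p - 1) / (2 - p)) = 1 by field_simp,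
        show (2 - p) * ((p - 1) / (2 - p)) = p - 1 by field_simp, Real.rpow_one] at h1
      have h2 : ‖g t‖ ^ p = ‖g t‖ * ‖g t‖ ^ (p - 1) := by
        conv_rhs => rw [← Real.rpow_one ‖g t‖]
        rw [Real.rpow_one ‖g t‖]
        nth_rw 2 [← Real.rpow_one ‖g t‖]
        rw [← Real.rpow_add_of_nonneg (norm_nonneg _) zero_le_one (by linarith)]
        ring_nf
      rw [h2]
      have h3 : 1 ≤ l / (2 * A) * ‖g t‖ ^ (p - 1) := by
        have := mul_le_mul_of_nonneg_left h1 (show 0 ≤ l / (2 * A) by positivity)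
        rwa [show l / (2 * A) * (2 * A / l) = 1 by field_simp] at this
      nlinarith [mul_le_mul_of_nonneg_left h3 (norm_nonneg (g t))]
    · rw [Set.indicator_of_notMem ht]; simp only [norm_zero]; positivity
  have hgi := intervalIntegrable_of_rpow hp1.le hg hgp
  calc _ ≤ ∫ t in (0:ℝ)..1, l / (2 * A) * ‖g t‖ ^ p :=
        intervalIntegral.integral_mono_on zero_le_one
          (hgi.indicator_of_measurableSet (measurableSet_rpow_le hg).compl).norm
          (hgp.const_mul _) fun t _ => hpw t
    _ = l / 2 := by rw [intervalIntegral.integral_const_mul, hgA]; field_simp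

lemma norm_cutCoeff_le_two_mul_lowPart {p l A : ℝ} (hp1 : 1 < p) (hp2 : p < 2) (hl : 0 < l)
    (hA : 0 < A) {g : ℝ → ℂ} (hg : Measurable g)
    (hgp : IntervalIntegrable (fun t => ‖g t‖ ^ p) volume 0 1)
    (hgA : ∫ t in (0:ℝ)..1, ‖g t‖ ^ p = A) {M : ℝ}
    (hM : M = (2 * A / l) ^ ((2 - p) / (p - 1))) {x : ℤ → ℝ} {n : ℤ}
    (hx : x n ∈ Set.Icc (0:ℝ) 1) (hn : l ≤ ‖cutCoeff g x n‖) :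
    ‖cutCoeff g x n‖ ≤ 2 * ‖cutCoeff (lowPart p g M) x n‖ := by
  have hgi := intervalIntegrable_of_rpow hp1.le hg hgp
  have hs := measurableSet_rpow_le (p := p) (M := M) hg
  have h1 := cutCoeff_add (hgi.indicator_of_measurableSet hs)
    (hgi.indicator_of_measurableSet hs.compl) hx
  have h2 : (fun t => {t | ‖g t‖ ^ (2 - p) ≤ M}.indicator g t
      + {t | ‖g t‖ ^ (2 - p) ≤ M}ᶜ.indicator g t) = g :=
    funext fun t => Set.indicator_self_add_compl_apply _ _ _
  rw [h2] at h1
  have h3 := norm_cutCoeff_le (hgi.indicator_of_measurableSet hs.compl) hx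
  have h4 := integral_norm_compl_lowPart_le hp1 hp2 hl hA hg hgp hgA hM
  have h5 := norm_add_le (cutCoeff (lowPart p g M) x n)
    (cutCoeff ({t | ‖g t‖ ^ (2 - p) ≤ M}ᶜ.indicator g) x n)
  unfold lowPart at h5 ⊢
  rw [← h1] at h5
  linarith

lemma exists_sum_rpow_cutCoeff_le_of_lt {p : ℝ} (hp1 : 1 < p) (hp2 : p < 2) :
    ∃ C : ℝ, 0 < C ∧ ∀ x : ℤ → ℝ, (∀ n, x n ∈ Set.Icc (0:ℝ) 1) → ∀ g : ℝ → ℂ, Measurable g →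
      IntervalIntegrable (fun t => ‖g t‖ ^ p) volume 0 1 → ∀ X : Finset ℤ,
      ∑ n ∈ X, ‖cutCoeff g x n‖ ^ (p / (p - 1)) ≤
        C * (∫ t in (0:ℝ)..1, ‖g t‖ ^ p) ^ (1 / (p - 1)) := by
  obtain ⟨C, hC, h2⟩ := exists_sum_sq_cutCoeff_le
  set θ : ℝ := (2 - p) / (p - 1) with hθ
  have hp' : 0 < p - 1 := by linarith
  have hp'' : 0 < 2 - p := by linarith
  have hθ0 : 0 < θ := by positivity
  have hq : p / (p - 1) = θ + 2 := by rw [hθ]; field_simp; ring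
  have hq1 : 1 / (p - 1) = θ + 1 := by rw [hθ]; field_simp; ring
  refine ⟨16 * C * 2 ^ θ, by positivity, fun x hx g hg hgp X => ?_⟩
  have hgi := intervalIntegrable_of_rpow hp1.le hg hgp
  set A := ∫ t in (0:ℝ)..1, ‖g t‖ ^ p with hA
  have hA0 : 0 ≤ A := intervalIntegral.integral_nonneg zero_le_one fun t _ => by positivity
  rw [hq, hq1]
  rcases hA0.eq_or_lt with hA00 | hA0
  · have hz : ∫ t in (0:ℝ)..1, ‖g t‖ = 0 := by
      rw [hA, intervalIntegral.integral_of_le zero_le_one, eq_comm,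
        setIntegral_eq_zero_iff_of_nonneg_ae
          (Filter.Eventually.of_forall fun t => by positivity)
          ((intervalIntegrable_iff_integrableOn_Ioc_of_le zero_le_one).1 hgp)] at hA00
      rw [intervalIntegral.integral_of_le zero_le_one]
      refine integral_eq_zero_of_ae ?_
      filter_upwards [hA00] with t ht
      have ht' : ‖g t‖ ^ p = 0 := ht
      rw [Real.rpow_eq_zero (norm_nonneg _) (by linarith)] at ht'
      exact ht'
    have hc : ∀ n, ‖cutCoeff g x n‖ = 0 := fun n =>
      le_antisymm ((norm_cutCoeff_le hgi (hx n)).trans hz.le) (norm_nonneg _)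
    rw [← hA00]
    simp only [hc]
    rw [Real.zero_rpow (by linarith), Real.zero_rpow (by linarith)]
    simp
  · have hlev : ∀ n, ∃ k : ℤ, cutCoeff g x n ≠ 0 →
        ‖cutCoeff g x n‖ ^ θ ∈ Set.Ico ((2:ℝ) ^ k) (2 ^ (k + 1)) := by
      intro n
      by_cases hn : cutCoeff g x n = 0
      · exact ⟨0, fun h => absurd hn h⟩
      · obtain ⟨k, hk⟩ := exists_mem_Ico_zpow (y := (2:ℝ))
          (show 0 < ‖cutCoeff g x n‖ ^ θ from Real.rpow_pos_of_pos (norm_pos_iff.2 hn) _)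
          one_lt_two
        exact ⟨k, fun _ => hk⟩
    choose k hk using hlev
    set D : ℝ := (2 * A) ^ θ with hD
    have hD0 : 0 < D := by positivity
    set X' := X.filter fun n => cutCoeff g x n ≠ 0 with hX'
    have e1 : ∑ n ∈ X, ‖cutCoeff g x n‖ ^ (θ + 2) = ∑ n ∈ X', ‖cutCoeff g x n‖ ^ (θ + 2) := by
      rw [hX', Finset.sum_filter_of_ne]
      intro n _ hne h0
      refine hne ?_
      rw [h0, norm_zero, Real.zero_rpow (by linarith)]
    set K := X'.image k with hK
    have e2 := Finset.sum_fiberwise_of_maps_to (s := X') (t := K) (g := k)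
      (fun n hn => Finset.mem_image_of_mem k hn) (fun n => ‖cutCoeff g x n‖ ^ (θ + 2))
    have hfib : ∀ j ∈ K, ∑ n ∈ X' with k n = j, ‖cutCoeff g x n‖ ^ (θ + 2) ≤
        ∫ t in (0:ℝ)..1, 8 * C * (2 ^ j * ‖lowPart p g (D / 2 ^ j) t‖ ^ 2) := by
      intro j _
      have hM0 : 0 ≤ D / 2 ^ j := by positivity
      have h3 := h2 x hx _ (hg.indicator (measurableSet_rpow_le (p := p) (M := D / 2 ^ j) hg))
        (intervalIntegrable_lowPart_sq hp1 hp2 hM0 hg hgp) (X'.filter fun n => k n = j)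
      rw [intervalIntegral.integral_const_mul, intervalIntegral.integral_const_mul]
      have h4 : ∀ n ∈ X'.filter fun n => k n = j, ‖cutCoeff g x n‖ ^ (θ + 2) ≤
          2 ^ j * 8 * ‖cutCoeff (lowPart p g (D / 2 ^ j)) x n‖ ^ 2 := by
        intro n hn
        rw [Finset.mem_filter, hX', Finset.mem_filter] at hn
        obtain ⟨⟨_, hne⟩, rfl⟩ := hn
        obtain ⟨hk1, hk2⟩ := hk n hne
        have hl : ((2:ℝ) ^ k n) ^ θ⁻¹ ≤ ‖cutCoeff g x n‖ := by
          have := Real.rpow_le_rpow (by positivity) hk1 (inv_nonneg.2 hθ0.le)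
          rwa [← Real.rpow_mul (norm_nonneg _), mul_inv_cancel₀ hθ0.ne', Real.rpow_one] at this
        have hMeq : D / 2 ^ k n = (2 * A / ((2:ℝ) ^ k n) ^ θ⁻¹) ^ θ := by
          rw [Real.div_rpow (by positivity) (by positivity), ← Real.rpow_mul (by positivity),
            inv_mul_cancel₀ hθ0.ne', Real.rpow_one]
        have h5 := norm_cutCoeff_le_two_mul_lowPart hp1 hp2 (by positivity) hA0 hg hgp rfl hMeq
          (hx n) hl
        have h6 := pow_le_pow_left₀ (norm_nonneg _) h5 2
        rw [Real.rpow_add_of_nonneg (norm_nonneg _) hθ0.le (by norm_num), Real.rpow_two]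
        rw [zpow_add_one₀ two_ne_zero] at hk2
        calc _ ≤ 2 ^ k n * 2 * (2 * ‖cutCoeff (lowPart p g (D / 2 ^ k n)) x n‖) ^ 2 :=
              mul_le_mul hk2.le h6 (by positivity) (by positivity)
          _ = _ := by ring
      refine (Finset.sum_le_sum h4).trans ?_
      rw [← Finset.mul_sum]
      calc _ ≤ 2 ^ j * 8 * (C * ∫ t in (0:ℝ)..1, ‖lowPart p g (D / 2 ^ j) t‖ ^ 2) :=
            mul_le_mul_of_nonneg_left h3 (by positivity)
        _ = _ := by ring
    rw [e1, ← e2]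
    refine (Finset.sum_le_sum hfib).trans ?_
    have hint : ∀ j : ℤ, IntervalIntegrable
        (fun t => 8 * C * (2 ^ j * ‖lowPart p g (D / 2 ^ j) t‖ ^ 2)) volume 0 1 := fun j =>
      ((intervalIntegrable_lowPart_sq hp1 hp2 (by positivity) hg hgp).const_mul _).const_mul _
    rw [← intervalIntegral.integral_finsetSum fun j _ => hint j]
    calc _ ≤ ∫ t in (0:ℝ)..1, 16 * C * D * ‖g t‖ ^ p := by
          refine intervalIntegral.integral_mono_on zero_le_one ?_ (hgp.const_mul _) fun t _ => ?_
          · have := IntervalIntegrable.sum K fun j (_ : j ∈ K) => hint j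
            simpa only [Finset.sum_fn] using this
          · have h7 := sum_two_zpow_mul_le K
              (show 0 ≤ ‖g t‖ ^ (2 - p) by positivity) hD0.le
            rw [Finset.sum_filter] at h7
            have h8 : ∀ j ∈ K, 8 * C * (2 ^ j * ‖lowPart p g (D / 2 ^ j) t‖ ^ 2) =
                8 * C * ‖g t‖ ^ p * (if (2:ℝ) ^ j * ‖g t‖ ^ (2 - p) ≤ D then
                  (2:ℝ) ^ j * ‖g t‖ ^ (2 - p) else 0) := by
              intro j _
              have hiff : (2:ℝ) ^ j * ‖g t‖ ^ (2 - p) ≤ D ↔ ‖g t‖ ^ (2 - p) ≤ D / 2 ^ j := by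
                rw [le_div_iff₀ (by positivity), mul_comm]
              unfold lowPart
              by_cases hj : ‖g t‖ ^ (2 - p) ≤ D / 2 ^ j
              · rw [if_pos (hiff.2 hj), Set.indicator_of_mem (by exact hj),
                  ← rpow_mul_rpow_two_sub hp1 hp2 (norm_nonneg (g t))]
                ring
              · rw [if_neg (mt hiff.1 hj), Set.indicator_of_notMem (by exact hj)]
                simp
            rw [Finset.sum_congr rfl h8, ← Finset.mul_sum]
            calc _ ≤ 8 * C * ‖g t‖ ^ p * (2 * D) :=
                  mul_le_mul_of_nonneg_left h7 (by positivity)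
              _ = _ := by ring
      _ = 16 * C * D * A := by rw [intervalIntegral.integral_const_mul]
      _ = _ := by
        rw [hD, Real.mul_rpow (by norm_num) hA0.le,
          Real.rpow_add_of_nonneg hA0.le hθ0.le zero_le_one, Real.rpow_one]
        ring

lemma exists_sum_rpow_cutCoeff_le {p : ℝ} (hp1 : 1 < p) (hp2 : p ≤ 2) :
    ∃ C : ℝ, 0 < C ∧ ∀ x : ℤ → ℝ, (∀ n, x n ∈ Set.Icc (0:ℝ) 1) → ∀ g : ℝ → ℂ, Measurable g →
      IntervalIntegrable (fun t => ‖g t‖ ^ p) volume 0 1 → ∀ X : Finset ℤ,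
      ∑ n ∈ X, ‖cutCoeff g x n‖ ^ (p / (p - 1)) ≤
        C * (∫ t in (0:ℝ)..1, ‖g t‖ ^ p) ^ (1 / (p - 1)) := by
  rcases hp2.eq_or_lt with rfl | hp2
  · obtain ⟨C, hC, h⟩ := exists_sum_sq_cutCoeff_le
    refine ⟨C, hC, fun x hx g hg hgp X => ?_⟩
    norm_num at hgp ⊢
    exact h x hx g hg hgp X
  · exact exists_sum_rpow_cutCoeff_le_of_lt hp1 hp2

/-! ### Passing from integers to rectangles -/

lemma exp_eq_sub_integral (μ : ℂ) (t x : ℝ) :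
    Complex.exp (Complex.I * μ * t) = Complex.exp (Complex.I * μ * x) -
      ∫ r in t..x, Complex.I * μ * Complex.exp (Complex.I * μ * r) := by
  have h : ∀ r ∈ Set.uIcc t x, HasDerivAt (fun r : ℝ => Complex.exp (Complex.I * μ * r))
      (Complex.I * μ * Complex.exp (Complex.I * μ * r)) r := by
    intro r _
    have h1 : HasDerivAt (fun r : ℝ => Complex.I * μ * (r : ℂ)) (Complex.I * μ * 1) r :=
      (Complex.ofRealCLM.hasDerivAt (x := r)).const_mul _
    simpa [mul_comm] using h1.cexp
  rw [intervalIntegral.integral_eq_sub_of_hasDerivAt h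
    (Continuous.intervalIntegrable (by fun_prop) _ _)]
  ring

lemma norm_exp_mul_le (μ : ℂ) {t : ℝ} (ht : t ∈ Set.Icc (0:ℝ) 1) :
    ‖Complex.exp (Complex.I * μ * t)‖ ≤ Real.exp ‖μ‖ := by
  refine (Complex.norm_exp_le_exp_norm _).trans (Real.exp_le_exp.2 ?_)
  rw [norm_mul, norm_mul, Complex.norm_I, one_mul, Complex.norm_real, Real.norm_of_nonneg ht.1]
  exact mul_le_of_le_one_right (norm_nonneg _) ht.2

lemma integral_mul_exp_eq {f : ℝ → ℂ} {x : ℝ} (hx : 0 ≤ x)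
    (hf : IntervalIntegrable f volume 0 x) (μ : ℂ) :
    ∫ t in (0:ℝ)..x, f t * Complex.exp (Complex.I * μ * t) =
      (∫ t in (0:ℝ)..x, f t) * Complex.exp (Complex.I * μ * x) -
        ∫ r in (0:ℝ)..x, (Complex.I * μ * Complex.exp (Complex.I * μ * r)) *
          ∫ t in (0:ℝ)..r, f t := by
  set ψ : ℝ → ℂ := fun r => Complex.I * μ * Complex.exp (Complex.I * μ * r) with hψ
  have hψc : Continuous ψ := by fun_prop
  have hf' : IntegrableOn f (Set.Ioc 0 x) :=
    (intervalIntegrable_iff_integrableOn_Ioc_of_le hx).1 hf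
  have hψi : IntegrableOn ψ (Set.Ioc 0 x) :=
    (intervalIntegrable_iff_integrableOn_Ioc_of_le hx).1 (hψc.intervalIntegrable _ _)
  have hprod : Integrable (Function.uncurry fun t r : ℝ => (Set.Ioi t).indicator ψ r * f t)
      ((volume.restrict (Set.Ioc 0 x)).prod (volume.restrict (Set.Ioc 0 x))) := by
    have h1 := hf'.mul_prod hψi
    have hs : MeasurableSet {z : ℝ × ℝ | z.1 < z.2} := measurableSet_lt measurable_fst measurable_snd
    refine (h1.indicator hs).congr (Filter.Eventually.of_forall fun z => ?_)
    obtain ⟨t, r⟩ := z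
    by_cases h : t < r
    · simp [Set.indicator, h, mul_comm]
    · simp [Set.indicator, h]
  have hswap := integral_integral_swap hprod
  have hleft : ∫ t in Set.Ioc 0 x, ∫ r in Set.Ioc 0 x, (Set.Ioi t).indicator ψ r * f t =
      ∫ t in (0:ℝ)..x, (∫ r in t..x, ψ r) * f t := by
    rw [intervalIntegral.integral_of_le hx]
    refine setIntegral_congr_fun measurableSet_Ioc fun t ht => ?_
    rw [integral_mul_const, setIntegral_indicator measurableSet_Ioi, Set.Ioc_inter_Ioi,
      max_eq_right ht.1.le, intervalIntegral.integral_of_le ht.2]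
  have hright : ∫ r in Set.Ioc 0 x, ∫ t in Set.Ioc 0 x, (Set.Ioi t).indicator ψ r * f t =
      ∫ r in (0:ℝ)..x, ψ r * ∫ t in (0:ℝ)..r, f t := by
    rw [intervalIntegral.integral_of_le hx]
    refine setIntegral_congr_fun measurableSet_Ioc fun r hr => ?_
    have e : ∀ t, (Set.Ioi t).indicator ψ r * f t = ψ r * (Set.Iio r).indicator f t := by
      intro t
      by_cases h : t < r
      · simp [Set.indicator, h]
      · simp [Set.indicator, h]
    simp_rw [e]
    rw [integral_const_mul, setIntegral_indicator measurableSet_Iio,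
      intervalIntegral.integral_of_le hr.1.le, integral_Ioc_eq_integral_Ioo]
    congr 3
    ext t
    simp only [Set.mem_inter_iff, Set.mem_Ioc, Set.mem_Iio, Set.mem_Ioo]
    exact ⟨fun h => ⟨h.1.1, h.2⟩, fun h => ⟨⟨h.1, h.2.le.trans hr.2⟩, h.2⟩⟩
  rw [hleft, hright] at hswap
  rw [← hswap]
  have e : ∀ t : ℝ, f t * Complex.exp (Complex.I * μ * t) =
      f t * Complex.exp (Complex.I * μ * x) - (∫ r in t..x, ψ r) * f t := by
    intro t
    rw [exp_eq_sub_integral μ t x]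
    ring
  have hI : Continuous fun t : ℝ => ∫ r in t..x, ψ r := by
    have : (fun t : ℝ => ∫ r in t..x, ψ r) = fun t => -∫ r in x..t, ψ r :=
      funext fun t => intervalIntegral.integral_symm _ _
    rw [this]
    exact (intervalIntegral.continuous_primitive
      (fun a b => hψc.intervalIntegrable a b) x).neg
  simp_rw [e]
  rw [intervalIntegral.integral_sub (hf.mul_const _) (hf.continuousOn_mul hI.continuousOn),
    intervalIntegral.integral_mul_const]

lemma norm_integral_mul_exp_le {f : ℝ → ℂ} (hf : IntervalIntegrable f volume 0 1) {M : ℝ}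
    (hM : ∀ x ∈ Set.Icc (0:ℝ) 1, ‖∫ t in (0:ℝ)..x, f t‖ ≤ M) (μ : ℂ) {x : ℝ}
    (hx : x ∈ Set.Icc (0:ℝ) 1) :
    ‖∫ t in (0:ℝ)..x, f t * Complex.exp (Complex.I * μ * t)‖ ≤
      (1 + ‖μ‖) * Real.exp ‖μ‖ * M := by
  have hM0 : 0 ≤ M := (norm_nonneg _).trans (hM x hx)
  have hfx : IntervalIntegrable f volume 0 x := hf.mono_set (by
    rw [Set.uIcc_of_le zero_le_one, Set.uIcc_of_le hx.1]
    exact Set.Icc_subset_Icc_right hx.2)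
  rw [integral_mul_exp_eq hx.1 hfx]
  have h1 : ‖(∫ t in (0:ℝ)..x, f t) * Complex.exp (Complex.I * μ * x)‖ ≤ M * Real.exp ‖μ‖ := by
    rw [norm_mul]
    exact mul_le_mul (hM x hx) (norm_exp_mul_le μ hx) (norm_nonneg _) hM0
  have h2 : ‖∫ r in (0:ℝ)..x, (Complex.I * μ * Complex.exp (Complex.I * μ * r)) *
      ∫ t in (0:ℝ)..r, f t‖ ≤ ‖μ‖ * Real.exp ‖μ‖ * M * |x - 0| := by
    refine intervalIntegral.norm_integral_le_of_norm_le_const fun r hr => ?_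
    rw [Set.uIoc_of_le hx.1] at hr
    have hr' : r ∈ Set.Icc (0:ℝ) 1 := ⟨hr.1.le, hr.2.trans hx.2⟩
    rw [norm_mul, norm_mul, norm_mul, Complex.norm_I, one_mul]
    exact mul_le_mul (mul_le_mul_of_nonneg_left (norm_exp_mul_le μ hr') (norm_nonneg _))
      (hM r hr') (norm_nonneg _) (by positivity)
  rw [sub_zero, abs_of_nonneg hx.1] at h2
  have h3 : ‖μ‖ * Real.exp ‖μ‖ * M * x ≤ ‖μ‖ * Real.exp ‖μ‖ * M :=
    mul_le_of_le_one_right (by positivity) hx.2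
  refine (norm_sub_le _ _).trans ?_
  linarith

lemma exists_forall_norm_integral_le_cutCoeff {g : ℝ → ℂ} (hg : IntervalIntegrable g volume 0 1) :
    ∃ x : ℤ → ℝ, (∀ n, x n ∈ Set.Icc (0:ℝ) 1) ∧ ∀ n : ℤ, ∀ y ∈ Set.Icc (0:ℝ) 1,
      ‖∫ t in (0:ℝ)..y, g t * ee (n * t)‖ ≤ ‖cutCoeff g x n‖ := by
  have h : ∀ n : ℤ, ∃ x ∈ Set.Icc (0:ℝ) 1, ∀ y ∈ Set.Icc (0:ℝ) 1,
      ‖∫ t in (0:ℝ)..y, g t * ee (n * t)‖ ≤ ‖∫ t in (0:ℝ)..x, g t * ee (n * t)‖ := by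
    intro n
    have hi : IntervalIntegrable (fun t => g t * ee (n * t)) volume 0 1 :=
      intervalIntegrable_mul_ee hg (by simp)
    have hc := intervalIntegral.continuousOn_primitive_interval
      ((intervalIntegrable_iff' enorm_ne_top).1 hi)
    rw [Set.uIcc_of_le zero_le_one] at hc
    exact isCompact_Icc.exists_isMaxOn (Set.nonempty_Icc.2 zero_le_one) hc.norm
  choose x hx hmax using h
  exact ⟨x, hx, hmax⟩

lemma rectSup_nonneg (g : ℝ → ℂ) (h : ℝ) (n : ℤ) : 0 ≤ rectSup g h n := by
  refine Real.sSup_nonneg ?_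
  rintro y ⟨lam, -, -, rfl⟩
  exact Real.iSup_nonneg fun _ => norm_nonneg _

lemma rectSup_le {g : ℝ → ℂ} (hg : IntervalIntegrable g volume 0 1) {h : ℝ} (hh : 0 ≤ h) {n : ℤ}
    {M : ℝ} (hM : ∀ y ∈ Set.Icc (0:ℝ) 1, ‖∫ t in (0:ℝ)..y, g t * ee (n * t)‖ ≤ M) :
    rectSup g h n ≤ (2 + h) * Real.exp (1 + h) * M := by
  have hM0 : 0 ≤ M := (norm_nonneg _).trans (hM 0 (by simp))
  refine csSup_le ⟨maxFourier g n, n, by simp, by simp [hh], rfl⟩ ?_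
  rintro y ⟨lam, hre, him, rfl⟩
  have : Nonempty (Set.Icc (0:ℝ) 1) := ⟨⟨0, by simp⟩⟩
  refine ciSup_le fun x => ?_
  have hμ : ‖lam - n‖ ≤ 1 + h := by
    refine (Complex.norm_le_abs_re_add_abs_im _).trans ?_
    simp only [Complex.sub_re, Complex.sub_im, Complex.intCast_re, Complex.intCast_im, sub_zero]
    refine add_le_add (abs_le.2 ⟨by linarith [hre.1], by linarith [hre.2]⟩) (abs_le.2 him)
  have e : ∀ t : ℝ, g t * Complex.exp (Complex.I * lam * t) =
      g t * ee (n * t) * Complex.exp (Complex.I * (lam - n) * t) := by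
    intro t
    unfold ee
    rw [mul_assoc (g t), ← Complex.exp_add]
    congr 2
    push_cast
    ring
  simp_rw [e]
  refine (norm_integral_mul_exp_le (intervalIntegrable_mul_ee hg (by simp)) hM _ x.2).trans ?_
  refine mul_le_mul_of_nonneg_right ?_ hM0
  exact mul_le_mul (by linarith) (Real.exp_le_exp.2 hμ) (Real.exp_pos _).le (by linarith)

/-- For `p ∈ (1,2]` and `h ≥ 0` there is `C = C(p,h) > 0` such that
`∑_{n∈ℤ} g_n^{p'} ≤ C ‖g‖_p^{p'}` for every `g ∈ L^p[0,1]`. -/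
theorem stmt2 (p : ℝ) (hp1 : 1 < p) (hp2 : p ≤ 2) (h : ℝ) (hh : 0 ≤ h) :
    ∃ C : ℝ, 0 < C ∧ ∀ g : ℝ → ℂ, Measurable g →
      IntervalIntegrable (fun t => ‖g t‖ ^ p) volume 0 1 →
      ∀ F : Finset ℤ, ∑ n ∈ F, rectSup g h n ^ (p / (p - 1)) ≤
        C * lpNorm01 p g ^ (p / (p - 1)) := by
  obtain ⟨C, hC, hb⟩ := exists_sum_rpow_cutCoeff_le hp1 hp2
  set B := (2 + h) * Real.exp (1 + h)
  have hB : 0 < B := by positivity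
  have hp' : 0 < p - 1 := by linarith
  refine ⟨B ^ (p / (p - 1)) * C, by positivity, fun g hg hgp F => ?_⟩
  have hgi := intervalIntegrable_of_rpow hp1.le hg hgp
  obtain ⟨x, hx, hmax⟩ := exists_forall_norm_integral_le_cutCoeff hgi
  have hnorm : lpNorm01 p g ^ (p / (p - 1)) =
      (∫ t in (0:ℝ)..1, ‖g t‖ ^ p) ^ (1 / (p - 1)) := by
    unfold lpNorm01
    rw [← Real.rpow_mul (intervalIntegral.integral_nonneg zero_le_one fun t _ => by positivity)]
    congr 1
    field_simp
  rw [hnorm, mul_assoc]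
  calc ∑ n ∈ F, rectSup g h n ^ (p / (p - 1))
      ≤ ∑ n ∈ F, B ^ (p / (p - 1)) * ‖cutCoeff g x n‖ ^ (p / (p - 1)) := by
        refine Finset.sum_le_sum fun n _ => ?_
        rw [← Real.mul_rpow hB.le (norm_nonneg _)]
        exact Real.rpow_le_rpow (rectSup_nonneg g h n) (rectSup_le hgi hh (hmax n))
          (by positivity)
    _ = B ^ (p / (p - 1)) * ∑ n ∈ F, ‖cutCoeff g x n‖ ^ (p / (p - 1)) := by rw [Finset.mul_sum]
    _ ≤ _ := mul_le_mul_of_nonneg_left (hb x hx g hg hgp F) (by positivity)
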